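/- (Neukirch 1969, Uchida 1976) Let K and L be number fields, and let G_K = Gal(K̄/K) and G_L = Gal(L̄/L) be their absolute Galois groups with the Krull topology. If there exists an isomorphism of topological groups G_K ≅ G_L, then K and L are isomorphic as fields. -/

import Mathlib

set_option linter.style.haveILetI false
set_option linter.unusedSectionVars false
set_option linter.unusedVariables false

namespace NU

/-- The group of square classes, abstractly. -/
abbrev V4 := ZMod 2 × ZMod 2

theorem V4.add_self (a : V4) : a + a = 0 := by revert a; decide

theorem V4.third {a b c : V4} (ha : a ≠ 0) (hb : b ≠ 0) (hab : a ≠ b) (hc : c ≠ 0)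
    (hca : c ≠ a) (hcb : c ≠ b) : c = a + b := by
  revert a b c; decide

theorem V4.add_ne_zero {a b : V4} (hab : a ≠ b) : a + b ≠ 0 := by
  revert a b; decide

theorem V4.add_ne_left {a b : V4} (hb : b ≠ 0) : a + b ≠ a := by
  revert a b; decide

theorem V4.add_ne_right {a b : V4} (ha : a ≠ 0) : a + b ≠ b := by
  revert a b; decide

section AEJ

variable {F : Type*} [Field F] (cl : F → V4)

/-- A class function on a field: multiplicative and rigid. -/
structure Rigid : Prop where
  mul : ∀ x y : F, x ≠ 0 → y ≠ 0 → cl (x * y) = cl x + cl y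
  add : ∀ x y : F, x ≠ 0 → y ≠ 0 → cl x ≠ cl y → cl (x + y) = cl x ∨ cl (x + y) = cl y
  neg_one : cl (-1) = 0
  surj : ∀ v : V4, ∃ x : F, x ≠ 0 ∧ cl x = v

/-- small elements -/
def Small (x : F) : Prop := x ≠ 0 ∧ cl x ≠ 0 ∧ cl (1 + x) = 0

variable {cl}

theorem Rigid.one (hr : Rigid cl) : cl 1 = 0 := by
  have := hr.mul (-1) (-1) (by simp) (by simp)
  simpa [hr.neg_one] using this

theorem Rigid.neg (hr : Rigid cl) {x : F} (hx : x ≠ 0) : cl (-x) = cl x := by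
  have := hr.mul (-1) x (by simp) hx
  simpa [hr.neg_one] using this

theorem Rigid.inv (hr : Rigid cl) {x : F} (hx : x ≠ 0) : cl x⁻¹ = cl x := by
  have := hr.mul x x⁻¹ hx (by simpa using hx)
  rw [mul_inv_cancel₀ hx, hr.one] at this
  have h2 := V4.add_self (cl x)
  calc cl x⁻¹ = (cl x + cl x) + cl x⁻¹ := by rw [h2, zero_add]
    _ = cl x + (cl x + cl x⁻¹) := by rw [add_assoc]
    _ = cl x := by rw [← this, add_zero]

theorem Rigid.div (hr : Rigid cl) {x y : F} (hx : x ≠ 0) (hy : y ≠ 0) : cl (x / y) = cl x + cl y := by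
  rw [div_eq_mul_inv, hr.mul _ _ hx (by simpa using hy), hr.inv hy]

theorem Rigid.add_ne (hr : Rigid cl) {x y : F} (hy : y ≠ 0) (h : cl x ≠ cl y) : x + y ≠ 0 := by
  intro h0
  have : x = -y := by linear_combination h0
  rw [this, hr.neg hy] at h
  exact h rfl

theorem Rigid.small_or (hr : Rigid cl) {x : F} (hx : x ≠ 0) (hc : cl x ≠ 0) : Small cl x ∨ Small cl x⁻¹ := by
  have h1 := hr.add 1 x one_ne_zero hx (by rw [hr.one]; exact hc.symm)
  rw [hr.one] at h1
  rcases h1 with h1 | h1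
  · exact Or.inl ⟨hx, hc, h1⟩
  · right
    refine ⟨by simpa using hx, by rw [hr.inv hx]; exact hc, ?_⟩
    have h2 : 1 + x⁻¹ = x⁻¹ * (1 + x) := by field_simp; ring
    have h3 : (1 + x) ≠ 0 := hr.add_ne hx (by rw [hr.one]; exact hc.symm)
    rw [h2, hr.mul _ _ (by simpa using hx) h3, hr.inv hx, h1, V4.add_self]

theorem Rigid.small_inv (hr : Rigid cl) {x : F} (h1 : Small cl x) (h2 : Small cl x⁻¹) : False := by
  obtain ⟨hx, hc, h⟩ := h1
  obtain ⟨_, _, hq⟩ := h2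
  have h2 : 1 + x⁻¹ = x⁻¹ * (1 + x) := by field_simp; ring
  have h3 : (1 + x) ≠ 0 := hr.add_ne hx (by rw [hr.one]; exact hc.symm)
  rw [h2, hr.mul _ _ (by simpa using hx) h3, hr.inv hx, h, add_zero] at hq
  exact hc hq

/-- the product lemma -/
theorem Rigid.small_mul (hr : Rigid cl) {x y : F} (h1 : Small cl x) (h2 : Small cl y) (h : cl x ≠ cl y) :
    Small cl (x * y) := by
  obtain ⟨hx, hcx, h1⟩ := h1
  obtain ⟨hy, hcy, h2⟩ := h2
  have hxy : x * y ≠ 0 := mul_ne_zero hx hy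
  have hm := hr.mul x y hx hy
  have hc : cl (x * y) ≠ 0 := by rw [hm]; exact V4.add_ne_zero h
  refine ⟨hxy, hc, ?_⟩
  have h1x : (1 + x) ≠ 0 := hr.add_ne hx (by rw [hr.one]; exact hcx.symm)
  have h1y : (1 + y) ≠ 0 := hr.add_ne hy (by rw [hr.one]; exact hcy.symm)
  have h1xy : (1 + x * y) ≠ 0 := hr.add_ne hxy (by rw [hr.one]; exact hc.symm)
  have a1 := hr.add 1 (x * y) one_ne_zero hxy (by rw [hr.one]; exact hc.symm)
  rw [hr.one] at a1
  rcases a1 with a1 | a1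
  · exact a1
  exfalso
  have e1 : 1 + x + x * y = 1 + x * (1 + y) := by ring
  have e2 : 1 + x + x * y = (1 + x * y) + x := by ring
  have b1 : cl (x * (1 + y)) = cl x := by rw [hr.mul _ _ hx h1y, h2, add_zero]
  have b2 := hr.add 1 (x * (1 + y)) one_ne_zero (mul_ne_zero hx h1y)
    (by rw [hr.one, b1]; exact hcx.symm)
  rw [b1, hr.one, ← e1] at b2
  have b3 := hr.add (1 + x) (x * y) h1x hxy (by rw [h1]; exact hc.symm)
  have b4 := hr.add (1 + x * y) x h1xy hx (by rw [a1, hm]; exact V4.add_ne_left hcy)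
  rw [← e2, a1] at b4
  rw [h1] at b3
  have hne : cl x ≠ cl (x * y) := by rw [hm]; exact (V4.add_ne_left hcy).symm
  clear a1
  generalize cl (1 + x + x * y) = v at *
  generalize cl (x * y) = w at *
  generalize cl x = z at *
  rcases b2 with rfl | rfl <;> rcases b3 with b3 | b3 <;> rcases b4 with b4 | b4 <;>
    first
    | exact hcx b3
    | exact hc b4.symm
    | exact hcx b4.symm
    | exact hne b3
    | exact hne b4
    | exact hc b3.symm

/-- If `x`, `u` are small in different classes then `(1+x)u` is small. -/
theorem Rigid.small_one_add_mul (hr : Rigid cl) {x u : F} (h1 : Small cl x) (h2 : Small cl u) (h : cl x ≠ cl u) :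
    Small cl ((1 + x) * u) := by
  have h3 := hr.small_mul h1 h2 h
  obtain ⟨hx, hcx, h1⟩ := h1
  obtain ⟨hu, hcu, h2⟩ := h2
  obtain ⟨hxu, hcxu, h3⟩ := h3
  have h1x : (1 + x) ≠ 0 := hr.add_ne hx (by rw [hr.one]; exact hcx.symm)
  have h1u : (1 + u) ≠ 0 := hr.add_ne hu (by rw [hr.one]; exact hcu.symm)
  have hm : cl ((1 + x) * u) = cl u := by rw [hr.mul _ _ h1x hu, h1, zero_add]
  refine ⟨mul_ne_zero h1x hu, by rw [hm]; exact hcu, ?_⟩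
  have e : 1 + (1 + x) * u = (1 + u) + x * u := by ring
  have b1 := hr.add 1 ((1 + x) * u) one_ne_zero (mul_ne_zero h1x hu)
    (by rw [hr.one, hm]; exact hcu.symm)
  have b2 := hr.add (1 + u) (x * u) h1u hxu (by rw [h2]; exact hcxu.symm)
  rw [hr.one, hm, e] at b1
  rw [h2] at b2
  have hne : cl u ≠ cl (x * u) := by
    rw [hr.mul _ _ hx hu]; exact (V4.add_ne_right hcx).symm
  rw [e]
  rcases b1 with b1 | b1 <;> rcases b2 with b2 | b2 <;> simp_all

variable (cl) in
/-- exceptional classes -/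
def Exc (b : V4) : Prop := ∃ x y : F, x ≠ 0 ∧ cl x = 0 ∧ Small cl y ∧ cl y = b ∧
  ¬ Small cl (x * y) ∧
  ∀ w, Small cl w → cl w ≠ b → Small cl (x * w) ∧ Small cl (x⁻¹ * w)

theorem Rigid.exc_unique (hr : Rigid cl) {b c : V4} (hb : Exc cl b) (hc : Exc cl c) : b = c := by
  by_contra hbc
  obtain ⟨x, y, hx, hx0, hy, hyb, hxy, hw⟩ := hb
  obtain ⟨x', y', hx', hx0', hy', hyb', hxy', hw'⟩ := hc
  -- general half
  have key : ∀ x y y' : F, ∀ b c : V4, x ≠ 0 → cl x = 0 → Small cl y → cl y = b →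
      ¬ Small cl (x * y) → (∀ w, Small cl w → cl w ≠ b → Small cl (x * w)) →
      Small cl y' → cl y' = c → b ≠ c → Small cl (y' / y) := by
    intro x y y' b c hx hx0 hy hyb hxy hw hy' hyc hbc
    have hxy0 : x * y ≠ 0 := mul_ne_zero hx hy.1
    have hcxy : cl (x * y) = b := by rw [hr.mul _ _ hx hy.1, hx0, zero_add, hyb]
    have hb0 : b ≠ 0 := by rw [← hyb]; exact hy.2.1
    have hs : Small cl (x * y)⁻¹ := by
      rcases hr.small_or hxy0 (by rw [hcxy]; exact hb0) with h | h
      · exact absurd h hxy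
      · exact h
    have hcs : cl (x * y)⁻¹ = b := by rw [hr.inv hxy0, hcxy]
    have h1 := hr.small_mul hs hy' (by rw [hcs, hyc]; exact hbc)
    have h2 := hw _ h1 (by
      rw [hr.mul _ _ hs.1 hy'.1, hcs, hyc]
      exact V4.add_ne_left (by rw [← hyc]; exact hy'.2.1))
    have e : x * ((x * y)⁻¹ * y') = y' / y := by
      have := hy.1
      field_simp
    rwa [e] at h2
  have h1 := key x y y' b c hx hx0 hy hyb hxy (fun w h h' => (hw w h h').1) hy' hyb' hbc
  have h2 := key x' y' y c b hx' hx0' hy' hyb' hxy' (fun w h h' => (hw' w h h').1) hy hyb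
    (Ne.symm hbc)
  rw [← inv_div] at h2
  exact hr.small_inv h1 h2

/-- If `x y` is not small and `z / x` is not small with `y, z` small, then `y, z` have the same
class (here the class of `x` is neither that of `y` nor that of `z`). -/
theorem Rigid.same_class (hr : Rigid cl) {x y z : F} (hx : x ≠ 0) (hy : Small cl y) (hz : Small cl z)
    (hcy : cl x ≠ cl y) (hcz : cl x ≠ cl z) (hxy : ¬ Small cl (x * y))
    (hxz : ¬ Small cl (x⁻¹ * z)) : cl y = cl z := by
  by_contra hne
  have hxy0 : x * y ≠ 0 := mul_ne_zero hx hy.1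
  have hxz0 : x⁻¹ * z ≠ 0 := mul_ne_zero (inv_ne_zero hx) hz.1
  have c1 : cl (x * y) = cl x + cl y := hr.mul _ _ hx hy.1
  have c2 : cl (x⁻¹ * z) = cl x + cl z := by rw [hr.mul _ _ (inv_ne_zero hx) hz.1, hr.inv hx]
  have s1 : Small cl (x * y)⁻¹ := (hr.small_or hxy0
    (by rw [c1]; exact V4.add_ne_zero hcy)).resolve_left hxy
  have s2 : Small cl (x⁻¹ * z)⁻¹ := (hr.small_or hxz0
    (by rw [c2]; exact V4.add_ne_zero hcz)).resolve_left hxz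
  have s3 := hr.small_mul s1 s2 (by
    rw [hr.inv hxy0, hr.inv hxz0, c1, c2]
    intro h; exact hne (add_left_cancel h))
  have e : (x * y)⁻¹ * (x⁻¹ * z)⁻¹ = (y * z)⁻¹ := by
    have := hy.1; have := hz.1
    field_simp
  rw [e] at s3
  exact hr.small_inv (hr.small_mul hy hz hne) s3

/-- E1 -/
theorem Rigid.exc1 (hr : Rigid cl) {x y z : F} (hx : x ≠ 0) (hx0 : cl x = 0) (hy : Small cl y) (hz : Small cl z)
    (hxy : ¬ Small cl (x * y)) (hxz : ¬ Small cl (x⁻¹ * z)) : Exc cl (cl y) := by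
  have hyz : cl y = cl z := hr.same_class hx hy hz (by rw [hx0]; exact hy.2.1.symm)
    (by rw [hx0]; exact hz.2.1.symm) hxy hxz
  refine ⟨x, y, hx, hx0, hy, rfl, hxy, fun w hw hwb => ⟨?_, ?_⟩⟩
  · by_contra h
    have := hr.same_class hx hw hz (by rw [hx0]; exact hw.2.1.symm)
      (by rw [hx0]; exact hz.2.1.symm) h hxz
    exact hwb (this.trans hyz.symm)
  · by_contra h
    have := hr.same_class hx hy hw (by rw [hx0]; exact hy.2.1.symm)
      (by rw [hx0]; exact hw.2.1.symm) hxy h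
    exact hwb this.symm

/-- E2 -/
theorem Rigid.exc2 (hr : Rigid cl) {u s : F} (hu : Small cl u) (hs : Small cl s) (hus : cl u = cl s)
    (h : cl (1 - u * s) ≠ 0) : Exc cl (cl u) := by
  have hus0 : u * s ≠ 0 := mul_ne_zero hu.1 hs.1
  have hn : cl (u * s) = 0 := by rw [hr.mul _ _ hu.1 hs.1, hus, V4.add_self]
  have hr0 : 1 - u * s ≠ 0 := by
    intro h0
    have : u⁻¹ = s := by
      have := hu.1
      field_simp
      linear_combination h0
    rw [← this] at hs
    exact hr.small_inv hu hs
  set x := (1 - u * s) / (u * s) with hxdef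
  have hx0 : x ≠ 0 := div_ne_zero hr0 hus0
  have h1x : 1 + x = (u * s)⁻¹ := by
    apply eq_inv_of_mul_eq_one_left; rw [hxdef, add_mul, div_mul_cancel₀ _ hus0]; ring
  have hcx : cl x = cl (1 - u * s) := by rw [hxdef, hr.div hr0 hus0, hn, add_zero]
  have hxs : Small cl x := ⟨hx0, by rw [hcx]; exact h, by rw [h1x, hr.inv hus0, hn]⟩
  have hxu : cl x = cl u := by
    by_contra hne
    have h2 := hr.small_one_add_mul hxs hs (by rw [← hus]; exact hne)
    have e : (1 + x) * s = u⁻¹ := by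
      rw [h1x]; have := hu.1; have := hs.1; field_simp
    rw [e] at h2
    exact hr.small_inv hu h2
  refine ⟨(u * s)⁻¹, u, inv_ne_zero hus0, by rw [hr.inv hus0, hn], hu, rfl, ?_, ?_⟩
  · have e : (u * s)⁻¹ * u = s⁻¹ := by have := hu.1; have := hs.1; field_simp
    rw [e]
    exact fun h => hr.small_inv hs h
  · intro w hw hwb
    refine ⟨?_, ?_⟩
    · rw [← h1x]
      exact hr.small_one_add_mul hxs hw (by rw [hxu]; exact hwb.symm)
    · rw [inv_inv, mul_assoc]
      refine hr.small_mul hu (hr.small_mul hs hw (by rw [← hus]; exact hwb.symm)) ?_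
      rw [hr.mul _ _ hs.1 hw.1, ← hus]
      exact (V4.add_ne_left hw.2.1).symm

/-- The set `A`. -/
theorem V4.mem_compl {a b c : V4} (ha : a ≠ 0) (hb : b ≠ 0) (hba : b ≠ a) (hc : c ≠ 0)
    (hca : c ≠ a) : b = c ∨ b + c = a := by
  by_contra h
  push Not at h
  exact h.2 (V4.third hb hc h.1 ha hba.symm hca.symm).symm

theorem V4.add_H {a b c : V4} (hb : b ≠ 0) (hba : b ≠ a) (hc : c = 0 ∨ c = a) :
    c + b ≠ 0 ∧ c + b ≠ a := by
  revert a b c; decide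

theorem V4.H_add {a b c : V4} (hb : b = 0 ∨ b = a) (hc : c = 0 ∨ c = a) :
    c + b = 0 ∨ c + b = a := by
  revert a b c; decide

/-- The valuation ring theorem (Arason, Elman, Jacob in the rank two case). -/
theorem Rigid.exists_valuationSubring (hr : Rigid cl) :
    ∃ O : ValuationSubring F, O ≠ ⊤ ∧ ∀ x ∈ O, x ≠ 0 → x⁻¹ ∉ O → cl (1 + x) = 0 := by
  obtain ⟨a, ha0, hexc⟩ : ∃ a : V4, a ≠ 0 ∧ ∀ b, b ≠ 0 → b ≠ a → ¬ Exc cl b := by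
    by_cases h : ∃ b, Exc cl b
    · obtain ⟨b, hb⟩ := h
      refine ⟨b, ?_, fun c _ hcb hc => hcb (hr.exc_unique hc hb)⟩
      obtain ⟨x, y, -, -, hy, hyb, -⟩ := hb
      rw [← hyb]; exact hy.2.1
    · exact ⟨(1, 0), by decide, fun b _ _ hb => h ⟨b, hb⟩⟩
  set A : Set F := {y | Small cl y ∧ cl y ≠ a} with hA
  set P : Set F := {x | x ≠ 0 ∧ (cl x = 0 ∨ cl x = a) ∧ ∀ y ∈ A, Small cl (x * y)} with hP
  have hPA : ∀ x ∈ P, ∀ y ∈ A, x * y ∈ A := by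
    intro x hx y hy
    refine ⟨hx.2.2 y hy, ?_⟩
    rw [hr.mul _ _ hx.1 hy.1.1]
    exact (V4.add_H hy.1.2.1 hy.2 hx.2.1).2
  have hne : ∀ x : F, (cl x = 0 ∨ cl x = a) → ∀ y ∈ A, cl x ≠ cl y := by
    rintro x (h | h) y hy <;> rw [h]
    · exact hy.1.2.1.symm
    · exact hy.2.symm
  -- (1)
  have h1 : ∀ x : F, x ≠ 0 → (cl x = 0 ∨ cl x = a) → x ∈ P ∨ x⁻¹ ∈ P := by
    intro x hx hcx
    by_contra hcon
    push Not at hcon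
    obtain ⟨hx1, hx2⟩ := hcon
    have e1 : ∃ y ∈ A, ¬ Small cl (x * y) := by
      by_contra h; push Not at h; exact hx1 ⟨hx, hcx, h⟩
    have e2 : ∃ z ∈ A, ¬ Small cl (x⁻¹ * z) := by
      by_contra h; push Not at h
      exact hx2 ⟨inv_ne_zero hx, by rw [hr.inv hx]; exact hcx, h⟩
    obtain ⟨y, hy, hxy⟩ := e1
    obtain ⟨z, hz, hxz⟩ := e2
    have hyz := hr.same_class hx hy.1 hz.1 (hne x hcx y hy) (hne x hcx z hz) hxy hxz
    rcases id hcx with hcx' | hcx'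
    · exact hexc _ hy.1.2.1 hy.2 (hr.exc1 hx hcx' hy.1 hz.1 hxy hxz)
    · have hxy0 : x * y ≠ 0 := mul_ne_zero hx hy.1.1
      have c1 : cl (x * y) = cl x + cl y := hr.mul _ _ hx hy.1.1
      have c2 := V4.add_H hy.1.2.1 hy.2 hcx
      have s1 : Small cl (x * y)⁻¹ := (hr.small_or hxy0 (by rw [c1]; exact c2.1)).resolve_left hxy
      have hwA : (x * y)⁻¹ ∈ A := ⟨s1, by rw [hr.inv hxy0, c1]; exact c2.2⟩
      have s2 : Small cl (x * (x * y)⁻¹) := by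
        by_contra h
        have h3 := hr.same_class hx s1 hz.1 (hne x hcx _ hwA) (hne x hcx z hz) h hxz
        rw [hr.inv hxy0, c1, ← hyz, hcx'] at h3
        exact V4.add_ne_right ha0 h3
      have e : x * (x * y)⁻¹ = y⁻¹ := by have := hy.1.1; field_simp
      rw [e] at s2
      exact hr.small_inv hy.1 s2
  -- (2)
  have h2 : ∀ y ∈ A, ∀ z ∈ A, y * z ∈ P := by
    intro y hy z hz
    have hm := hr.mul y z hy.1.1 hz.1.1
    have h0 : y * z ≠ 0 := mul_ne_zero hy.1.1 hz.1.1
    by_cases hyz : cl y = cl z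
    · have hc0 : cl (y * z) = 0 := by rw [hm, hyz, V4.add_self]
      refine ⟨h0, Or.inl hc0, fun w hw => ?_⟩
      by_cases hwy : cl w = cl y
      · by_contra h
        have h3 : ¬ Small cl ((y * z)⁻¹ * y) := by
          have e : (y * z)⁻¹ * y = z⁻¹ := by have := hy.1.1; have := hz.1.1; field_simp
          rw [e]; exact fun h => hr.small_inv hz.1 h
        exact hexc _ hw.1.2.1 hw.2 (hr.exc1 h0 hc0 hw.1 hy.1 h h3)
      · rw [mul_assoc]
        refine hr.small_mul hy.1 (hr.small_mul hz.1 hw.1 (by rw [← hyz]; exact Ne.symm hwy)) ?_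
        rw [hr.mul _ _ hz.1.1 hw.1.1, ← hyz]
        exact (V4.add_ne_left hw.1.2.1).symm
    · have hca : cl (y * z) = a := by
        rw [hm]
        exact (V4.mem_compl ha0 hy.1.2.1 hy.2 hz.1.2.1 hz.2).resolve_left hyz
      exact ⟨h0, Or.inr hca, fun w hw => hr.small_mul (hr.small_mul hy.1 hz.1 hyz) hw.1
        (hne _ (Or.inr hca) w hw)⟩
  have hPP : ∀ x ∈ P, ∀ y ∈ P, x * y ∈ P := by
    intro x hx y hy
    refine ⟨mul_ne_zero hx.1 hy.1, ?_, fun w hw => ?_⟩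
    · rw [hr.mul _ _ hx.1 hy.1]; exact V4.H_add hy.2.1 hx.2.1
    · rw [mul_assoc]; exact hx.2.2 _ (hPA y hy w hw)
  have hneg1 : (-1 : F) ∈ P := by
    have := h1 (-1) (by simp) (Or.inl hr.neg_one)
    rwa [inv_neg, inv_one, or_self] at this
  have hone : (1 : F) ∈ P := ⟨one_ne_zero, Or.inl hr.one, fun y hy => by rw [one_mul]; exact hy.1⟩
  have hnegA : ∀ y ∈ A, -y ∈ A := fun y hy => by
    have := hPA _ hneg1 y hy
    rwa [neg_one_mul] at this
  -- (3)
  have h3 : ∀ x ∈ A, (1 + x) ∈ P := by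
    intro x hx
    have h1x : (1 + x) ≠ 0 := hr.add_ne hx.1.1 (by rw [hr.one]; exact hx.1.2.1.symm)
    refine ⟨h1x, Or.inl hx.1.2.2, fun u hu => ?_⟩
    by_cases hxu : cl x = cl u
    · by_contra h
      have h0 : (1 + x) * u ≠ 0 := mul_ne_zero h1x hu.1.1
      have hc : cl ((1 + x) * u) = cl u := by rw [hr.mul _ _ h1x hu.1.1, hx.1.2.2, zero_add]
      have s1 : Small cl ((1 + x) * u)⁻¹ := (hr.small_or h0
        (by rw [hc]; exact hu.1.2.1)).resolve_left h
      have e : 1 - u * ((1 + x) * u)⁻¹ = x / (1 + x) := by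
        have := hu.1.1
        field_simp
        ring
      refine hexc _ hu.1.2.1 hu.2 (hr.exc2 hu.1 s1 (by rw [hr.inv h0, hc]) ?_)
      rw [e, hr.div hx.1.1 h1x, hx.1.2.2, add_zero]
      exact hx.1.2.1
    · exact hr.small_one_add_mul hx.1 hu.1 hxu
  have h4 : ∀ y ∈ A, (1 + y)⁻¹ ∈ P := by
    intro y hy
    have h1y : (1 + y) ≠ 0 := (h3 y hy).1
    have hq0 : y / (1 + y) ≠ 0 := div_ne_zero hy.1.1 h1y
    have hcq : cl (y / (1 + y)) = cl y := by rw [hr.div hy.1.1 h1y, hy.1.2.2, add_zero]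
    have e : 1 + -(y / (1 + y)) = (1 + y)⁻¹ := by field_simp; ring
    have hq : -(y / (1 + y)) ∈ A := by
      refine ⟨⟨neg_ne_zero.2 hq0, ?_, ?_⟩, ?_⟩
      · rw [hr.neg hq0, hcq]; exact hy.1.2.1
      · rw [e, hr.inv h1y, hy.1.2.2]
      · rw [hr.neg hq0, hcq]; exact hy.2
    have := h3 _ hq
    rwa [e] at this
  have h5 : ∀ x ∈ P, 1 + x = 0 ∨ 1 + x ∈ A ∨ 1 + x ∈ P := by
    intro x hx
    by_cases h0 : 1 + x = 0
    · exact Or.inl h0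
    right
    by_cases hH : cl (1 + x) = 0 ∨ cl (1 + x) = a
    · refine Or.inr ⟨h0, hH, fun y hy => ?_⟩
      have hy' := hPA x hx y hy
      have h6 := hPA _ (h4 y hy) _ hy'
      have h1y := (h3 y hy).1
      have e : 1 + (1 + x) * y = (1 + y) * (1 + (1 + y)⁻¹ * (x * y)) := by
        field_simp; ring
      have hcy : cl ((1 + x) * y) = cl (1 + x) + cl y := hr.mul _ _ h0 hy.1.1
      refine ⟨mul_ne_zero h0 hy.1.1, ?_, ?_⟩
      · rw [hcy]; exact (V4.add_H hy.1.2.1 hy.2 hH).1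
      · rw [e, hr.mul _ _ h1y (h3 _ h6).1, hy.1.2.2, h6.1.2.2, add_zero]
    · push Not at hH
      rcases hr.small_or h0 hH.1 with hs | hs
      · exact Or.inl ⟨hs, hH.2⟩
      · exfalso
        have h6 : (1 + x)⁻¹ ∈ A := ⟨hs, by rw [hr.inv h0]; exact hH.2⟩
        have h7 := hPA x hx _ h6
        have h8 := h3 _ (hnegA _ h6)
        have e : 1 + -(1 + x)⁻¹ = x * (1 + x)⁻¹ := by field_simp; ring
        rw [e] at h8
        exact hne _ h8.2.1 _ h7 rfl
  set S : Set F := {x | x = 0 ∨ x ∈ A ∨ x ∈ P} with hS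
  have hSmul : ∀ x ∈ S, ∀ y ∈ S, x * y ∈ S := by
    rintro x (rfl | hx | hx) y (rfl | hy | hy)
    · left; simp
    · left; simp
    · left; simp
    · left; simp
    · right; right; exact h2 x hx y hy
    · right; left; rw [mul_comm]; exact hPA y hy x hx
    · left; simp
    · right; left; exact hPA x hx y hy
    · right; right; exact hPP x hx y hy
  have hSor : ∀ x : F, x ∈ S ∨ x⁻¹ ∈ S := by
    intro x
    by_cases hx : x = 0
    · left; left; exact hx
    by_cases hH : cl x = 0 ∨ cl x = a
    · rcases h1 x hx hH with h | h
      · exact Or.inl (Or.inr (Or.inr h))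
      · exact Or.inr (Or.inr (Or.inr h))
    · push Not at hH
      rcases hr.small_or hx hH.1 with h | h
      · exact Or.inl (Or.inr (Or.inl ⟨h, hH.2⟩))
      · exact Or.inr (Or.inr (Or.inl ⟨h, by rw [hr.inv hx]; exact hH.2⟩))
  have hSone : ∀ x ∈ S, 1 + x ∈ S := by
    rintro x (rfl | hx | hx)
    · rw [add_zero]; exact Or.inr (Or.inr hone)
    · exact Or.inr (Or.inr (h3 x hx))
    · exact h5 x hx
  have hSadd : ∀ x ∈ S, ∀ y ∈ S, x + y ∈ S := by
    intro x hx y hy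
    by_cases hx0 : x = 0
    · rw [hx0, zero_add]; exact hy
    by_cases hy0 : y = 0
    · rw [hy0, add_zero]; exact hx
    rcases hSor (y / x) with h | h
    · have := hSmul x hx _ (hSone _ h)
      have e : x * (1 + y / x) = x + y := by field_simp
      rwa [e] at this
    · rw [inv_div] at h
      have := hSmul y hy _ (hSone _ h)
      have e : y * (1 + x / y) = x + y := by field_simp; ring
      rwa [e] at this
  let O : ValuationSubring F :=
    { carrier := S
      mul_mem' := fun {x y} hx hy => hSmul x hx y hy
      one_mem' := Or.inr (Or.inr hone)
      add_mem' := fun {x y} hx hy => hSadd x hx y hy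
      zero_mem' := Or.inl rfl
      neg_mem' := fun {x} hx => by
        have := hSmul (-1) (Or.inr (Or.inr hneg1)) x hx
        rwa [neg_one_mul] at this
      mem_or_inv_mem' := hSor }
  have hOA : ∀ y ∈ A, y⁻¹ ∉ S := by
    rintro y hy (h | h | h)
    · exact hy.1.1 (inv_eq_zero.1 h)
    · exact hr.small_inv hy.1 h.1
    · have := h.2.1
      rw [hr.inv hy.1.1] at this
      exact hne _ this _ hy rfl
  refine ⟨O, ?_, ?_⟩
  · intro hO
    obtain ⟨v, hv0, hva⟩ : ∃ v : V4, v ≠ 0 ∧ v ≠ a := by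
      clear * -
      revert a; decide
    obtain ⟨x, hx, hxv⟩ := hr.surj v
    have hy : ∃ y, y ∈ A := by
      rcases hr.small_or hx (by rw [hxv]; exact hv0) with h | h
      · exact ⟨x, h, by rw [hxv]; exact hva⟩
      · exact ⟨x⁻¹, h, by rw [hr.inv hx, hxv]; exact hva⟩
    obtain ⟨y, hy⟩ := hy
    have : y⁻¹ ∈ O := by rw [hO]; trivial
    exact hOA y hy this
  · rintro x (hx | hx | hx) hx0 hxi
    · exact absurd hx hx0
    · exact hx.1.2.2
    · have e2 : ∃ z ∈ A, ¬ Small cl (x⁻¹ * z) := by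
        by_contra h; push Not at h
        exact hxi (Or.inr (Or.inr ⟨inv_ne_zero hx0, by rw [hr.inv hx0]; exact hx.2.1, h⟩))
      obtain ⟨y, hy, hyx⟩ := e2
      have h0 : x⁻¹ * y ≠ 0 := mul_ne_zero (inv_ne_zero hx0) hy.1.1
      have hc : cl (x⁻¹ * y) = cl x + cl y := by
        rw [hr.mul _ _ (inv_ne_zero hx0) hy.1.1, hr.inv hx0]
      have hcc := V4.add_H hy.1.2.1 hy.2 hx.2.1
      have s1 : Small cl (x⁻¹ * y)⁻¹ := (hr.small_or h0
        (by rw [hc]; exact hcc.1)).resolve_left hyx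
      have hcz : cl (x⁻¹ * y)⁻¹ = cl x + cl y := by rw [hr.inv h0, hc]
      have e : y * (x⁻¹ * y)⁻¹ = x := by have := hy.1.1; field_simp
      by_cases hyz : cl y = cl (x⁻¹ * y)⁻¹
      · by_contra h
        have hny := hnegA y hy
        have hcn : cl (-y) = cl y := hr.neg hy.1.1
        refine hexc _ hny.1.2.1 hny.2 (hr.exc2 hny.1 s1 (by rw [hcn]; exact hyz) ?_)
        rw [neg_mul, sub_neg_eq_add, e]
        exact h
      · have := (hr.small_mul hy.1 s1 hyz).2.2
        rwa [e] at this

end AEJ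

end NU

namespace NU

section RigidOfIndex

/-- The subgroup of `p`-th powers in the units of a field. -/
abbrev powSub (p : ℕ) (F : Type*) [Field F] : Subgroup Fˣ := (powMonoidHom p : Fˣ →* Fˣ).range

theorem mem_powSub {p : ℕ} {F : Type*} [Field F] {x : Fˣ} : x ∈ powSub p F ↔ ∃ y : Fˣ, y ^ p = x :=
  Iff.rfl

theorem mem_powSub' {p : ℕ} (hp : p ≠ 0) {F : Type*} [Field F] {x : Fˣ} :
    x ∈ powSub p F ↔ ∃ y : F, y ^ p = x := by
  rw [mem_powSub]
  constructor
  · rintro ⟨y, rfl⟩; exact ⟨y, by simp⟩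
  · rintro ⟨y, hy⟩
    have hy0 : y ≠ 0 := by
      rintro rfl
      rw [zero_pow hp] at hy
      exact x.ne_zero hy.symm
    exact ⟨Units.mk0 y hy0, by ext; simp [hy]⟩

theorem exists_rigid {F : Type*} [Field F] (hidx : (powSub 2 F).index = 4)
    (hi : ∃ i : F, i ^ 2 = -1)
    (hrig : ∀ z : F, z ≠ 0 → (¬ ∃ y, y ^ 2 = z) → (∃ y, y ^ 2 = 1 + z) ∨ (∃ y, z * y ^ 2 = 1 + z)) :
    ∃ cl : F → V4, Rigid cl ∧ ∀ x, x ≠ 0 → (cl x = 0 ↔ ∃ y, y ^ 2 = x) := by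
  classical
  let Q := Fˣ ⧸ powSub 2 F
  have hcard : Nat.card Q = 4 := hidx
  have hexp : ∀ q : Q, q ^ 2 = 1 := by
    intro q
    induction q using QuotientGroup.induction_on with
    | H z =>
      rw [← QuotientGroup.mk_pow, QuotientGroup.eq_one_iff]
      exact ⟨z, rfl⟩
  haveI : IsKleinFour Q := by
    refine ⟨hcard, ?_⟩
    haveI : Nontrivial Q := by
      have : Finite Q := Nat.finite_of_card_ne_zero (by rw [hcard]; norm_num)
      exact Finite.one_lt_card_iff_nontrivial.1 (by rw [hcard]; norm_num)
    have h1 : Monoid.exponent Q ∣ 2 := Monoid.exponent_dvd_of_forall_pow_eq_one hexp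
    rcases (Nat.dvd_prime Nat.prime_two).1 h1 with h | h
    · rw [Monoid.exp_eq_one_iff] at h
      exact absurd h (not_subsingleton Q)
    · exact h
  obtain ⟨φ⟩ : Nonempty (Q ≃* Multiplicative V4) := IsKleinFour.nonempty_mulEquiv
  let cl : F → V4 := fun x => if h : x = 0 then 0 else
    Multiplicative.toAdd (φ (QuotientGroup.mk (Units.mk0 x h)))
  have hcl : ∀ x (h : x ≠ 0), cl x = Multiplicative.toAdd (φ (QuotientGroup.mk (Units.mk0 x h))) :=
    fun x h => by simp only [cl, dif_neg h]
  have hmul : ∀ x y : F, x ≠ 0 → y ≠ 0 → cl (x * y) = cl x + cl y := by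
    intro x y hx hy
    rw [hcl x hx, hcl y hy, hcl _ (mul_ne_zero hx hy), ← toAdd_mul, ← map_mul,
      ← QuotientGroup.mk_mul, Units.mk0_mul]
  have hz : ∀ x, x ≠ 0 → (cl x = 0 ↔ ∃ y, y ^ 2 = x) := by
    intro x hx
    rw [hcl x hx, toAdd_eq_zero, EmbeddingLike.map_eq_one_iff, QuotientGroup.eq_one_iff,
      mem_powSub' two_ne_zero]
    simp
  have hm1 : cl (-1) = 0 := (hz _ (by simp)).2 hi
  refine ⟨cl, ⟨hmul, ?_, hm1, ?_⟩, hz⟩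
  · intro x y hx hy hxy
    set z := y / x with hzd
    have hz0 : z ≠ 0 := div_ne_zero hy hx
    have hyx : y = x * z := by rw [hzd]; field_simp
    have hne : ¬ ∃ w, w ^ 2 = z := by
      rw [← hz z hz0]
      intro h
      apply hxy
      rw [hyx, hmul _ _ hx hz0, h, add_zero]
    have hnz : 1 + z ≠ 0 := by
      intro h
      apply hne
      obtain ⟨i, hi⟩ := hi
      exact ⟨i, by rw [hi]; linear_combination -h⟩
    have e : x + y = x * (1 + z) := by rw [hyx]; ring
    rw [e, hmul _ _ hx hnz]
    rcases hrig z hz0 hne with h | ⟨w, hw⟩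
    · left
      rw [(hz _ hnz).2 h, add_zero]
    · right
      have hw0 : w ^ 2 ≠ 0 := by
        intro h; rw [h, mul_zero] at hw; exact hnz hw.symm
      rw [← hw, hmul _ _ hz0 hw0, (hz _ hw0).2 ⟨w, rfl⟩, add_zero, hyx, hmul _ _ hx hz0]
  · intro v
    obtain ⟨q, hq⟩ := φ.surjective (Multiplicative.ofAdd v)
    obtain ⟨u, rfl⟩ := QuotientGroup.mk_surjective q
    refine ⟨u, u.ne_zero, ?_⟩
    rw [hcl _ u.ne_zero, Units.mk0_val, hq]; rfl

end RigidOfIndex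

section Quadratic

variable {Ω : Type*} [Field Ω]

/-- The rigidity from the count of square classes in `E` and in a quadratic extension `E'`. -/
theorem rigid_of_quadratic [CharZero Ω] (E E' : Subfield Ω) (hEE' : E ≤ E') (σ : Ω ≃+* Ω)
    (hσ : ∀ x ∈ E, σ x = x) (hN : ∀ x ∈ E', x * σ x ∈ E) (hT : ∀ x ∈ E', x + σ x ∈ E)
    (s : Ω) (hs : s ∈ E') (hs0 : s ≠ 0) (hss : s ^ 2 ∈ E) (hσs : σ s = - s)
    (i : Ω) (hi : i ∈ E) (hi2 : i ^ 2 = -1)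
    (h4 : (powSub 2 E).index = 4) (h4' : (powSub 2 E').index = 4) :
    (∃ y ∈ E, y ^ 2 = 1 + s ^ 2) ∨ (∃ y ∈ E, s ^ 2 * y ^ 2 = 1 + s ^ 2) := by
  by_cases hne : 1 + s ^ 2 = 0
  · left; exact ⟨0, E.zero_mem, by rw [hne]; simp⟩
  have hfix : ∀ x ∈ E', σ x = x → x ∈ E := by
    intro x hx hx'
    have := hT x hx
    rw [hx'] at this
    have h2 : (2 : Ω)⁻¹ * (x + x) ∈ E := E.mul_mem (E.inv_mem (ofNat_mem E 2)) this
    have e : (2 : Ω)⁻¹ * (x + x) = x := by field_simp; ring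
    rwa [e] at h2
  have hsE : s ∉ E := by
    intro h
    have := hσ s h
    rw [hσs] at this
    exact hs0 (self_eq_neg.1 this.symm)
  let f : Eˣ →* E'ˣ := Units.map (Subfield.inclusion hEE' : E →* E')
  have hf : ∀ u : Eˣ, (((f u : E') : Ω)) = ((u : E) : Ω) := fun u => rfl
  let N : E'ˣ →* Eˣ :=
    Units.map
      { toFun := fun x => (⟨(x : Ω) * σ x, hN _ x.2⟩ : E)
        map_one' := by ext; simp
        map_mul' := fun x y => by ext; simp; ring }
  have hNv : ∀ u : E'ˣ, ((N u : E) : Ω) = ((u : E') : Ω) * σ ((u : E') : Ω) := fun u => rfl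
  have msq : ∀ (D : Subfield Ω) (u : Dˣ), u ∈ powSub 2 D ↔ ∃ y ∈ D, y ^ 2 = ((u : D) : Ω) := by
    intro D u
    rw [mem_powSub' two_ne_zero]
    constructor
    · rintro ⟨y, hy⟩; exact ⟨y, y.2, by rw [← hy]; simp⟩
    · rintro ⟨y, hy, hyu⟩; exact ⟨⟨y, hy⟩, by ext; simp [hyu]⟩
  set C := (powSub 2 E').comap f with hC
  set B := (powSub 2 E).comap N with hB
  have hs2 : s ^ 2 ≠ 0 := pow_ne_zero 2 hs0
  let X : Eˣ := Units.mk0 ⟨s ^ 2, hss⟩ (by simpa [Subtype.ext_iff] using hs0)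
  have hXv : ((X : E) : Ω) = s ^ 2 := rfl
  have hXC : X ∈ C := by
    rw [hC, Subgroup.mem_comap, msq]
    exact ⟨s, hs, by rw [hf, hXv]⟩
  have hXn : X ∉ powSub 2 E := by
    rw [msq]
    rintro ⟨y, hy, hyX⟩
    rw [hXv] at hyX
    rcases sq_eq_sq_iff_eq_or_eq_neg.1 hyX with h | h
    · exact hsE (h ▸ hy)
    · exact hsE (by have := E.neg_mem hy; rwa [h, neg_neg] at this)
  have hleC : powSub 2 E ≤ C := by
    rintro _ ⟨y, rfl⟩
    exact ⟨f y, by simp⟩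
  have hrel : (powSub 2 E).relIndex C = 2 := by
    rw [Subgroup.relIndex_eq_two_iff]
    refine ⟨X, hXC, fun b hb => ?_⟩
    by_cases hb' : b ∈ powSub 2 E
    · right
      exact ⟨hb', fun h => hXn (((powSub 2 E).mul_mem_cancel_left hb').1 h)⟩
    · left
      refine ⟨?_, hb'⟩
      rw [hC, Subgroup.mem_comap, msq] at hb
      obtain ⟨w, hw, hwb⟩ := hb
      rw [hf] at hwb
      have h1 : σ w ^ 2 = w ^ 2 := by
        rw [← map_pow, hwb]; exact hσ _ (b : E).2
      rcases sq_eq_sq_iff_eq_or_eq_neg.1 h1 with h | h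
      · exact absurd ((msq E b).2 ⟨w, hfix w hw h, hwb⟩) hb'
      · rw [msq]
        refine ⟨w * s, hfix _ (E'.mul_mem hw hs) (by rw [map_mul, h, hσs]; ring), ?_⟩
        rw [mul_pow, hwb]; rfl
  have hCidx : C.index = 2 := by
    have := Subgroup.relIndex_mul_index hleC
    rw [hrel, h4] at this
    omega
  have hBeq : B = f.range ⊔ powSub 2 E' := by
    apply le_antisymm
    · intro δ hδ
      rw [hB, Subgroup.mem_comap, msq] at hδ
      obtain ⟨c, hc, hcδ⟩ := hδ
      rw [hNv] at hcδ
      set d : Ω := ((δ : E') : Ω) with hd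
      have hd0 : d ≠ 0 := by
        intro h
        exact δ.ne_zero (Subtype.ext h)
      have hdE : d ∈ E' := (δ : E').2
      by_cases ht : d + σ d + 2 * c = 0
      · have h1 : (d + c) ^ 2 = 0 := by linear_combination hcδ + d * ht
        have h2 : d + c = 0 := pow_eq_zero_iff two_ne_zero |>.1 h1
        have h3 : d ∈ E := by
          have := E.neg_mem hc
          rwa [← eq_neg_of_add_eq_zero_left h2] at this
        apply Subgroup.mem_sup_left
        refine ⟨Units.mk0 ⟨d, h3⟩ (fun h => hd0 (congrArg Subtype.val h)), ?_⟩
        ext; rfl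
      · have htE : d + σ d + 2 * c ∈ E :=
          E.add_mem (hT d hdE) (E.mul_mem (ofNat_mem E 2) hc)
        let t : Eˣ := Units.mk0 ⟨_, htE⟩ (fun h => ht (congrArg Subtype.val h))
        have h1 : δ * f t ∈ powSub 2 E' := by
          rw [msq]
          refine ⟨d + c, E'.add_mem hdE (hEE' hc), ?_⟩
          change (d + c) ^ 2 = d * (d + σ d + 2 * c)
          linear_combination hcδ
        have h2 : δ = (f t)⁻¹ * (δ * f t) := by rw [mul_comm δ, inv_mul_cancel_left]
        rw [h2]
        exact Subgroup.mul_mem_sup (Subgroup.inv_mem _ ⟨t, rfl⟩) h1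
    · rw [sup_le_iff]
      constructor
      · rintro _ ⟨u, rfl⟩
        rw [hB, Subgroup.mem_comap, msq]
        refine ⟨_, (u : E).2, ?_⟩
        rw [hNv, hf, hσ _ (u : E).2, sq]
      · rintro _ ⟨u, rfl⟩
        exact ⟨N u, by simp⟩
  have hBidx : B.index = 2 := by
    have h1 : powSub 2 E' ≤ B := by rw [hBeq]; exact le_sup_right
    have h2 := Subgroup.relIndex_mul_index h1
    have h3 : (powSub 2 E').relIndex B = 2 := by
      rw [hBeq, Subgroup.relIndex_sup_right]
      exact (Subgroup.index_comap _ _).symm.trans hCidx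
    rw [h3, h4'] at h2
    omega
  -- apply with `s` and `1 + i s`
  let S : E'ˣ := Units.mk0 ⟨s, hs⟩ (fun h => hs0 (congrArg Subtype.val h))
  have hδE : 1 + i * s ∈ E' := E'.add_mem E'.one_mem (E'.mul_mem (hEE' hi) hs)
  have hprod : (1 + i * s) * σ (1 + i * s) = 1 + s ^ 2 := by
    rw [map_add, map_one, map_mul, hσ i hi, hσs]; linear_combination -s ^ 2 * hi2
  have hδ0 : 1 + i * s ≠ 0 := by
    intro h; rw [h, zero_mul] at hprod; exact hne hprod.symm
  let δ : E'ˣ := Units.mk0 ⟨_, hδE⟩ (fun h => hδ0 (congrArg Subtype.val h))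
  have hi0 : i ≠ 0 := by
    rintro rfl
    norm_num at hi2
  have hSB : S ∉ B := by
    rw [hB, Subgroup.mem_comap, msq]
    rintro ⟨y, hy, hyS⟩
    apply hXn
    rw [msq]
    refine ⟨y * i, E.mul_mem hy hi, ?_⟩
    rw [mul_pow, hyS, hi2, hNv]
    change s * σ s * -1 = s ^ 2
    rw [hσs]; ring
  by_cases hδB : δ ∈ B
  · left
    rw [hB, Subgroup.mem_comap, msq] at hδB
    obtain ⟨y, hy, hyδ⟩ := hδB
    exact ⟨y, hy, by rw [hyδ, hNv]; exact hprod⟩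
  · right
    have h1 : δ * S ∈ B := by
      rw [Subgroup.mul_mem_iff_of_index_two hBidx]
      exact iff_of_false hδB hSB
    rw [hB, Subgroup.mem_comap, msq] at h1
    obtain ⟨y, hy, hyδ⟩ := h1
    rw [map_mul, Units.val_mul] at hyδ
    have h2 : y ^ 2 = (1 + s ^ 2) * (s * σ s) := by
      rw [hyδ, ← hprod]; rfl
    refine ⟨y * i / s ^ 2, E.div_mem (E.mul_mem hy hi) hss, ?_⟩
    rw [div_pow, mul_pow, h2, hi2, hσs]
    field_simp

end Quadratic

end NU

namespace NU

open IntermediateField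

/-- Characters of exponent `p` with open kernel and values in `Ω`. -/
def IsCh (p : ℕ) (Ω : Type*) [Field Ω] {Γ : Type*} [Group Γ] [TopologicalSpace Γ]
    (f : Γ →* Ωˣ) : Prop := (∀ x, f x ^ p = 1) ∧ IsOpen (f.ker : Set Γ)

/-- The number of characters. -/
noncomputable def chCard (p : ℕ) (Ω : Type*) [Field Ω] (Γ : Type*) [Group Γ] [TopologicalSpace Γ] :
    ℕ := Nat.card {f : Γ →* Ωˣ // IsCh p Ω f}

theorem chCard_congr (p : ℕ) (Ω : Type*) [Field Ω] {Γ Δ : Type*} [Group Γ] [TopologicalSpace Γ]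
    [Group Δ] [TopologicalSpace Δ] (e : Γ ≃* Δ) (h1 : Continuous e) (h2 : Continuous e.symm) :
    chCard p Ω Γ = chCard p Ω Δ := by
  refine Nat.card_congr ⟨fun f => ⟨f.1.comp e.symm, ?_, ?_⟩, fun f => ⟨f.1.comp e, ?_, ?_⟩, ?_, ?_⟩
  · intro x; exact f.2.1 _
  · exact f.2.2.preimage h2
  · intro x; exact f.2.1 _
  · exact f.2.2.preimage h1
  · intro f; ext; simp
  · intro f; ext; simp

section Kummer

variable {Ω : Type*} [Field Ω] [CharZero Ω] [Algebra.IsAlgebraic ℚ Ω] [IsAlgClosed Ω]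

instance : IsGalois ℚ Ω := {
  to_isSeparable := inferInstance
  to_normal := (normal_iff).2 fun x => ⟨Algebra.IsIntegral.isIntegral x, IsAlgClosed.splits _⟩ }

theorem mem_fixedField' {H : Subgroup (Ω ≃ₐ[ℚ] Ω)} {x : Ω} :
    x ∈ fixedField H ↔ ∀ h ∈ H, h x = x := by
  rw [IntermediateField.mem_fixedField_iff]

theorem fixing_fixed {H : Subgroup (Ω ≃ₐ[ℚ] Ω)} (hH : IsClosed (H : Set (Ω ≃ₐ[ℚ] Ω))) :
    (fixedField H).fixingSubgroup = H :=
  InfiniteGalois.fixingSubgroup_fixedField ⟨H, hH⟩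

/-- Surjectivity in Kummer theory. -/
theorem kummer_surj {p : ℕ} (hp : p.Prime) {H : Subgroup (Ω ≃ₐ[ℚ] Ω)}
    (hH : IsClosed (H : Set (Ω ≃ₐ[ℚ] Ω))) (hμ : ∀ z : Ω, z ^ p = 1 → z ∈ fixedField H)
    (f : H →* Ωˣ) (hf : IsCh p Ω f) : ∃ β : Ω, β ≠ 0 ∧ ∀ h : H, (h : Ω ≃ₐ[ℚ] Ω) β = f h * β := by
  by_cases hf1 : ∀ h, f h = 1
  · exact ⟨1, one_ne_zero, fun h => by simp [hf1 h]⟩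
  push Not at hf1
  obtain ⟨h0, hh0⟩ := hf1
  set ζ : Ω := (f h0 : Ω) with hζ
  have hζp : ζ ^ p = 1 := by
    have := congrArg Units.val (hf.1 h0)
    simpa using this
  have hζ1 : ζ ≠ 1 := fun h => hh0 (Units.ext h)
  have hprim : IsPrimitiveRoot ζ p := by
    have h1 : orderOf ζ = p := by
      haveI := Fact.mk hp
      exact orderOf_eq_prime hζp hζ1
    rw [← h1]; exact IsPrimitiveRoot.orderOf ζ
  have hfix : ∀ z : Ω, z ^ p = 1 → ∀ h : H, (h : Ω ≃ₐ[ℚ] Ω) z = z := fun z hz h =>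
    mem_fixedField'.1 (hμ z hz) h h.2
  have hζ0 : ζ ≠ 0 := hprim.ne_zero hp.ne_zero
  -- the kernel
  let N : Subgroup (Ω ≃ₐ[ℚ] Ω) := f.ker.map H.subtype
  have hNc : IsClosed (N : Set (Ω ≃ₐ[ℚ] Ω)) := by
    have h1 : IsClosed (f.ker : Set H) := Subgroup.isClosed_of_isOpen _ hf.2
    exact hH.isClosedEmbedding_subtypeVal.isClosedMap _ h1
  obtain ⟨y, hyN, hy⟩ : ∃ y ∈ fixedField N, (h0 : Ω ≃ₐ[ℚ] Ω) y ≠ y := by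
    by_contra hcon
    push Not at hcon
    have : (h0 : Ω ≃ₐ[ℚ] Ω) ∈ (fixedField N).fixingSubgroup := by
      rw [IntermediateField.mem_fixingSubgroup_iff]
      exact hcon
    rw [fixing_fixed hNc] at this
    obtain ⟨n, hn, hn'⟩ := this
    have : n = h0 := Subtype.ext hn'
    rw [this] at hn
    exact hh0 hn
  have hpow : ∀ n : ℕ, ∀ z ∈ fixedField N, ∀ h : H, f h = (f h0) ^ n →
      (h : Ω ≃ₐ[ℚ] Ω) z = ((h0 : Ω ≃ₐ[ℚ] Ω) ^ n) z := by
    intro n z hz h hh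
    have h1 : (h0 ^ n)⁻¹ * h ∈ f.ker := by
      rw [MonoidHom.mem_ker, map_mul, map_inv, map_pow, hh]; simp
    have h2 := mem_fixedField'.1 hz _ ⟨_, h1, rfl⟩
    have h3 := congrArg ((h0 : Ω ≃ₐ[ℚ] Ω) ^ n) h2
    rw [← AlgEquiv.mul_apply] at h3
    simpa using h3
  have hstab : ∀ n : ℕ, ∀ z ∈ fixedField N, ((h0 : Ω ≃ₐ[ℚ] Ω) ^ n) z ∈ fixedField N := by
    intro n z hz
    rw [mem_fixedField']
    rintro _ ⟨k, hk, rfl⟩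
    have h1 := hpow n z hz (k * h0 ^ n) (by
      rw [map_mul, map_pow, (MonoidHom.mem_ker).1 hk, one_mul])
    simpa using h1
  have hperiod : ((h0 : Ω ≃ₐ[ℚ] Ω) ^ p) y = y := by
    have := hpow p y hyN 1 (by rw [map_one, hf.1])
    simpa using this.symm
  let α : ℕ → Ω := fun j => ∑ k ∈ Finset.range p, (ζ⁻¹) ^ (j * k) * ((h0 : Ω ≃ₐ[ℚ] Ω) ^ k) y
  have hζi : ∀ n : ℕ, (h0 : Ω ≃ₐ[ℚ] Ω) (ζ⁻¹ ^ n) = ζ⁻¹ ^ n := fun n =>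
    hfix _ (by rw [← pow_mul, mul_comm, pow_mul, inv_pow, hζp, inv_one, one_pow]) h0
  have hα : ∀ j, (h0 : Ω ≃ₐ[ℚ] Ω) (α j) = ζ ^ j * α j := by
    intro j
    let g : ℕ → Ω := fun k => (ζ⁻¹) ^ (j * k) * ((h0 : Ω ≃ₐ[ℚ] Ω) ^ k) y
    have h1 : (h0 : Ω ≃ₐ[ℚ] Ω) (α j) = ∑ k ∈ Finset.range p, ζ ^ j * g (k + 1) := by
      simp only [α, map_sum]
      refine Finset.sum_congr rfl fun k _ => ?_
      simp only [g]
      rw [map_mul, hζi, pow_succ' (h0 : Ω ≃ₐ[ℚ] Ω) k, AlgEquiv.mul_apply, mul_add, pow_add, mul_one]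
      have : ζ ^ j * ζ⁻¹ ^ j = 1 := by rw [← mul_pow, mul_inv_cancel₀ hζ0, one_pow]
      linear_combination (-(ζ⁻¹ ^ (j * k)) * (h0 : Ω ≃ₐ[ℚ] Ω) (((h0 : Ω ≃ₐ[ℚ] Ω) ^ k) y)) * this
    rw [h1, ← Finset.mul_sum]
    congr 1
    have h2 := Finset.sum_range_succ g p
    have h3 := Finset.sum_range_succ' g p
    have h4 : g p = g 0 := by
      simp only [g]
      rw [hperiod, mul_comm j p, pow_mul, inv_pow, hζp]; simp
    change _ = ∑ k ∈ Finset.range p, g k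
    rw [h4] at h2
    exact add_right_cancel (h3.symm.trans h2)
  have hsum : ∑ j ∈ Finset.range p, α j = p * y := by
    simp only [α]
    rw [Finset.sum_comm]
    rw [Finset.sum_eq_single_of_mem 0 (Finset.mem_range.2 hp.pos)]
    · simp
    · intro k hk hk0
      rw [← Finset.sum_mul]
      have : ∑ j ∈ Finset.range p, ζ⁻¹ ^ (j * k) = 0 := by
        have h1 : IsPrimitiveRoot (ζ⁻¹ ^ k) p := hprim.inv.pow_of_coprime k
          (Nat.coprime_of_lt_prime hk0 (Finset.mem_range.1 hk) hp).symm
        have h2 := h1.geom_sum_eq_zero hp.one_lt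
        rw [← h2]
        refine Finset.sum_congr rfl fun j _ => ?_
        rw [← pow_mul, mul_comm]
      rw [this, zero_mul]
  obtain ⟨j, hj0, hjp, hαj⟩ : ∃ j, j ≠ 0 ∧ j < p ∧ α j ≠ 0 := by
    by_contra hcon
    push Not at hcon
    rw [Finset.sum_eq_single_of_mem 0 (Finset.mem_range.2 hp.pos)
      (fun j hj hj0 => hcon j hj0 (Finset.mem_range.1 hj))] at hsum
    have h1 := hα 0
    rw [hsum, pow_zero, one_mul, map_mul, map_natCast] at h1
    exact hy (mul_left_cancel₀ (by exact_mod_cast hp.ne_zero) h1)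
  have hαN : α j ∈ fixedField N := by
    refine sum_mem fun k _ => mul_mem ?_ (hstab k y hyN)
    have h1 : ζ⁻¹ ∈ fixedField H := hμ _ (by rw [inv_pow, hζp, inv_one])
    have h2 : ζ⁻¹ ∈ fixedField N := by
      rw [mem_fixedField'] at h1 ⊢
      rintro _ ⟨k, hk, rfl⟩
      exact h1 _ k.2
    exact pow_mem h2 _
  obtain ⟨m, hm⟩ : ∃ m : ℕ, (ζ ^ j) ^ m = ζ := by
    have h1 : IsPrimitiveRoot (ζ ^ j) p := hprim.pow_of_coprime j
      (Nat.coprime_of_lt_prime hj0 hjp hp).symm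
    haveI := NeZero.mk hp.ne_zero
    obtain ⟨m, -, hm⟩ := h1.eq_pow_of_pow_eq_one hζp
    exact ⟨m, hm⟩
  refine ⟨α j ^ m, pow_ne_zero _ hαj, fun h => ?_⟩
  have hβN : α j ^ m ∈ fixedField N := pow_mem hαN m
  have hβ : (h0 : Ω ≃ₐ[ℚ] Ω) (α j ^ m) = ζ * α j ^ m := by
    rw [map_pow, hα, mul_pow, hm]
  have hβn : ∀ n : ℕ, ((h0 : Ω ≃ₐ[ℚ] Ω) ^ n) (α j ^ m) = ζ ^ n * α j ^ m := by
    intro n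
    induction n with
    | zero => simp
    | succ n ih =>
      rw [pow_succ' (h0 : Ω ≃ₐ[ℚ] Ω) n, AlgEquiv.mul_apply, ih, map_mul, hβ, hfix (ζ ^ n)
        (by rw [← pow_mul, mul_comm, pow_mul, hζp, one_pow]) h0]
      ring
  haveI := NeZero.mk hp.ne_zero
  obtain ⟨n, -, hn⟩ := hprim.eq_pow_of_pow_eq_one
    (ξ := (f h : Ω)) (by have := congrArg Units.val (hf.1 h); simpa using this)
  rw [hpow n _ hβN h (Units.ext (by rw [← hn]; simp [hζ])), hβn, hn]

/-- Kummer theory: counting. -/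
theorem kummer_card {p : ℕ} (hp : p.Prime) {H : Subgroup (Ω ≃ₐ[ℚ] Ω)}
    (hH : IsClosed (H : Set (Ω ≃ₐ[ℚ] Ω))) (hμ : ∀ z : Ω, z ^ p = 1 → z ∈ fixedField H) :
    chCard p Ω H = (powSub p (fixedField H)).index := by
  set E := fixedField H with hE
  have hfixE : ∀ z ∈ E, ∀ h : H, (h : Ω ≃ₐ[ℚ] Ω) z = z := fun z hz h => mem_fixedField'.1 hz h h.2
  choose rt hrt using fun a : E => IsAlgClosed.exists_pow_nat_eq (a : Ω) hp.pos
  have hrt0 : ∀ a : Eˣ, rt a ≠ 0 := by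
    intro a h
    have := hrt a
    rw [h, zero_pow hp.ne_zero] at this
    exact a.ne_zero (Subtype.ext this.symm)
  -- ratio of two roots is fixed
  have hratio : ∀ α β : Ω, α ≠ 0 → β ≠ 0 → α ^ p = β ^ p → ∀ h : H,
      (h : Ω ≃ₐ[ℚ] Ω) α / α = (h : Ω ≃ₐ[ℚ] Ω) β / β := by
    intro α β hα hβ hab h
    have h1 := hfixE (α / β) (hμ _ (by rw [div_pow, hab, div_self (pow_ne_zero _ hβ)])) h
    rw [map_div₀] at h1
    have hb : (h : Ω ≃ₐ[ℚ] Ω) β ≠ 0 := by simpa using hβ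
    rw [div_eq_div_iff hb hβ] at h1
    rw [div_eq_div_iff hα hβ]
    linear_combination h1
  have hroot : ∀ (a : E) (h : H), ((h : Ω ≃ₐ[ℚ] Ω) (rt a)) ^ p = a := by
    intro a h; rw [← map_pow, hrt]; exact hfixE _ a.2 h
  have hh0 : ∀ (a : Eˣ) (h : H), (h : Ω ≃ₐ[ℚ] Ω) (rt a) ≠ 0 := by
    intro a h; simpa using hrt0 a
  let Φ : Eˣ →* (H →* Ωˣ) :=
    { toFun := fun a =>
        { toFun := fun h => Units.mk0 ((h : Ω ≃ₐ[ℚ] Ω) (rt a) / rt a) (div_ne_zero (hh0 a h) (hrt0 a))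
          map_one' := by ext; simp [hrt0 a]
          map_mul' := fun h k => by
            ext
            simp only [Subgroup.coe_mul, Units.val_mk0, Units.val_mul, AlgEquiv.mul_apply]
            have h1 := hratio _ _ (hh0 a k) (hrt0 a) (by rw [hroot, hrt]) h
            have := hrt0 a
            have := hh0 a k
            rw [← h1]
            field_simp }
      map_one' := by
        ext h
        simp only [Units.val_mk0, MonoidHom.coe_mk, OneHom.coe_mk]
        have := hratio _ 1 (hrt0 1) one_ne_zero (by rw [hrt]; simp) h
        simpa using this
      map_mul' := fun a b => by
        ext h
        simp only [Units.val_mk0, MonoidHom.coe_mk, OneHom.coe_mk, MonoidHom.mul_apply,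
          Units.val_mul]
        have := hratio _ (rt a * rt b) (hrt0 (a * b)) (mul_ne_zero (hrt0 a) (hrt0 b))
          (by rw [hrt, mul_pow, hrt, hrt]; simp) h
        rw [Units.val_mul] at this
        rw [this, map_mul, mul_div_mul_comm] }
  have hΦ : ∀ a h, ((Φ a h : Ωˣ) : Ω) = (h : Ω ≃ₐ[ℚ] Ω) (rt a) / rt a := fun a h => rfl
  have hker : Φ.ker = powSub p E := by
    ext a
    rw [MonoidHom.mem_ker, mem_powSub' hp.ne_zero]
    constructor
    · intro h
      refine ⟨⟨rt a, ?_⟩, by ext; simp [hrt]⟩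
      refine mem_fixedField'.2 ?_
      intro k hk
      have h1 := hΦ a ⟨k, hk⟩
      rw [h] at h1
      simp only [MonoidHom.one_apply, Units.val_one] at h1
      exact (div_eq_one_iff_eq (hrt0 a)).1 h1.symm
    · rintro ⟨y, hy⟩
      have hy0 : (y : Ω) ≠ 0 := by
        intro h
        have h2 : y = 0 := Subtype.ext h
        rw [h2, zero_pow hp.ne_zero] at hy
        exact a.ne_zero hy.symm
      ext h
      rw [hΦ, hratio _ y (hrt0 a) hy0 (by rw [hrt, ← hy]; simp) h, hfixE _ y.2, div_self hy0]
      rfl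
  rw [← hker, Subgroup.index_ker]
  refine Nat.card_congr (Equiv.subtypeEquivRight fun f => ?_)
  constructor
  · intro hf
    obtain ⟨β, hβ0, hβ⟩ := kummer_surj hp hH hμ f hf
    have hβE : β ^ p ∈ E := by
      rw [hE, mem_fixedField']
      intro h hh
      rw [map_pow, hβ ⟨h, hh⟩, mul_pow]
      have := congrArg Units.val (hf.1 ⟨h, hh⟩)
      simp only [Units.val_pow_eq_pow_val, Units.val_one] at this
      rw [this, one_mul]
    refine ⟨Units.mk0 ⟨β ^ p, hβE⟩ (fun h => pow_ne_zero p hβ0 (congrArg Subtype.val h)), ?_⟩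
    ext h
    rw [hΦ, hratio _ β (hrt0 _) hβ0 (by rw [hrt]; rfl) h, hβ, mul_div_cancel_right₀ _ hβ0]
  · rintro ⟨a, rfl⟩
    constructor
    · intro h
      ext
      rw [Units.val_pow_eq_pow_val, hΦ, div_pow, hroot, hrt, div_self]
      · rfl
      · intro h; exact a.ne_zero (Subtype.ext h)
    · have h1 : ((Φ a).ker : Set H) = Subtype.val ⁻¹'
          (MulAction.stabilizer (Ω ≃ₐ[ℚ] Ω) (rt a) : Set (Ω ≃ₐ[ℚ] Ω)) := by
        ext h
        simp only [SetLike.mem_coe, MonoidHom.mem_ker, Set.mem_preimage, MulAction.mem_stabilizer_iff,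
          AlgEquiv.smul_def]
        rw [Units.ext_iff, hΦ, Units.val_one, div_eq_one_iff_eq (hrt0 a)]
      rw [h1]
      exact (stabilizer_isOpen_of_isIntegral (K := ℚ) (rt a)).preimage
        continuous_subtype_val

end Kummer

end NU

namespace NU

open IntermediateField NumberField IsDedekindDomain

section Places

variable {Ω : Type*} [Field Ω] [CharZero Ω]

/-- A (normalized) place of `Ω` over `p`. -/
structure IsPl (p : ℕ) (v : AbsoluteValue Ω ℝ) : Prop where
  prime : p.Prime
  na : IsNonarchimedean v
  vp : v (p : Ω) = (p : ℝ)⁻¹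

/-- Pullback of an absolute value by an automorphism. -/
noncomputable def pull (v : AbsoluteValue Ω ℝ) (g : Ω ≃ₐ[ℚ] Ω) : AbsoluteValue Ω ℝ :=
  v.comp (f := (g : Ω →+* Ω)) g.injective

@[simp] theorem pull_apply (v : AbsoluteValue Ω ℝ) (g : Ω ≃ₐ[ℚ] Ω) (x : Ω) :
    pull v g x = v (g x) := rfl

theorem pull_mul (v : AbsoluteValue Ω ℝ) (g h : Ω ≃ₐ[ℚ] Ω) : pull v (g * h) = pull (pull v g) h := by
  ext; rfl

theorem pull_one (v : AbsoluteValue Ω ℝ) : pull v 1 = v := by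
  ext; rfl

/-- Decomposition group. -/
def Dec (v : AbsoluteValue Ω ℝ) : Subgroup (Ω ≃ₐ[ℚ] Ω) where
  carrier := {g | pull v g = v}
  mul_mem' := fun {a b} ha hb => by
    change pull v (a * b) = v
    rw [pull_mul, ha, hb]
  one_mem' := pull_one v
  inv_mem' := fun {a} ha => by
    change pull v a⁻¹ = v
    have h : pull v a = v := ha
    nth_rw 1 [← h]
    rw [← pull_mul, mul_inv_cancel, pull_one]

theorem mem_Dec {v : AbsoluteValue Ω ℝ} {g : Ω ≃ₐ[ℚ] Ω} : g ∈ Dec v ↔ pull v g = v := Iff.rfl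

theorem mem_Dec' {v : AbsoluteValue Ω ℝ} {g : Ω ≃ₐ[ℚ] Ω} : g ∈ Dec v ↔ ∀ x, v (g x) = v x :=
  ⟨fun h x => by rw [← pull_apply, h], fun h => by ext x; exact h x⟩

variable {p : ℕ} {v : AbsoluteValue Ω ℝ}

theorem IsPl.pull (hv : IsPl p v) (g : Ω ≃ₐ[ℚ] Ω) : IsPl p (pull v g) :=
  ⟨hv.prime, fun a b => by simpa using hv.na (g a) (g b), by simpa using hv.vp⟩

theorem IsPl.natCast_le (hv : IsPl p v) (n : ℕ) : v n ≤ 1 :=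
  hv.na.apply_natCast_le_one

theorem IsPl.intCast_le (hv : IsPl p v) (n : ℤ) : v n ≤ 1 := by
  rcases Int.natAbs_eq n with h | h <;> rw [h]
  · rw [Int.cast_natCast]; exact hv.natCast_le _
  · rw [Int.cast_neg, Int.cast_natCast, map_neg_eq_map]; exact hv.natCast_le _

theorem IsPl.vp_lt (hv : IsPl p v) : v (p : Ω) < 1 := by
  rw [hv.vp]; exact inv_lt_one_of_one_lt₀ (by exact_mod_cast hv.prime.one_lt)

theorem IsPl.nontrivial (hv : IsPl p v) : v.IsNontrivial :=
  ⟨p, by exact_mod_cast hv.prime.ne_zero, hv.vp_lt.ne⟩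

theorem IsPl.add_le (hv : IsPl p v) {x y : Ω} {r : ℝ} (hx : v x ≤ r) (hy : v y ≤ r) :
    v (x + y) ≤ r := (hv.na x y).trans (max_le hx hy)

theorem IsPl.add_lt (hv : IsPl p v) {x y : Ω} {r : ℝ} (hx : v x < r) (hy : v y < r) :
    v (x + y) < r := (hv.na x y).trans_lt (max_lt hx hy)

theorem IsPl.sub_le (hv : IsPl p v) {x y : Ω} {r : ℝ} (hx : v x ≤ r) (hy : v y ≤ r) :
    v (x - y) ≤ r := by
  rw [sub_eq_add_neg]; exact hv.add_le hx (by rwa [map_neg_eq_map])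

theorem IsPl.sub_lt (hv : IsPl p v) {x y : Ω} {r : ℝ} (hx : v x < r) (hy : v y < r) :
    v (x - y) < r := by
  rw [sub_eq_add_neg]; exact hv.add_lt hx (by rwa [map_neg_eq_map])

theorem IsPl.sum_le (hv : IsPl p v) {ι : Type*} (s : Finset ι) (f : ι → Ω) {r : ℝ} (hr : 0 ≤ r)
    (h : ∀ i ∈ s, v (f i) ≤ r) : v (∑ i ∈ s, f i) ≤ r := by
  classical
  induction s using Finset.induction_on with
  | empty => simpa using hr
  | insert a s ha ih =>
    rw [Finset.sum_insert ha]
    exact hv.add_le (h a (Finset.mem_insert_self a s))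
      (ih fun i hi => h i (Finset.mem_insert_of_mem hi))

theorem IsPl.sum_lt (hv : IsPl p v) {ι : Type*} (s : Finset ι) (f : ι → Ω) {r : ℝ} (hr : 0 < r)
    (h : ∀ i ∈ s, v (f i) < r) : v (∑ i ∈ s, f i) < r := by
  classical
  induction s using Finset.induction_on with
  | empty => simpa using hr
  | insert a s ha ih =>
    rw [Finset.sum_insert ha]
    exact hv.add_lt (h a (Finset.mem_insert_self a s))
      (ih fun i hi => h i (Finset.mem_insert_of_mem hi))

/-- if `v (x - y) < v y` then `v x = v y`. -/
theorem IsPl.eq_of_sub_lt (hv : IsPl p v) {x y : Ω} (h : v (x - y) < v y) : v x = v y := by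
  have := hv.na.add_eq_right_of_lt (x := x - y) (y := y) h
  simpa using this

theorem IsPl.eq_one_of_sub_lt (hv : IsPl p v) {x : Ω} (h : v (x - 1) < 1) : v x = 1 := by
  have := hv.eq_of_sub_lt (x := x) (y := 1) (by simpa using h)
  simpa using this

theorem IsPl.le_one_of_isIntegral (hv : IsPl p v) {x : Ω} (hx : IsIntegral ℤ x) : v x ≤ 1 := by
  by_contra hlt
  push Not at hlt
  obtain ⟨f, hf, hfx⟩ := hx
  rw [Polynomial.eval₂_eq_sum_range, Finset.sum_range_succ, hf.coeff_natDegree] at hfx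
  simp only [map_one, one_mul] at hfx
  have h0 : v x ^ f.natDegree > 0 := by positivity
  have h1 : v (∑ i ∈ Finset.range f.natDegree, (algebraMap ℤ Ω) (f.coeff i) * x ^ i)
      < v x ^ f.natDegree := by
    refine hv.sum_lt _ _ h0 fun i hi => ?_
    rw [map_mul, map_pow]
    calc v ((algebraMap ℤ Ω) (f.coeff i)) * v x ^ i ≤ 1 * v x ^ i := by
          gcongr; exact hv.intCast_le _
      _ < v x ^ f.natDegree := by
          rw [one_mul]; exact pow_lt_pow_right₀ hlt (Finset.mem_range.1 hi)
  rw [eq_neg_of_add_eq_zero_left hfx, map_neg_eq_map, map_pow] at h1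
  exact lt_irrefl _ h1

theorem IsPl.natCast_lt_iff (hv : IsPl p v) (n : ℕ) : v n < 1 ↔ p ∣ n := by
  constructor
  · intro h
    by_contra hn
    have hc : Nat.Coprime p n := (Nat.Prime.coprime_iff_not_dvd hv.prime).2 hn
    have h1 : (p : ℤ) * (Nat.gcdA p n) + n * (Nat.gcdB p n) = 1 := by
      rw [← Nat.gcd_eq_gcd_ab, hc]; rfl
    have h2 : (p : Ω) * ((Nat.gcdA p n : ℤ) : Ω) + n * ((Nat.gcdB p n : ℤ) : Ω) = 1 := by
      exact_mod_cast h1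
    have h3 : v 1 < 1 := by
      rw [← h2]
      refine hv.add_lt ?_ ?_
      · rw [map_mul]
        exact mul_lt_one_of_nonneg_of_lt_one_left (v.nonneg _) hv.vp_lt (hv.intCast_le _)
      · rw [map_mul]
        exact mul_lt_one_of_nonneg_of_lt_one_left (v.nonneg _) h (hv.intCast_le _)
    simp at h3
  · rintro ⟨m, rfl⟩
    rw [Nat.cast_mul, map_mul]
    exact mul_lt_one_of_nonneg_of_lt_one_left (v.nonneg _) hv.vp_lt (hv.natCast_le _)

theorem IsPl.natCast_eq_one (hv : IsPl p v) {n : ℕ} (hn : ¬ p ∣ n) : v n = 1 :=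
  le_antisymm (hv.natCast_le n) (not_lt.1 fun h => hn ((hv.natCast_lt_iff n).1 h))

theorem IsPl.p_unique {q : ℕ} (hv : IsPl p v) (hq : q.Prime) (h : v (q : Ω) < 1) : q = p :=
  ((Nat.prime_dvd_prime_iff_eq hv.prime hq).1 ((hv.natCast_lt_iff q).1 h)).symm

theorem exists_isPl [Algebra.IsAlgebraic ℚ Ω] {p : ℕ} (hp : p.Prime) :
    ∃ v : AbsoluteValue Ω ℝ, IsPl p v := by
  haveI := Fact.mk hp
  let ι : Ω →ₐ[ℚ] PadicAlgCl p := IsAlgClosed.lift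
  refine ⟨(NormedField.toAbsoluteValue (PadicAlgCl p)).comp (f := (ι : Ω →+* _)) ι.injective,
    hp, ?_, ?_⟩
  · intro a b
    have := PadicAlgCl.isNonarchimedean p (ι a) (ι b)
    change ‖ι (a + b)‖ ≤ ‖ι a‖ ⊔ ‖ι b‖
    rw [map_add]; exact this
  · change ‖ι (p : Ω)‖ = _
    rw [map_natCast]
    have h := PadicAlgCl.norm_extends p (p : ℚ_[p])
    rw [Padic.norm_p, map_natCast] at h
    exact h

variable [Algebra.IsAlgebraic ℚ Ω]

instance (E : IntermediateField ℚ Ω) [FiniteDimensional ℚ E] : NumberField E where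
  to_charZero := inferInstance
  to_finiteDimensional := inferInstance

variable (E : IntermediateField ℚ Ω) [FiniteDimensional ℚ E]

theorem ringOfIntegers_isIntegral (x : 𝓞 E) : IsIntegral ℤ (((x : 𝓞 E) : E) : Ω) :=
  (RingOfIntegers.isIntegral_coe x).map (IsScalarTower.toAlgHom ℤ E Ω)

/-- the prime ideal of a place -/
noncomputable def IsPl.pid (hv : IsPl p v) : Ideal (𝓞 E) where
  carrier := {x | v ((x : E) : Ω) < 1}
  add_mem' := fun {a b} ha hb => by
    simpa using hv.add_lt (x := ((a : E) : Ω)) (y := ((b : E) : Ω)) ha hb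
  zero_mem' := by simp
  smul_mem' := fun c x hx => by
    simp only [Set.mem_ofPred_eq, smul_eq_mul, map_mul, MulMemClass.coe_mul]
    exact mul_lt_one_of_nonneg_of_lt_one_right
      (hv.le_one_of_isIntegral (ringOfIntegers_isIntegral E c)) (v.nonneg _) hx

theorem IsPl.mem_pid (hv : IsPl p v) {x : 𝓞 E} : x ∈ hv.pid E ↔ v ((x : E) : Ω) < 1 := Iff.rfl

theorem IsPl.not_mem_pid (hv : IsPl p v) {x : 𝓞 E} : x ∉ hv.pid E ↔ v ((x : E) : Ω) = 1 := by
  rw [hv.mem_pid E]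
  constructor
  · intro h
    exact le_antisymm (hv.le_one_of_isIntegral (ringOfIntegers_isIntegral E x)) (not_lt.1 h)
  · intro h; rw [h]; exact lt_irrefl _

theorem IsPl.p_mem_pid (hv : IsPl p v) : (p : 𝓞 E) ∈ hv.pid E := by
  rw [hv.mem_pid E]; simpa using hv.vp_lt

/-- the prime of a place -/
noncomputable def IsPl.hos (hv : IsPl p v) : HeightOneSpectrum (𝓞 E) where
  asIdeal := hv.pid E
  isPrime := by
    refine ⟨?_, ?_⟩
    · rw [Ne, Ideal.eq_top_iff_one, hv.mem_pid E]; simp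
    · intro x y hxy
      by_contra h
      push Not at h
      rw [hv.not_mem_pid E, hv.not_mem_pid E] at h
      rw [hv.mem_pid E] at hxy
      simp only [map_mul, MulMemClass.coe_mul] at hxy
      rw [h.1, h.2] at hxy
      norm_num at hxy
  ne_bot := by
    intro h
    have := hv.p_mem_pid E
    rw [h, Ideal.mem_bot] at this
    exact hv.prime.ne_zero (by exact_mod_cast this)

/-- Lemma L -/
theorem IsPl.exists_denom (hv : IsPl p v) {x : E} (hx : v (x : Ω) ≤ 1) :
    ∃ s t : 𝓞 E, v ((t : E) : Ω) = 1 ∧ x * (t : E) = (s : E) := by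
  obtain ⟨n, d, h⟩ := HeightOneSpectrum.exists_primeCompl_mul_eq_or_mul_eq (hv.hos E) x
  have hd : v (((d : 𝓞 E) : E) : Ω) = 1 := (hv.not_mem_pid E).1 d.2
  rcases h with h | h
  · exact ⟨n, d, hd, h⟩
  · have h1 : v (x : Ω) * v ((n : E) : Ω) = 1 := by
      rw [← map_mul, ← hd]
      congr 1
      exact congrArg Subtype.val h
    have hn := hv.le_one_of_isIntegral (ringOfIntegers_isIntegral E n)
    have hn1 : v ((n : E) : Ω) = 1 := by
      refine le_antisymm hn (not_lt.1 fun hlt => ?_)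
      have : v (x : Ω) * v ((n : E) : Ω) < 1 :=
        mul_lt_one_of_nonneg_of_lt_one_right hx (v.nonneg _) hlt
      exact absurd h1 this.ne
    exact ⟨d, n, hn1, h⟩

theorem IsPl.val_eq_one (hv : IsPl p v) {x : E} (hx : (hv.hos E).valuation E x = 1) :
    v (x : Ω) = 1 := by
  obtain ⟨n, d, h⟩ := HeightOneSpectrum.exists_primeCompl_mul_eq_of_integer (hv.hos E) x hx.le
  have hd : v (((d : 𝓞 E) : E) : Ω) = 1 := (hv.not_mem_pid E).1 d.2
  have hn : n ∉ hv.pid E := by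
    have h1 := congrArg ((hv.hos E).valuation E) h
    rw [map_mul, hx, one_mul, (HeightOneSpectrum.valuation_eq_one_iff_notMem (K := E) (hv.hos E)).2 d.2] at h1
    exact (HeightOneSpectrum.valuation_eq_one_iff_notMem (K := E) (hv.hos E)).1 h1.symm
  rw [hv.not_mem_pid E] at hn
  have h2 : v (x : Ω) * v (((d : 𝓞 E) : E) : Ω) = v ((n : E) : Ω) := by
    rw [← map_mul]
    congr 1
    exact congrArg Subtype.val h
  rwa [hd, hn, mul_one] at h2

theorem IsPl.exists_unif (hv : IsPl p v) (π : E) (hπ : (hv.hos E).valuation E π = WithZero.exp (-1 : ℤ))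
    (x : E) (hx : x ≠ 0) : ∃ n : ℤ, (hv.hos E).valuation E x = WithZero.exp n ∧
      v (x : Ω) = v (π : Ω) ^ (-n) := by
  set w := (hv.hos E).valuation E
  have hwx : w x ≠ 0 := (Valuation.ne_zero_iff w).2 hx
  obtain ⟨n, hn⟩ : ∃ n : ℤ, w x = WithZero.exp n := ⟨WithZero.log (w x), (WithZero.exp_log hwx).symm⟩
  refine ⟨n, hn, ?_⟩
  have hπ0 : π ≠ 0 := by
    rintro rfl
    rw [map_zero] at hπ
    exact WithZero.exp_ne_zero hπ.symm
  have h1 : w (x * π ^ n) = 1 := by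
    rw [map_mul, map_zpow₀, hn, hπ, ← WithZero.exp_zsmul, ← WithZero.exp_add]
    simp
  have h2 := hv.val_eq_one E h1
  have hvπ : v (π : Ω) ≠ 0 := by simpa using hπ0
  have h3 : v (x : Ω) * v (π : Ω) ^ n = 1 := by
    rw [← map_zpow₀, ← map_mul, ← h2]; congr 1
  rw [zpow_neg]
  exact eq_inv_of_mul_eq_one_left h3

theorem IsPl.unif_lt (hv : IsPl p v) (π : E)
    (hπ : (hv.hos E).valuation E π = WithZero.exp (-1 : ℤ)) : 0 < v (π : Ω) ∧ v (π : Ω) < 1 := by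
  have hπ0 : π ≠ 0 := by
    rintro rfl
    rw [map_zero] at hπ
    exact WithZero.exp_ne_zero hπ.symm
  refine ⟨v.pos (by simpa using hπ0), ?_⟩
  obtain ⟨n, d, h⟩ := HeightOneSpectrum.exists_primeCompl_mul_eq_of_integer (hv.hos E) π
    (by rw [hπ]; exact WithZero.exp_le_exp.2 (by norm_num))
  have hd : v (((d : 𝓞 E) : E) : Ω) = 1 := (hv.not_mem_pid E).1 d.2
  have hn : n ∈ hv.pid E := by
    have h1 := congrArg ((hv.hos E).valuation E) h
    rw [map_mul, hπ, (HeightOneSpectrum.valuation_eq_one_iff_notMem (K := E) (hv.hos E)).2 d.2, mul_one] at h1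
    refine (HeightOneSpectrum.valuation_lt_one_iff_mem (K := E) (hv.hos E) n).1 ?_
    rw [← h1]; exact WithZero.exp_lt_exp.2 (by norm_num)
  have h2 : v (π : Ω) * v (((d : 𝓞 E) : E) : Ω) = v ((n : E) : Ω) := by
    rw [← map_mul]
    congr 1
    exact congrArg Subtype.val h
  rw [hd, mul_one] at h2
  rw [h2]; exact hn

/-- The value group on a number field is infinite cyclic. -/
theorem IsPl.discrete (hv : IsPl p v) : ∃ π ∈ E, 0 < v π ∧ v π < 1 ∧
    ∀ x ∈ E, x ≠ 0 → ∃ n : ℤ, v x = v π ^ n := by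
  obtain ⟨π, hπ⟩ := (hv.hos E).valuation_exists_uniformizer E
  refine ⟨π, π.2, (hv.unif_lt E π hπ).1, (hv.unif_lt E π hπ).2, fun x hx hx0 => ?_⟩
  obtain ⟨n, -, hn⟩ := hv.exists_unif E π hπ ⟨x, hx⟩ (fun h => hx0 (congrArg Subtype.val h))
  exact ⟨-n, hn⟩

theorem IsPl.eq_of_pid_eq (hv : IsPl p v) {q : ℕ} {w : AbsoluteValue Ω ℝ} (hw : IsPl q w)
    (h : hv.pid E = hw.pid E) : ∀ x ∈ E, v x = w x := by
  have hhos : hv.hos E = hw.hos E := HeightOneSpectrum.ext h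
  have hpq : p = q := by
    refine hw.p_unique hv.prime ?_
    have := hv.p_mem_pid E
    rw [h, hw.mem_pid E] at this
    simpa using this
  subst hpq
  obtain ⟨π, hπ⟩ := (hv.hos E).valuation_exists_uniformizer E
  have hπ' := hπ
  rw [hhos] at hπ'
  have key : ∀ x : E, x ≠ 0 → ∃ n : ℤ, v (x : Ω) = v (π : Ω) ^ n ∧ w (x : Ω) = w (π : Ω) ^ n := by
    intro x hx
    obtain ⟨n, hn, hn'⟩ := hv.exists_unif E π hπ x hx
    obtain ⟨m, hm, hm'⟩ := hw.exists_unif E π hπ' x hx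
    rw [hhos, hm] at hn
    have : m = n := WithZero.exp_injective hn
    subst this
    exact ⟨-m, hn', hm'⟩
  have hvw : v (π : Ω) = w (π : Ω) := by
    obtain ⟨n, h1, h2⟩ := key (p : E) (by exact_mod_cast hv.prime.ne_zero)
    have e : (((p : E)) : Ω) = p := by simp
    rw [e, hv.vp] at h1
    rw [e, hw.vp] at h2
    have hn : n ≠ 0 := by
      rintro rfl
      rw [zpow_zero] at h1
      have := hv.vp_lt
      rw [hv.vp, h1] at this
      exact lt_irrefl _ this
    exact (zpow_left_inj₀ (v.nonneg _) (w.nonneg _) hn).1 (h1.symm.trans h2)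
  intro x hx
  by_cases hx0 : x = 0
  · simp [hx0]
  · obtain ⟨n, h1, h2⟩ := key ⟨x, hx⟩ (fun h => hx0 (congrArg Subtype.val h))
    exact h1.trans (by rw [hvw]; exact h2.symm)

end Places

end NU

namespace NU

open IntermediateField NumberField IsDedekindDomain

section WA

variable {Ω : Type*} [Field Ω] [CharZero Ω]

/-- restriction of an absolute value to a subfield -/
noncomputable def res (E : IntermediateField ℚ Ω) (v : AbsoluteValue Ω ℝ) : AbsoluteValue E ℝ :=
  v.comp (f := algebraMap E Ω) (algebraMap E Ω).injective

theorem res_apply (E : IntermediateField ℚ Ω) (v : AbsoluteValue Ω ℝ) (x : E) :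
    res E v x = v (x : Ω) := rfl

theorem res_eq_iff {E : IntermediateField ℚ Ω} {v w : AbsoluteValue Ω ℝ} :
    res E v = res E w ↔ ∀ x ∈ E, v x = w x := by
  constructor
  · intro h x hx
    have := DFunLike.congr_fun h (⟨x, hx⟩ : E)
    exact this
  · intro h
    ext x
    exact h x x.2

theorem res_equiv {E : IntermediateField ℚ Ω} {v w : AbsoluteValue Ω ℝ} {p q : ℕ}
    (hv : IsPl p v) (hw : IsPl q w) (h : (res E v).IsEquiv (res E w)) : res E v = res E w := by
  obtain ⟨c, hc, h⟩ := AbsoluteValue.isEquiv_iff_exists_rpow_eq.1 h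
  have h1 : ∀ x : E, v (x : Ω) ^ c = w (x : Ω) := fun x => congrFun h x
  have h2 := h1 (p : E)
  have e : (((p : E)) : Ω) = p := by simp
  rw [e] at h2
  have hwp : w (p : Ω) < 1 := by
    rw [← h2]
    exact Real.rpow_lt_one (v.nonneg _) hv.vp_lt hc
  have hpq : p = q := hw.p_unique hv.prime hwp
  subst hpq
  rw [hv.vp, hw.vp] at h2
  have hp1 : (1 : ℝ) < p := by exact_mod_cast hv.prime.one_lt
  have hc1 : c = 1 := by
    have h0 : (0:ℝ) < (p : ℝ)⁻¹ := by positivity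
    have h3 : ((p : ℝ)⁻¹) ^ c = ((p : ℝ)⁻¹) ^ (1:ℝ) := by rw [h2, Real.rpow_one]
    exact (Real.strictAnti_rpow_of_base_lt_one h0 (inv_lt_one_of_one_lt₀ hp1)).injective h3
  ext x
  have := h1 x
  rw [hc1, Real.rpow_one] at this
  exact this

theorem weak_approx (E : IntermediateField ℚ Ω) {ι : Type*} [Finite ι]
    (v : ι → AbsoluteValue Ω ℝ) (hv : ∀ i, ∃ p, IsPl p (v i)) (t : ι → Ω) (ht : ∀ i, t i ∈ E)
    (hc : ∀ i j, (∀ x ∈ E, v i x = v j x) → t i = t j) {ε : ℝ} (hε : 0 < ε) :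
    ∃ x ∈ E, ∀ i, v i (x - t i) < ε := by
  classical
  let f : ι → AbsoluteValue E ℝ := fun i => res E (v i)
  let κ := Set.range f
  haveI : Finite κ := Set.finite_range f |>.to_subtype
  let u : κ → AbsoluteValue E ℝ := Subtype.val
  choose g hg using fun k : κ => k.2
  have h1 : ∀ k : κ, (u k).IsNontrivial := by
    intro k
    obtain ⟨p, hp⟩ := hv (g k)
    have : u k = res E (v (g k)) := (hg k).symm
    rw [this]
    refine ⟨(p : E), by exact_mod_cast hp.prime.ne_zero, ?_⟩
    rw [res_apply]
    have e : (((p : E)) : Ω) = p := by simp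
    rw [e]; exact hp.vp_lt.ne
  have h2 : Pairwise fun i j : κ => ¬ (u i).IsEquiv (u j) := by
    intro i j hij h
    apply hij
    obtain ⟨p, hp⟩ := hv (g i)
    obtain ⟨q, hq⟩ := hv (g j)
    apply Subtype.ext
    rw [← hg i, ← hg j]
    have hi : u i = res E (v (g i)) := (hg i).symm
    have hj : u j = res E (v (g j)) := (hg j).symm
    rw [hi, hj] at h
    exact res_equiv hp hq h
  haveI := Fintype.ofFinite κ
  have hd := Metric.denseRange_iff.1 (AbsoluteValue.denseRange_algebraMap_pi h1 h2)
    (fun k => WithAbs.toAbs (u k) ⟨t (g k), ht _⟩) ε hε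
  obtain ⟨x, hx⟩ := hd
  refine ⟨x, x.2, fun i => ?_⟩
  have hx' := (dist_pi_lt_iff hε).1 hx ⟨f i, ⟨i, rfl⟩⟩
  set k : κ := ⟨f i, ⟨i, rfl⟩⟩ with hk
  have htk : t (g k) = t i := by
    apply hc
    exact res_eq_iff.1 (hg k)
  rw [dist_comm, dist_eq_norm] at hx'
  have hx'' : u k (x - ⟨t (g k), ht _⟩) < ε := hx'
  have : u k (x - ⟨t (g k), ht _⟩) = v i ((x : Ω) - t (g k)) := rfl
  rw [this, htk] at hx''
  exact hx''

end WA

section Trans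

variable {Ω : Type*} [Field Ω] [CharZero Ω] [Algebra.IsAlgebraic ℚ Ω] [IsAlgClosed Ω]

theorem isOpen_apply (x : Ω) (A : Set Ω) : IsOpen {g : Ω ≃ₐ[ℚ] Ω | g x ∈ A} := by
  rw [isOpen_iff_forall_mem_open]
  intro g hg
  have hs := stabilizer_isOpen_of_isIntegral (K := ℚ) x
  refine ⟨(fun h => g⁻¹ * h) ⁻¹' (MulAction.stabilizer (Ω ≃ₐ[ℚ] Ω) x : Set _), ?_,
    hs.preimage (continuous_const_mul _), ?_⟩
  · intro h hh
    have h1 : (g⁻¹ * h) x = x := hh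
    have : h x = g x := by
      conv_rhs => rw [← h1]
      rw [AlgEquiv.mul_apply]
      exact (g.apply_symm_apply _).symm
    change h x ∈ A
    rw [this]; exact hg
  · change (g⁻¹ * g) x = x
    simp

theorem isClosed_apply (x : Ω) (A : Set Ω) : IsClosed {g : Ω ≃ₐ[ℚ] Ω | g x ∈ A} := by
  rw [← isOpen_compl_iff]
  exact isOpen_apply x Aᶜ

theorem isClosed_Dec (v : AbsoluteValue Ω ℝ) : IsClosed (Dec v : Set (Ω ≃ₐ[ℚ] Ω)) := by
  have : (Dec v : Set (Ω ≃ₐ[ℚ] Ω)) = ⋂ x : Ω, {g | g x ∈ {y | v y = v x}} := by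
    ext g
    simp only [SetLike.mem_coe, mem_Dec', Set.mem_iInter, Set.mem_ofPred_eq]
  rw [this]
  exact isClosed_iInter fun x => isClosed_apply x _

/-- a finite set is contained in a finite normal extension -/
theorem exists_normal_fin (s : Finset Ω) : ∃ E : IntermediateField ℚ Ω, FiniteDimensional ℚ E ∧
    Normal ℚ E ∧ ∀ x ∈ s, x ∈ E := by
  have hfd : FiniteDimensional ℚ (adjoin ℚ (s : Set Ω)) :=
    finiteDimensional_adjoin fun x _ => Algebra.IsIntegral.isIntegral x
  refine ⟨normalClosure ℚ (adjoin ℚ (s : Set Ω)) Ω, inferInstance, normalClosure.normal _ _ _, fun x hx => ?_⟩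
  exact (adjoin ℚ (s : Set Ω)).le_normalClosure (subset_adjoin ℚ _ hx)

theorem restrictNormalHom_coe (E : IntermediateField ℚ Ω) [Normal ℚ E] (g : Ω ≃ₐ[ℚ] Ω) (x : E) :
    ((AlgEquiv.restrictNormalHom E g x : E) : Ω) = g x :=
  AlgEquiv.restrictNormal_commutes g E x

theorem normal_mem {E : IntermediateField ℚ Ω} [Normal ℚ E] (g : Ω ≃ₐ[ℚ] Ω) {x : Ω} (hx : x ∈ E) :
    g x ∈ E := by
  rw [← restrictNormalHom_coe E g ⟨x, hx⟩]
  exact (AlgEquiv.restrictNormalHom E g ⟨x, hx⟩).2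

variable {p q : ℕ} {v w : AbsoluteValue Ω ℝ}

theorem trans_fin (H : Subgroup (Ω ≃ₐ[ℚ] Ω)) (hv : IsPl p v) (hw : IsPl q w)
    (hvw : ∀ x ∈ fixedField H, v x = w x) (E : IntermediateField ℚ Ω) [FiniteDimensional ℚ E]
    [Normal ℚ E] : ∃ h ∈ H, ∀ x ∈ E, v (h x) = w x := by
  classical
  by_contra hcon
  push Not at hcon
  let A : Subgroup (E ≃ₐ[ℚ] E) := H.map (AlgEquiv.restrictNormalHom E)
  have hA : ∀ a : A, ∃ h ∈ H, AlgEquiv.restrictNormalHom E h = a := fun a => a.2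
  choose l hl hla using hA
  have hlx : ∀ (a : A) (x : E), l a (x : Ω) = ((a : E ≃ₐ[ℚ] E) x : E) := by
    intro a x
    rw [← hla a, restrictNormalHom_coe]
  obtain ⟨x, hxE, hx⟩ := weak_approx E (ι := A ⊕ A)
    (Sum.elim (fun a => pull v (l a)) (fun a => pull w (l a)))
    (by rintro (a | a); exacts [⟨p, hv.pull _⟩, ⟨q, hw.pull _⟩])
    (Sum.elim (fun _ => 1) (fun _ => 0))
    (by rintro (a | a); exacts [E.one_mem, E.zero_mem])
    (by
      have key : ∀ a b : A, ¬ (∀ x ∈ E, v (l a x) = w (l b x)) := by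
        intro a b hab
        obtain ⟨x, hx, hne⟩ := hcon (l a * (l b)⁻¹) (H.mul_mem (hl a) (H.inv_mem (hl b)))
        apply hne
        have := hab ((l b)⁻¹ x) (normal_mem _ hx)
        rw [AlgEquiv.mul_apply, this]
        congr 1
        exact (l b).apply_symm_apply x
      rintro (a | a) (b | b) h
      · rfl
      · exact absurd h (key a b)
      · exact absurd (fun x hx => (h x hx).symm) (key b a)
      · rfl) one_pos
  let N : Ω := ∏ a : A, l a x
  have hN : N ∈ fixedField H := by
    rw [mem_fixedField']
    intro h hh
    let b : A := ⟨AlgEquiv.restrictNormalHom E h, ⟨h, hh, rfl⟩⟩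
    have : ∀ a : A, h (l a x) = l (b * a) x := by
      intro a
      have e1 := hlx a ⟨x, hxE⟩
      have e2 := hlx (b * a) ⟨x, hxE⟩
      simp only at e1 e2
      rw [e1, e2, ← restrictNormalHom_coe]
      rfl
    simp only [N, map_prod, this]
    exact Fintype.prod_equiv (Equiv.mulLeft b) _ _ fun a => rfl
  have h1 : v N = 1 := by
    simp only [N, map_prod]
    refine Finset.prod_eq_one fun a _ => ?_
    have := hx (Sum.inl a)
    simp only [Sum.elim_inl, pull_apply, map_sub, map_one] at this
    exact hv.eq_one_of_sub_lt this
  have h2 : w N < 1 := by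
    have h3 : ∀ a : A, w (l a x) < 1 := fun a => by
      have := hx (Sum.inr a)
      simpa using this
    simp only [N, map_prod]
    rw [← Finset.mul_prod_erase _ _ (Finset.mem_univ (1 : A))]
    refine mul_lt_one_of_nonneg_of_lt_one_left (w.nonneg _) (h3 1) ?_
    exact Finset.prod_le_one (fun _ _ => w.nonneg _) fun a _ => (h3 a).le
  rw [← hvw N hN, h1] at h2
  exact lt_irrefl _ h2

theorem trans_H {H : Subgroup (Ω ≃ₐ[ℚ] Ω)} (hH : IsClosed (H : Set (Ω ≃ₐ[ℚ] Ω)))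
    (hv : IsPl p v) (hw : IsPl q w)
    (hvw : ∀ x ∈ fixedField H, v x = w x) : ∃ h ∈ H, pull v h = w := by
  have := hH.isCompact.inter_iInter_nonempty (fun x : Ω => {g : Ω ≃ₐ[ℚ] Ω | g x ∈ {y | v y = w x}})
    (fun x => isClosed_apply x _) (by
      intro u
      obtain ⟨E, hE, hn, hu⟩ := exists_normal_fin u
      obtain ⟨h, hh, hx⟩ := trans_fin H hv hw hvw E
      exact ⟨h, hh, Set.mem_iInter₂.2 fun x hxu => hx x (hu x hxu)⟩)
  obtain ⟨h, hh, hx⟩ := this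
  refine ⟨h, hh, ?_⟩
  ext x
  exact Set.mem_iInter.1 hx x

/-- two places over the same prime are conjugate -/
theorem trans_all (hv : IsPl p v) (hw : IsPl p w) : ∃ g, pull v g = w := by
  obtain ⟨h, -, hh⟩ := trans_H (H := ⊤) (by simp) hv hw (by
    intro x hx
    haveI : FiniteDimensional ℚ (⊥ : IntermediateField ℚ Ω) := inferInstance
    rw [InfiniteGalois.fixedField_bot] at hx
    have key : ∀ n : ℕ, v (n : Ω) = w n := by
      intro n
      by_cases h0 : n = 0
      · simp [h0]
      obtain ⟨k, m, hm, rfl⟩ := Nat.exists_eq_pow_mul_and_not_dvd h0 p hv.prime.ne_one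
      push_cast
      rw [map_mul, map_mul, map_pow, map_pow, hv.vp, hw.vp, hv.natCast_eq_one hm,
        hw.natCast_eq_one hm]
    have keyz : ∀ n : ℤ, v (n : Ω) = w n := by
      intro n
      rcases Int.natAbs_eq n with h | h <;> rw [h]
      · rw [Int.cast_natCast]; exact key _
      · rw [Int.cast_neg, Int.cast_natCast, map_neg_eq_map, map_neg_eq_map]; exact key _
    obtain ⟨r, rfl⟩ := IntermediateField.mem_bot.1 hx
    have : algebraMap ℚ Ω r = (r.num : Ω) / (r.den : Ω) := by
      rw [eq_ratCast]; exact Rat.cast_def r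
    rw [this, map_div₀, map_div₀, key, keyz])
  exact ⟨h, hh⟩

end Trans

end NU

namespace NU

open IntermediateField NumberField IsDedekindDomain

section ExPl

variable {Ω : Type*} [Field Ω] [CharZero Ω] [Algebra.IsAlgebraic ℚ Ω] [IsAlgClosed Ω]
variable {p : ℕ} {v : AbsoluteValue Ω ℝ}

theorem exists_extend (E : IntermediateField ℚ Ω) (τ : E →ₐ[ℚ] Ω) :
    ∃ g : Ω ≃ₐ[ℚ] Ω, ∀ x : E, g x = τ x := by
  let f : Ω →ₐ[ℚ] Ω := τ.liftNormal Ω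
  refine ⟨AlgEquiv.ofBijective f (Algebra.IsAlgebraic.algHom_bijective f), fun x => ?_⟩
  exact τ.liftNormal_commutes Ω x

theorem exists_pid (hv : IsPl p v) (E : IntermediateField ℚ Ω) [FiniteDimensional ℚ E]
    (y : Ideal (𝓞 E)) [hy : y.IsPrime] (hpy : (p : 𝓞 E) ∈ y) :
    ∃ g, (hv.pull g).pid E = y := by
  classical
  by_contra hcon
  push Not at hcon
  choose ext hext using exists_extend E
  have hy0 : y ≠ ⊥ := by
    rintro rfl
    rw [Ideal.mem_bot] at hpy
    exact hv.prime.ne_zero (by exact_mod_cast hpy)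
  haveI hmax : y.IsMaximal := hy.isMaximal hy0
  let f : (E →ₐ[ℚ] Ω) → Ideal (𝓞 E) := fun τ => (hv.pull (ext τ)).pid E
  have hnot : ¬ ((y : Set (𝓞 E)) ⊆ ⋃ i ∈ ((Finset.univ : Finset (E →ₐ[ℚ] Ω)) : Set _), (f i : Set (𝓞 E))) := by
    intro hsub
    rw [Ideal.subset_union_prime (s := Finset.univ) (f := f) E.val E.val] at hsub
    · obtain ⟨τ, -, hτ⟩ := hsub
      exact hcon (ext τ) (hmax.eq_of_le ((hv.pull (ext τ)).hos E).isPrime.ne_top hτ).symm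
    · intro i _ _ _
      exact ((hv.pull (ext i)).hos E).isPrime
  rw [Set.not_subset] at hnot
  obtain ⟨x, hxy, hx⟩ := hnot
  simp only [Finset.coe_univ, Set.mem_univ, Set.iUnion_true, Set.mem_iUnion, not_exists] at hx
  have h1 : v (algebraMap ℚ Ω (Algebra.norm ℚ (x : E))) = 1 := by
    rw [Algebra.norm_eq_prod_embeddings ℚ Ω (x : E), map_prod]
    refine Finset.prod_eq_one fun τ _ => ?_
    have := ((hv.pull (ext τ)).not_mem_pid E).1 (hx τ)
    rw [pull_apply, hext] at this
    exact this
  have h2 : ((Algebra.norm ℤ x : ℤ) : 𝓞 E) ∈ y := by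
    have h3 := Ideal.absNorm_mem (Ideal.span {x})
    rw [Ideal.absNorm_span_singleton] at h3
    have h4 := (Ideal.span_singleton_le_iff_mem y).2 hxy h3
    rcases Int.natAbs_eq (Algebra.norm ℤ x) with h | h
    · rw [h, Int.cast_natCast]; exact h4
    · rw [h, Int.cast_neg, Int.cast_natCast]; exact y.neg_mem h4
  rw [← Algebra.coe_norm_int, map_intCast] at h1
  set N := Algebra.norm ℤ x
  have h5 : v ((N.natAbs : ℕ) : Ω) = 1 := by
    rw [← h1]
    rcases Int.natAbs_eq N with h | h
    · conv_rhs => rw [h, Int.cast_natCast]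
    · conv_rhs => rw [h, Int.cast_neg, Int.cast_natCast, map_neg_eq_map]
  have h6 : ¬ p ∣ N.natAbs := fun hd => by
    have := (hv.natCast_lt_iff _).2 hd
    exact absurd h5 this.ne
  have h7 : IsCoprime (p : ℤ) N := by
    rw [Int.isCoprime_iff_gcd_eq_one]
    exact (Nat.Prime.coprime_iff_not_dvd hv.prime).2 h6
  obtain ⟨a, b, hab⟩ := h7
  apply hy.ne_top
  rw [Ideal.eq_top_iff_one]
  have : (1 : 𝓞 E) = (a : 𝓞 E) * (p : 𝓞 E) + (b : 𝓞 E) * (N : 𝓞 E) := by exact_mod_cast hab.symm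
  rw [this]
  exact y.add_mem (y.mul_mem_left _ hpy) (y.mul_mem_left _ h2)

variable {E : IntermediateField ℚ Ω}

theorem valSub_integral (O : ValuationSubring E) {x : E} (hx : IsIntegral ℤ x) : x ∈ O := by
  have h : IsIntegral O x := hx.tower_top
  obtain ⟨y, hy⟩ := IsIntegrallyClosed.isIntegral_iff.1 h
  rw [← hy]; exact y.2

theorem valSub_prime (O : ValuationSubring E) (hO : O ≠ ⊤) :
    ∃ p : ℕ, p.Prime ∧ (p : E)⁻¹ ∉ O := by
  by_contra hcon
  push Not at hcon
  apply hO
  have hn : ∀ n : ℕ, (n : E)⁻¹ ∈ O := by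
    intro n
    induction n using induction_on_primes with
    | zero => simp [O.zero_mem]
    | one => simp [O.one_mem]
    | prime_mul p a hp ih =>
      rw [Nat.cast_mul, mul_inv]
      exact O.mul_mem _ _ (hcon p hp) ih
  rw [eq_top_iff]
  intro x _
  have halg : IsAlgebraic ℚ x :=
    isAlgebraic_iff.2 (Algebra.IsAlgebraic.isAlgebraic (x : Ω))
  have halg' : IsAlgebraic ℤ x := (IsFractionRing.isAlgebraic_iff ℤ ℚ E).2 halg
  obtain ⟨y, hy0, hy⟩ := halg'.exists_integral_multiple
  have h1 := valSub_integral O hy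
  have h2 : (y : E)⁻¹ ∈ O := by
    rcases Int.natAbs_eq y with h | h
    · rw [h, Int.cast_natCast]; exact hn _
    · rw [h, Int.cast_neg, Int.cast_natCast, inv_neg]; exact O.neg_mem _ (hn _)
  have h3 : x = (y : E)⁻¹ * (y • x) := by
    have : (y : E) ≠ 0 := by exact_mod_cast hy0
    rw [zsmul_eq_mul]; field_simp
  rw [h3]
  exact O.mul_mem _ _ h2 h1

theorem valSub_fin (O : ValuationSubring E) (hv : IsPl p v) (hp : (p : E)⁻¹ ∉ O)
    (E0 : IntermediateField ℚ Ω) [FiniteDimensional ℚ E0] (hle : E0 ≤ E) :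
    ∃ g : Ω ≃ₐ[ℚ] Ω, ∀ x : E, (x : Ω) ∈ E0 → x ∈ O → v (g x) ≤ 1 := by
  let ψ : 𝓞 E0 →+* E := (inclusion hle : E0 →+* E).comp (algebraMap (𝓞 E0) E0)
  have hψ : ∀ a, ψ a ∈ O.toSubring := fun a =>
    valSub_integral O ((RingOfIntegers.isIntegral_coe a).map
      ((inclusion hle : E0 →+* E).toIntAlgHom))
  let φ : 𝓞 E0 →+* O := ψ.codRestrict O.toSubring hψ
  let y : Ideal (𝓞 E0) := (IsLocalRing.maximalIdeal O).comap φ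
  haveI : y.IsPrime := Ideal.comap_isPrime _ _
  have hmem : ∀ a, a ∈ y ↔ ¬ IsUnit (φ a) := fun a => Iff.rfl
  have hunit : ∀ b : O, (b : E) ≠ 0 → (b : E)⁻¹ ∈ O → IsUnit b := fun b hb hbi =>
    IsUnit.of_mul_eq_one (⟨(b : E)⁻¹, hbi⟩ : O) (Subtype.ext (mul_inv_cancel₀ hb))
  have hunit' : ∀ b : O, IsUnit b → (b : E)⁻¹ ∈ O := by
    rintro b ⟨u, rfl⟩
    have : ((u : O) : E)⁻¹ = ((u⁻¹ : Oˣ) : O) := by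
      apply inv_eq_of_mul_eq_one_right
      rw [← MulMemClass.coe_mul, Units.mul_inv]; rfl
    rw [this]; exact Subtype.mem _
  have hpy : (p : 𝓞 E0) ∈ y := by
    rw [hmem]
    intro h
    have := hunit' _ h
    rw [map_natCast] at this
    exact hp (by simpa using this)
  obtain ⟨g, hg⟩ := exists_pid hv E0 y hpy
  refine ⟨g, fun x hx hxO => ?_⟩
  by_contra hlt
  push Not at hlt
  set w := pull v g
  have hw : IsPl p w := hv.pull g
  have hx0 : (x : Ω) ≠ 0 := by
    intro h0
    rw [h0] at hlt; simp at hlt; linarith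
  have hx0' : x ≠ 0 := fun h => hx0 (by rw [h]; rfl)
  have hwx : w (x : Ω)⁻¹ < 1 := by
    rw [map_inv₀]; exact inv_lt_one_of_one_lt₀ hlt
  obtain ⟨s, t, ht, hst⟩ := hw.exists_denom E0 (x := ⟨(x : Ω)⁻¹, E0.inv_mem hx⟩) hwx.le
  have htu : IsUnit (φ t) := by
    have : t ∉ y := by rw [← hg]; exact (hw.not_mem_pid E0).2 ht
    rw [hmem] at this
    exact not_not.1 this
  have hs : s ∈ y := by
    rw [← hg, hw.mem_pid E0, ← hst]
    change w ((x : Ω)⁻¹ * ((t : E0) : Ω)) < 1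
    rw [map_mul, ht, mul_one]; exact hwx
  rw [hmem] at hs
  apply hs
  have e1 : x⁻¹ * ψ t = ψ s := by
    apply Subtype.ext
    exact congrArg (fun z : E0 => (z : Ω)) hst
  have ht0 : ψ t ≠ 0 := by
    intro h0
    have : (φ t) = 0 := Subtype.ext h0
    rw [this] at htu
    exact not_isUnit_zero htu
  refine hunit _ ?_ ?_
  · change ψ s ≠ 0
    rw [← e1]; exact mul_ne_zero (inv_ne_zero hx0') ht0
  · change (ψ s)⁻¹ ∈ O
    rw [← e1, mul_inv, inv_inv]
    exact O.mul_mem _ _ hxO (hunit' _ htu)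

theorem valSub_place (O : ValuationSubring E) (hO : O ≠ ⊤) :
    ∃ p v, IsPl p v ∧ ∀ x : E, x ∈ O → v (x : Ω) ≤ 1 := by
  classical
  obtain ⟨p, hp, hpO⟩ := valSub_prime O hO
  obtain ⟨v, hv⟩ := exists_isPl (Ω := Ω) hp
  have := isCompact_univ.inter_iInter_nonempty
    (fun x : O => {g : Ω ≃ₐ[ℚ] Ω | g ((x : E) : Ω) ∈ {y | v y ≤ 1}})
    (fun x => isClosed_apply _ _) (by
      intro u
      let s : Set Ω := ((fun x : O => ((x : E) : Ω)) '' u)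
      have hs : s.Finite := u.finite_toSet.image _
      haveI := hs.to_subtype
      haveI : FiniteDimensional ℚ (adjoin ℚ s) :=
        finiteDimensional_adjoin fun x _ => Algebra.IsIntegral.isIntegral x
      obtain ⟨g, hg⟩ := valSub_fin O hv hpO (adjoin ℚ s) (by
        rw [adjoin_le_iff]
        rintro _ ⟨x, _, rfl⟩
        exact Subtype.mem _)
      refine ⟨g, trivial, Set.mem_iInter₂.2 fun x hxu => hg x ?_ x.2⟩
      exact subset_adjoin ℚ _ ⟨x, hxu, rfl⟩)
  obtain ⟨g, -, hg⟩ := this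
  refine ⟨p, pull v g, hv.pull g, fun x hx => ?_⟩
  exact Set.mem_iInter.1 hg ⟨x, hx⟩

end ExPl

end NU

namespace NU

open IntermediateField NumberField IsDedekindDomain

section ThmA

variable {Ω : Type*} [Field Ω] [CharZero Ω] [Algebra.IsAlgebraic ℚ Ω] [IsAlgClosed Ω]

/-- The group theoretic condition. -/
structure TT (H : Subgroup (Ω ≃ₐ[ℚ] Ω)) : Prop where
  closed : IsClosed (H : Set (Ω ≃ₐ[ℚ] Ω))
  im : ∃ i ∈ fixedField H, i ^ 2 = -1
  cnt : ∀ V : Subgroup (Ω ≃ₐ[ℚ] Ω), IsOpen (V : Set (Ω ≃ₐ[ℚ] Ω)) → chCard 2 Ω ↥(H ⊓ V) = 4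

variable {H : Subgroup (Ω ≃ₐ[ℚ] Ω)}

theorem fixedField_mono {H H' : Subgroup (Ω ≃ₐ[ℚ] Ω)} (h : H ≤ H') :
    fixedField H' ≤ fixedField H := fun x hx => by
  rw [mem_fixedField'] at hx ⊢
  exact fun g hg => hx g (h hg)

theorem TT.inf (hH : TT H) {V : Subgroup (Ω ≃ₐ[ℚ] Ω)} (hV : IsOpen (V : Set (Ω ≃ₐ[ℚ] Ω))) :
    TT (H ⊓ V) where
  closed := by
    rw [Subgroup.coe_inf]; exact hH.closed.inter (V.isClosed_of_isOpen hV)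
  im := by
    obtain ⟨i, hi, h⟩ := hH.im
    exact ⟨i, fixedField_mono inf_le_left hi, h⟩
  cnt := fun W hW => by
    rw [inf_assoc]
    exact hH.cnt _ (by rw [Subgroup.coe_inf]; exact hV.inter hW)

theorem mu_two {E : IntermediateField ℚ Ω} (z : Ω) (hz : z ^ 2 = 1) : z ∈ E := by
  rcases mul_self_eq_one_iff.1 ((sq z).symm.trans hz) with h | h
  · rw [h]; exact E.one_mem
  · rw [h]; exact E.neg_mem E.one_mem

theorem TT.index (hH : TT H) : (powSub 2 (fixedField H)).index = 4 := by
  rw [← kummer_card Nat.prime_two hH.closed mu_two]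
  have := hH.cnt ⊤ (by simp)
  rwa [inf_top_eq] at this

theorem TT.rigid (hH : TT H) : ∃ cl, Rigid (F := fixedField H) cl ∧
    ∀ x ≠ 0, (cl x = 0 ↔ ∃ y, y ^ 2 = x) := by
  obtain ⟨i, hi, hi2⟩ := hH.im
  refine exists_rigid hH.index ⟨⟨i, hi⟩, Subtype.ext hi2⟩ ?_
  intro z hz0 hz
  obtain ⟨s, hs⟩ := IsAlgClosed.exists_pow_nat_eq (z : Ω) (n := 2) two_pos
  let V : Subgroup (Ω ≃ₐ[ℚ] Ω) := MulAction.stabilizer (Ω ≃ₐ[ℚ] Ω) s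
  have hV : IsOpen (V : Set (Ω ≃ₐ[ℚ] Ω)) := stabilizer_isOpen_of_isIntegral (K := ℚ) s
  have hmV : ∀ g : Ω ≃ₐ[ℚ] Ω, g ∈ V ↔ g s = s := fun g => Iff.rfl
  have hsn : s ∉ fixedField H := by
    intro h
    exact hz ⟨⟨s, h⟩, Subtype.ext hs⟩
  rw [mem_fixedField'] at hsn
  push Not at hsn
  have hz' := mem_fixedField'.1 z.2
  have hpm : ∀ h ∈ H, h s = s ∨ h s = -s := by
    intro h hh
    have : (h s) ^ 2 = s ^ 2 := by rw [← map_pow, hs, hz' h hh]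
    exact sq_eq_sq_iff_eq_or_eq_neg.1 this
  obtain ⟨σ, hσ, hσs⟩ := hsn
  have hσs : σ s = -s := (hpm σ hσ).resolve_left hσs
  have hs0 : s ≠ 0 := by
    rintro rfl
    apply hz0
    apply Subtype.ext
    rw [← hs]; simp
  let E' := fixedField (H ⊓ V)
  have hE' : ∀ {x}, x ∈ E' → ∀ h ∈ H, h s = s → h x = x := fun hx h hh hhs =>
    mem_fixedField'.1 hx h ⟨hh, hhs⟩
  have key : ∀ x ∈ E', ∀ h ∈ H, (h x = x ∧ h (σ x) = σ x) ∨ (h x = σ x ∧ h (σ x) = x) := by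
    intro x hx h hh
    rcases hpm h hh with h1 | h1
    · left
      refine ⟨hE' hx h hh h1, ?_⟩
      have h2 : (σ⁻¹ * h * σ) x = x := by
        refine hE' hx _ (H.mul_mem (H.mul_mem (H.inv_mem hσ) hh) hσ) ?_
        rw [AlgEquiv.mul_apply, AlgEquiv.mul_apply, hσs, map_neg, h1, ← hσs]
        exact σ.symm_apply_apply s
      have h3 := congrArg σ h2
      rw [AlgEquiv.mul_apply, AlgEquiv.mul_apply] at h3
      exact (σ.apply_symm_apply _).symm.trans h3
    · right
      constructor
      · have h2 : (σ⁻¹ * h) x = x := by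
          refine hE' hx _ (H.mul_mem (H.inv_mem hσ) hh) ?_
          rw [AlgEquiv.mul_apply, h1, ← hσs]
          exact σ.symm_apply_apply s
        have h3 := congrArg σ h2
        rw [AlgEquiv.mul_apply] at h3
        rw [← h3]
        exact (σ.apply_symm_apply _).symm
      · have h2 : (h * σ) x = x := by
          refine hE' hx _ (H.mul_mem hh hσ) ?_
          rw [AlgEquiv.mul_apply, hσs, map_neg, h1, neg_neg]
        exact h2
  have hq := rigid_of_quadratic (fixedField H).toSubfield E'.toSubfield
    (fun x hx => fixedField_mono inf_le_left hx) σ.toRingEquiv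
    (fun x hx => mem_fixedField'.1 hx σ hσ)
    (fun x hx => by
      change x * σ x ∈ fixedField H
      rw [mem_fixedField']
      intro h hh
      rcases key x hx h hh with ⟨h1, h2⟩ | ⟨h1, h2⟩
      · rw [map_mul, h1, h2]
      · rw [map_mul, h1, h2, mul_comm])
    (fun x hx => by
      change x + σ x ∈ fixedField H
      rw [mem_fixedField']
      intro h hh
      rcases key x hx h hh with ⟨h1, h2⟩ | ⟨h1, h2⟩
      · rw [map_add, h1, h2]
      · rw [map_add, h1, h2, add_comm])
    s (mem_fixedField'.2 fun h hh => hh.2) hs0 (by rw [hs]; exact z.2) hσs i hi hi2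
    hH.index (hH.inf hV).index
  rw [hs] at hq
  rcases hq with ⟨y, hy, h⟩ | ⟨y, hy, h⟩
  · exact Or.inl ⟨⟨y, hy⟩, Subtype.ext h⟩
  · exact Or.inr ⟨⟨y, hy⟩, Subtype.ext h⟩

/-- Units congruent to one are squares. -/
def QQ (v : AbsoluteValue Ω ℝ) (E : IntermediateField ℚ Ω) : Prop :=
  ∀ x ∈ E, v (x - 1) < 1 → ∃ y ∈ E, y ^ 2 = x

variable {p q : ℕ} {v w : AbsoluteValue Ω ℝ}

theorem TT.exists_place (hH : TT H) : ∃ p v, IsPl p v ∧ QQ v (fixedField H) := by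
  obtain ⟨cl, hr, hcl⟩ := hH.rigid
  obtain ⟨O, hO, h⟩ := hr.exists_valuationSubring
  obtain ⟨p, v, hv, hvO⟩ := valSub_place O hO
  refine ⟨p, v, hv, fun x hx hx1 => ?_⟩
  by_cases h0 : x - 1 = 0
  · rw [sub_eq_zero] at h0
    exact ⟨1, one_mem _, by rw [h0]; simp⟩
  set y : fixedField H := ⟨x, hx⟩ - 1 with hy
  have hy' : (y : Ω) = x - 1 := rfl
  have hy0 : y ≠ 0 := fun h => h0 (congrArg Subtype.val h)
  have hyi : y⁻¹ ∉ O := by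
    intro hmem
    have h1 := hvO _ hmem
    rw [show ((y⁻¹ : fixedField H) : Ω) = (x - 1)⁻¹ from rfl, map_inv₀] at h1
    have := (one_lt_inv₀ (v.pos h0)).2 hx1
    linarith
  have hyO : y ∈ O := (O.mem_or_inv_mem y).resolve_right hyi
  have h2 := h y hyO hy0 hyi
  have h3 : 1 + y = ⟨x, hx⟩ := by rw [hy]; ring
  rw [h3] at h2
  have hx0 : (⟨x, hx⟩ : fixedField H) ≠ 0 := by
    intro h4
    have h5 : x = 0 := congrArg Subtype.val h4
    rw [h5] at hx1
    simp at hx1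
  obtain ⟨z, hz⟩ := (hcl _ hx0).1 h2
  exact ⟨z, z.2, congrArg Subtype.val hz⟩

/-- There are four square classes, so not all products of nonsquares are squares. -/
theorem TT.exists_ab (hH : TT H) : ∃ a b : Ω, a ∈ fixedField H ∧ b ∈ fixedField H ∧ a ≠ 0 ∧ b ≠ 0 ∧
    (∀ y ∈ fixedField H, y ^ 2 ≠ a) ∧ (∀ y ∈ fixedField H, y ^ 2 ≠ b) ∧
    (∀ y ∈ fixedField H, y ^ 2 ≠ a * b) := by
  obtain ⟨cl, hr, hcl⟩ := hH.rigid
  have key : ∀ c : V4, c ≠ 0 → ∃ a : fixedField H, a ≠ 0 ∧ cl a = c := fun c _ => hr.surj c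
  obtain ⟨c, d, hc, hd, hcd⟩ : ∃ c d : V4, c ≠ 0 ∧ d ≠ 0 ∧ c + d ≠ 0 := by
    decide
  obtain ⟨a, ha0, ha⟩ := hr.surj c
  obtain ⟨b, hb0, hb⟩ := hr.surj d
  have ns : ∀ x : fixedField H, x ≠ 0 → cl x ≠ 0 → ∀ y ∈ fixedField H, y ^ 2 ≠ (x : Ω) := by
    intro x hx0 hx y hy h
    exact hx ((hcl x hx0).2 ⟨⟨y, hy⟩, Subtype.ext h⟩)
  refine ⟨a, b, a.2, b.2, fun h => ha0 (Subtype.ext h), fun h => hb0 (Subtype.ext h),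
    ns a ha0 (by rw [ha]; exact hc), ns b hb0 (by rw [hb]; exact hd), ?_⟩
  exact ns (a * b) (mul_ne_zero ha0 hb0) (by rw [hr.mul _ _ ha0 hb0, ha, hb]; exact hcd)

/-- residue fields are finite: `x ^ (p ^ k) ≡ x`. -/
theorem IsPl.frob (hv : IsPl p v) {x : Ω} (hx : v x = 1) :
    ∃ k : ℕ, 0 < k ∧ v (x ^ (p ^ k) - x) < 1 := by
  haveI : FiniteDimensional ℚ (adjoin ℚ {x}) :=
    adjoin.finiteDimensional (Algebra.IsIntegral.isIntegral x)
  set E := adjoin ℚ {x}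
  let y := hv.pid E
  haveI : Fact p.Prime := ⟨hv.prime⟩
  haveI hyp : y.IsPrime := (hv.hos E).isPrime
  have hy0 : y ≠ ⊥ := (hv.hos E).ne_bot
  haveI : y.IsMaximal := hyp.isMaximal hy0
  letI : Field (𝓞 E ⧸ y) := Ideal.Quotient.field y
  haveI : Finite (𝓞 E ⧸ y) := Ideal.finiteQuotientOfFreeOfNeBot y hy0
  haveI := Fintype.ofFinite (𝓞 E ⧸ y)
  haveI : CharP (𝓞 E ⧸ y) p := by
    refine (CharP.charP_iff_prime_eq_zero hv.prime).2 ?_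
    have := Ideal.Quotient.eq_zero_iff_mem.2 (hv.p_mem_pid E)
    simpa using this
  obtain ⟨k, hk, hcard⟩ := FiniteField.card (𝓞 E ⧸ y) p
  have hfact : ∀ a : 𝓞 E, v (((a : E) : Ω) ^ (p ^ (k : ℕ)) - ((a : E) : Ω)) < 1 := by
    intro a
    have h1 : a ^ (p ^ (k : ℕ)) - a ∈ y := by
      rw [← Ideal.Quotient.eq_zero_iff_mem, map_sub, map_pow, ← hcard, FiniteField.pow_card, sub_self]
    exact h1
  refine ⟨k, k.pos, ?_⟩
  obtain ⟨s, t, ht, hst⟩ := hv.exists_denom E (x := ⟨x, mem_adjoin_simple_self ℚ x⟩) hx.le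
  set n := p ^ (k : ℕ)
  set t' : Ω := ((t : E) : Ω)
  set s' : Ω := ((s : E) : Ω)
  have e1 : x * t' = s' := congrArg (fun z : E => (z : Ω)) hst
  have ht0 : v t' = 1 := ht
  have hs := hfact s
  have htt := hfact t
  have e2 : t' ^ n * (x ^ n - x) = (s' ^ n - s') - x * (t' ^ n - t') := by
    have : s' ^ n = x ^ n * t' ^ n := by rw [← e1, mul_pow]
    rw [this, ← e1]; ring
  have h3 : v (t' ^ n * (x ^ n - x)) < 1 := by
    rw [e2]
    refine hv.sub_lt hs ?_
    rw [map_mul, hx, one_mul]; exact htt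
  rwa [map_mul, map_pow, ht0, one_pow, one_mul] at h3

theorem TT.ne_two (hH : TT H) (hv : IsPl p v) (hQ : QQ v (fixedField H)) : p ≠ 2 := by
  rintro rfl
  set F := fixedField H
  have hunit : ∀ x ∈ F, v x = 1 → ∃ y ∈ F, y ^ 2 = x := by
    intro x hx hvx
    have hx0 : x ≠ 0 := by rintro rfl; simp at hvx
    obtain ⟨k, hk, h⟩ := hv.frob hvx
    obtain ⟨m, rfl⟩ : ∃ m, k = m + 1 := ⟨k - 1, by omega⟩
    set z := x ^ (2 ^ m)
    have hz : z ^ 2 = x ^ (2 ^ (m + 1)) := by rw [← pow_mul, pow_succ]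
    have hzF : z ∈ F := pow_mem hx _
    obtain ⟨y, hy, hyy⟩ := hQ (z ^ 2 * x⁻¹) (F.mul_mem (pow_mem hzF _) (F.inv_mem hx)) (by
      have : z ^ 2 * x⁻¹ - 1 = (z ^ 2 - x) * x⁻¹ := by field_simp
      rw [this, map_mul, map_inv₀, hvx, inv_one, mul_one, hz]; exact h)
    have hz0 : z ≠ 0 := pow_ne_zero _ hx0
    have hy0 : y ≠ 0 := by
      rintro rfl
      have : z ^ 2 * x⁻¹ ≠ 0 := mul_ne_zero (pow_ne_zero _ hz0) (inv_ne_zero hx0)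
      exact this (by rw [← hyy]; simp)
    refine ⟨z / y, F.div_mem hzF hy, ?_⟩
    rw [div_pow, hyy]; field_simp
  obtain ⟨a, b, ha, hb, ha0, hb0, hna, hnb, hnab⟩ := hH.exists_ab
  haveI : FiniteDimensional ℚ (adjoin ℚ {a, b}) :=
    finiteDimensional_adjoin fun x _ => Algebra.IsIntegral.isIntegral x
  have hle : adjoin ℚ {a, b} ≤ F := by
    rw [adjoin_le_iff]; rintro x (rfl | rfl); exacts [ha, hb]
  obtain ⟨π, hπ, hπ0, hπ1, hd⟩ := hv.discrete (adjoin ℚ {a, b})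
  have hπF := hle hπ
  have hπne : π ≠ 0 := fun h => by rw [h] at hπ0; simp at hπ0
  have heven : ∀ x ∈ F, ∀ m : ℤ, v x = v π ^ (m + m) → ∃ y ∈ F, y ^ 2 = x := by
    intro x hx m h
    obtain ⟨y, hy, hyy⟩ := hunit (x / (π ^ m) ^ 2) (F.div_mem hx (pow_mem (zpow_mem hπF m) 2)) (by
      rw [map_div₀, map_pow, map_zpow₀, h, ← two_mul, mul_comm, zpow_mul, zpow_ofNat]
      exact div_self (pow_ne_zero _ (zpow_ne_zero _ hπ0.ne')))
    refine ⟨y * π ^ m, F.mul_mem hy (zpow_mem hπF m), ?_⟩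
    rw [mul_pow, hyy, div_mul_cancel₀]
    exact pow_ne_zero _ (zpow_ne_zero _ hπne)
  obtain ⟨m, hm⟩ := hd a (subset_adjoin ℚ _ (by simp)) ha0
  obtain ⟨n, hn⟩ := hd b (subset_adjoin ℚ _ (by simp)) hb0
  rcases Int.even_or_odd m with ⟨m', rfl⟩ | hm'
  · obtain ⟨y, hy, h⟩ := heven a ha m' hm; exact hna y hy h
  rcases Int.even_or_odd n with ⟨n', rfl⟩ | hn'
  · obtain ⟨y, hy, h⟩ := heven b hb n' hn; exact hnb y hy h
  obtain ⟨l, hl⟩ := hm'.add_odd hn'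
  obtain ⟨y, hy, h⟩ := heven (a * b) (F.mul_mem ha hb) l (by
    rw [map_mul, hm, hn, ← zpow_add₀ hπ0.ne', hl])
  exact hnab y hy h

theorem TT.unique (hH : TT H) (hv : IsPl p v) (hQ : QQ v (fixedField H))
    (hw : IsPl q w) (hQ' : QQ w (fixedField H)) : ∀ x ∈ fixedField H, v x = w x := by
  by_contra hne
  obtain ⟨a, b, ha, hb, ha0, hb0, hna, -, -⟩ := hH.exists_ab
  set F := fixedField H
  obtain ⟨y, hy, h⟩ := weak_approx F (ι := Bool) (fun i => if i then v else w)
    (by rintro (_ | _); exacts [⟨q, hw⟩, ⟨p, hv⟩]) (fun i => if i then 1 else a⁻¹)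
    (by rintro (_ | _); exacts [F.inv_mem ha, F.one_mem])
    (by
      rintro (_ | _) (_ | _) h
      · rfl
      · exact absurd (fun x hx => (h x hx).symm) hne
      · exact absurd h hne
      · rfl) (ε := min 1 (w a⁻¹)) (lt_min one_pos (w.pos (inv_ne_zero ha0)))
  have h1 := h true
  have h2 := h false
  simp only [if_true] at h1
  simp only [Bool.false_eq_true, if_false] at h2
  obtain ⟨s, hs, hs2⟩ := hQ y hy (h1.trans_le (min_le_left _ _))
  obtain ⟨t, ht, ht2⟩ := hQ' (a * y) (F.mul_mem ha hy) (by
    have : a * y - 1 = a * (y - a⁻¹) := by field_simp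
    rw [this, map_mul]
    have h3 := h2.trans_le (min_le_right _ _)
    calc w a * w (y - a⁻¹) < w a * w a⁻¹ := by
          exact mul_lt_mul_of_pos_left h3 (w.pos ha0)
      _ = 1 := by rw [← map_mul, mul_inv_cancel₀ ha0, map_one])
  have hy0 : y ≠ 0 := by
    rintro rfl
    simp at h1
  have hs0 : s ≠ 0 := by rintro rfl; apply hy0; rw [← hs2]; simp
  refine hna (t / s) (F.div_mem ht hs) ?_
  rw [div_pow, ht2, hs2]; field_simp

/-- Claim U: invariance implies `QQ`. -/
theorem QQ_of_inv (hv : IsPl p v) (hp : p ≠ 2) (hinv : ∀ h ∈ H, ∀ z, z ^ 2 ∈ fixedField H → v (h z - 1) < 1 ∨ 1 ≤ v (z - 1)) :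
    QQ v (fixedField H) := by
  intro x hx hx1
  have hv2 : v (2 : Ω) = 1 := by
    have := hv.natCast_eq_one (n := 2) (fun h => hp ((Nat.prime_dvd_prime_iff_eq hv.prime Nat.prime_two).1 h))
    simpa using this
  obtain ⟨z, hz, hz1⟩ : ∃ z, z ^ 2 = x ∧ v (z - 1) < 1 := by
    obtain ⟨z, hz⟩ := IsAlgClosed.exists_pow_nat_eq x (n := 2) two_pos
    by_cases h1 : v (z - 1) < 1
    · exact ⟨z, hz, h1⟩
    · refine ⟨-z, by rw [neg_sq, hz], ?_⟩
      by_contra h2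
      push Not at h1 h2
      have h3 : v (x - 1) = v (z - 1) * v (-z - 1) := by
        rw [← map_mul, ← map_neg_eq_map v, ← hz]; congr 1; ring
      have h4 := mul_le_mul h1 h2 zero_le_one (zero_le_one.trans h1)
      rw [← h3] at h4
      linarith
  refine ⟨z, mem_fixedField'.2 fun h hh => ?_, hz⟩
  have hsq : (h z) ^ 2 = z ^ 2 := by rw [← map_pow, hz, mem_fixedField'.1 hx h hh]
  rcases sq_eq_sq_iff_eq_or_eq_neg.1 hsq with h1 | h1
  · exact h1
  · exfalso
    have h2 := (hinv h hh z (by rw [hz]; exact hx)).resolve_right (not_le.2 hz1)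
    have h3 := hv.add_lt h2 hz1
    rw [h1] at h3
    have : -z - 1 + (z - 1) = -2 := by ring
    rw [this, map_neg_eq_map, hv2] at h3
    exact lt_irrefl _ h3

theorem QQ_of_le_Dec (hv : IsPl p v) (hp : p ≠ 2) (h : H ≤ Dec v) : QQ v (fixedField H) := by
  refine QQ_of_inv hv hp fun g hg z hz => ?_
  by_cases h1 : v (z - 1) < 1
  · left
    have := mem_Dec'.1 (h hg) (z - 1)
    rw [map_sub, map_one] at this
    rwa [this]
  · right; exact not_lt.1 h1

/-- open normal subgroup fixing a given finite set -/
theorem exists_open_normal (s : Finset Ω) : ∃ V : Subgroup (Ω ≃ₐ[ℚ] Ω), V.Normal ∧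
    IsOpen (V : Set (Ω ≃ₐ[ℚ] Ω)) ∧ ∀ g ∈ V, ∀ x ∈ s, g x = x := by
  obtain ⟨E, hE, hn, hs⟩ := exists_normal_fin s
  refine ⟨E.fixingSubgroup, (InfiniteGalois.normal_iff_isGalois E).2 { to_isSeparable := inferInstance, to_normal := hn }, E.fixingSubgroup_isOpen, fun g hg x hx => ?_⟩
  exact (mem_fixingSubgroup_iff _ _).1 hg x (hs x hx)

theorem TT.inv_normal (hH : TT H) {V : Subgroup (Ω ≃ₐ[ℚ] Ω)} (hV : IsOpen (V : Set (Ω ≃ₐ[ℚ] Ω)))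
    (hn : V.Normal) (hv : IsPl p v) (hQ : QQ v (fixedField (H ⊓ V))) (g : Ω ≃ₐ[ℚ] Ω) (hg : g ∈ H) :
    QQ (pull v g) (fixedField (H ⊓ V)) ∧ ∀ x ∈ fixedField (H ⊓ V), v (g x) = v x := by
  have hst : ∀ g ∈ H, ∀ x ∈ fixedField (H ⊓ V), g x ∈ fixedField (H ⊓ V) := by
    intro g hg x hx
    rw [mem_fixedField'] at hx ⊢
    intro h hh
    have := hx (g⁻¹ * h * g) ⟨H.mul_mem (H.mul_mem (H.inv_mem hg) hh.1) hg, by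
      have := hn.conj_mem h hh.2 g⁻¹
      simpa using this⟩
    have h3 := congrArg g this
    rw [AlgEquiv.mul_apply, AlgEquiv.mul_apply] at h3
    exact (g.apply_symm_apply _).symm.trans h3
  have hQ' : QQ (pull v g) (fixedField (H ⊓ V)) := by
    intro x hx hx1
    rw [pull_apply, map_sub, map_one] at hx1
    obtain ⟨y, hy, h⟩ := hQ (g x) (hst g hg x hx) hx1
    refine ⟨g⁻¹ y, hst _ (H.inv_mem hg) y hy, ?_⟩
    rw [← map_pow, h]
    exact g.symm_apply_apply x
  exact ⟨hQ', (hH.inf hV).unique (hv.pull g) hQ' hv hQ⟩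

/-- Theorem A -/
theorem TT.thmA (hH : TT H) : ∃ p v, p ≠ 2 ∧ IsPl p v ∧ H ≤ Dec v ∧
    ∀ q w, q ≠ 2 → IsPl q w → H ≤ Dec w → w = v := by
  classical
  -- representatives of square classes
  have hfi : (powSub 2 (fixedField H)).FiniteIndex := ⟨by rw [hH.index]; norm_num⟩
  haveI : Finite ((fixedField H)ˣ ⧸ powSub 2 (fixedField H)) := inferInstance
  haveI := Fintype.ofFinite ((fixedField H)ˣ ⧸ powSub 2 (fixedField H))
  have hroot : ∀ x : Ω, ∃ z, z ^ 2 = x := fun x => IsAlgClosed.exists_pow_nat_eq x two_pos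
  choose rt hrt using hroot
  let s : Finset Ω := Finset.univ.image fun c : (fixedField H)ˣ ⧸ powSub 2 (fixedField H) =>
    rt ((c.out : fixedField H) : Ω)
  obtain ⟨V2, hV2n, hV2, hV2s⟩ := exists_open_normal s
  have hsq : ∀ z, z ^ 2 ∈ fixedField H → z ∈ fixedField (H ⊓ V2) := by
    intro z hz
    by_cases hz0 : z = 0
    · rw [hz0]; exact zero_mem _
    let u : (fixedField H)ˣ := Units.mk0 ⟨z ^ 2, hz⟩ (fun h => hz0 (by
      have : z ^ 2 = 0 := congrArg Subtype.val h
      simpa using this))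
    let c : (fixedField H)ˣ ⧸ powSub 2 (fixedField H) := u
    have h1 : (c.out)⁻¹ * u ∈ powSub 2 (fixedField H) := QuotientGroup.eq.1 (QuotientGroup.out_eq' c)
    obtain ⟨y, hy⟩ := mem_powSub.1 h1
    have h2 : u = c.out * y ^ 2 := by rw [hy]; group
    have h3 : z ^ 2 = ((c.out : fixedField H) : Ω) * ((y : fixedField H) : Ω) ^ 2 := by
      exact congrArg (fun t : (fixedField H)ˣ => ((t : fixedField H) : Ω)) h2
    have h4 : z ^ 2 = (rt ((c.out : fixedField H) : Ω) * ((y : fixedField H) : Ω)) ^ 2 := by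
      rw [mul_pow, hrt, h3]
    have h5 : rt ((c.out : fixedField H) : Ω) ∈ fixedField (H ⊓ V2) := by
      rw [mem_fixedField']
      intro h hh
      exact hV2s h hh.2 _ (Finset.mem_image.2 ⟨c, Finset.mem_univ _, rfl⟩)
    have h6 : ((y : fixedField H) : Ω) ∈ fixedField (H ⊓ V2) :=
      fixedField_mono inf_le_left (y : fixedField H).2
    rcases sq_eq_sq_iff_eq_or_eq_neg.1 h4 with h | h
    · rw [h]; exact mul_mem h5 h6
    · rw [h]; exact neg_mem (mul_mem h5 h6)
  -- key: any place for small normal V works on F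
  have key : ∀ V : Subgroup (Ω ≃ₐ[ℚ] Ω), IsOpen (V : Set (Ω ≃ₐ[ℚ] Ω)) → V.Normal → V ≤ V2 →
      ∀ p v, IsPl p v → QQ v (fixedField (H ⊓ V)) → p ≠ 2 ∧ QQ v (fixedField H) := by
    intro V hV hn hle p v hv hQ
    have hp := (hH.inf hV).ne_two hv hQ
    refine ⟨hp, QQ_of_inv hv hp fun g hg z hz => ?_⟩
    have hzE : z ∈ fixedField (H ⊓ V) := fixedField_mono (inf_le_inf_left H hle) (hsq z hz)
    have := (hH.inv_normal hV hn hv hQ g hg).2 (z - 1) (sub_mem hzE (one_mem _))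
    rw [map_sub, map_one] at this
    rw [this]
    exact lt_or_ge _ _
  obtain ⟨p, u, hu, hQ2⟩ := (hH.inf hV2).exists_place
  obtain ⟨hp, hQ⟩ := key V2 hV2 hV2n le_rfl p u hu hQ2
  have hall : ∀ V : Subgroup (Ω ≃ₐ[ℚ] Ω), IsOpen (V : Set (Ω ≃ₐ[ℚ] Ω)) → V.Normal → V ≤ V2 →
      QQ u (fixedField (H ⊓ V)) := by
    intro V hV hn hle
    obtain ⟨q, w, hw, hQw⟩ := (hH.inf hV).exists_place
    obtain ⟨hq, hQw'⟩ := key V hV hn hle q w hw hQw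
    obtain ⟨h, hh, rfl⟩ := trans_H hH.closed hw hu (hH.unique hw hQw' hu hQ)
    exact (hH.inv_normal hV hn hw hQw h hh).1
  have hsmall : ∀ x : Ω, ∃ V : Subgroup (Ω ≃ₐ[ℚ] Ω), IsOpen (V : Set (Ω ≃ₐ[ℚ] Ω)) ∧ V.Normal ∧ V ≤ V2 ∧
      x ∈ fixedField (H ⊓ V) := by
    intro x
    obtain ⟨V, hn, hV, hVx⟩ := exists_open_normal {x}
    refine ⟨V ⊓ V2, ?_, inferInstance, inf_le_right, ?_⟩
    · rw [Subgroup.coe_inf]; exact hV.inter hV2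
    · rw [mem_fixedField']
      intro h hh
      exact hVx h hh.2.1 x (by simp)
  refine ⟨p, u, hp, hu, ?_, ?_⟩
  · intro g hg
    rw [mem_Dec']
    intro x
    obtain ⟨V, hV, hn, hle, hx⟩ := hsmall x
    exact (hH.inv_normal hV hn hu (hall V hV hn hle) g hg).2 x hx
  · intro q w hq hw hHw
    ext x
    obtain ⟨V, hV, hn, hle, hx⟩ := hsmall x
    exact (hH.inf hV).unique hw (QQ_of_le_Dec hw hq (inf_le_left.trans hHw)) hu (hall V hV hn hle) x hx

end ThmA

end NU

namespace NU

open IntermediateField NumberField IsDedekindDomain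

section Density

variable {Ω : Type*} [Field Ω] [CharZero Ω] [Algebra.IsAlgebraic ℚ Ω] [IsAlgClosed Ω]
variable {p q : ℕ} {v w : AbsoluteValue Ω ℝ}

/-- decomposition field -/
abbrev DF (v : AbsoluteValue Ω ℝ) (E : IntermediateField ℚ Ω) : IntermediateField ℚ Ω :=
  fixedField (Dec v ⊓ E.fixingSubgroup)

theorem mem_fixing {E : IntermediateField ℚ Ω} {g : Ω ≃ₐ[ℚ] Ω} :
    g ∈ E.fixingSubgroup ↔ ∀ x ∈ E, g x = x := mem_fixingSubgroup_iff _

theorem le_DF (v : AbsoluteValue Ω ℝ) (E : IntermediateField ℚ Ω) : E ≤ DF v E := fun x hx =>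
  mem_fixedField'.2 fun _ hg => mem_fixing.1 hg.2 x hx

theorem density (hv : IsPl p v) (E : IntermediateField ℚ Ω) [FiniteDimensional ℚ E] {f : Ω}
    (hf : f ∈ DF v E) {ε : ℝ} (hε : 0 < ε) : ∃ y ∈ E, v (f - y) < ε := by
  classical
  obtain ⟨M, hM, hMn, hEM, hfM⟩ : ∃ M : IntermediateField ℚ Ω, FiniteDimensional ℚ M ∧
      Normal ℚ M ∧ E ≤ M ∧ f ∈ M := by
    haveI : FiniteDimensional ℚ (adjoin ℚ {f}) :=
      adjoin.finiteDimensional (Algebra.IsIntegral.isIntegral f)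
    let E1 := E ⊔ adjoin ℚ {f}
    haveI : FiniteDimensional ℚ E1 := inferInstance
    refine ⟨normalClosure ℚ E1 Ω, inferInstance, normalClosure.normal _ _ _, ?_, ?_⟩
    · exact le_sup_left.trans E1.le_normalClosure
    · exact E1.le_normalClosure (le_sup_right (a := E) (mem_adjoin_simple_self ℚ f))
  let A : Subgroup (M ≃ₐ[ℚ] M) := E.fixingSubgroup.map (AlgEquiv.restrictNormalHom M)
  have hA : ∀ a : A, ∃ h ∈ E.fixingSubgroup, AlgEquiv.restrictNormalHom M h = a := fun a => a.2
  choose l hl hla using hA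
  have hlx : ∀ (a : A) (x : M), l a (x : Ω) = ((a : M ≃ₐ[ℚ] M) x : M) := by
    intro a x
    rw [← hla a, restrictNormalHom_coe]
  let D : A → Prop := fun a => ∀ x ∈ M, v (l a x) = v x
  have hD1 : D 1 := by
    intro x hx
    have := hlx 1 ⟨x, hx⟩
    simp only at this
    rw [this]; rfl
  have hDf : ∀ a, D a → l a f = f := by
    intro a ha
    obtain ⟨h, hh, hhv⟩ := trans_H (H := M.fixingSubgroup) (M.fixingSubgroup_isClosed)
      (hv.pull (l a)) hv (by
        rw [InfiniteGalois.fixedField_fixingSubgroup]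
        exact ha)
    rw [← pull_mul] at hhv
    have h1 := mem_fixedField'.1 hf (l a * h) ⟨hhv, mul_mem (hl a)
      (mem_fixing.2 fun x hx => mem_fixing.1 hh x (hEM hx))⟩
    rw [AlgEquiv.mul_apply, mem_fixing.1 hh f hfM] at h1
    exact h1
  let n : ℕ := (Finset.univ.filter D).card
  have hn : n ≠ 0 := Finset.card_ne_zero.2 ⟨1, by simpa using hD1⟩
  have hvn : 0 < v (n : Ω) := v.pos (by exact_mod_cast hn)
  let B : ℝ := 1 + ∑ a : A, v (l a f)
  have hB0 : ∀ a, v (l a f) < B := fun a => by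
    have := Finset.single_le_sum (f := fun a : A => v (l a f)) (fun i _ => v.nonneg _) (Finset.mem_univ a)
    linarith
  have hB : 0 < B := (v.nonneg _).trans_lt (hB0 1)
  obtain ⟨c, hcM, hc⟩ := weak_approx M (ι := A) (fun a => pull v (l a)) (fun a => ⟨p, hv.pull _⟩)
    (fun a => if D a then 1 else 0) (fun a => by split_ifs; exacts [M.one_mem, M.zero_mem])
    (by
      intro a b hab
      have : D a ↔ D b := by
        constructor
        · intro h x hx; rw [← h x hx]; exact (hab x hx).symm
        · intro h x hx; rw [← h x hx]; exact hab x hx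
      simp only [this]) (ε := ε * v (n : Ω) / B) (by positivity)
  set δ := ε * v (n : Ω) / B with hδ
  let y0 : Ω := ∑ a : A, l a (f * c)
  have hy0 : y0 ∈ E := by
    rw [← InfiniteGalois.fixedField_fixingSubgroup E, mem_fixedField']
    intro h hh
    let b : A := ⟨AlgEquiv.restrictNormalHom M h, ⟨h, hh, rfl⟩⟩
    have : ∀ a : A, h (l a (f * c)) = l (b * a) (f * c) := by
      intro a
      have e1 := hlx a ⟨f * c, M.mul_mem hfM hcM⟩
      have e2 := hlx (b * a) ⟨f * c, M.mul_mem hfM hcM⟩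
      simp only at e1 e2
      rw [e1, e2, ← restrictNormalHom_coe]
      rfl
    simp only [y0, map_sum, this]
    exact Fintype.sum_equiv (Equiv.mulLeft b) _ _ fun a => rfl
  have hest : v (y0 - n * f) < ε * v (n : Ω) := by
    have e : y0 - n * f = ∑ a : A, (l a f * (l a (c - if D a then 1 else 0))) := by
      have : (n : Ω) * f = ∑ a : A, (l a f * (l a (if D a then 1 else 0))) := by
        have h1 : ∀ a : A, l a f * (l a (if D a then 1 else 0)) = if D a then f else 0 := by
          intro a
          split_ifs with h
          · rw [map_one, mul_one, hDf a h]
          · simp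
        simp only [h1]
        rw [← Finset.sum_filter, Finset.sum_const, nsmul_eq_mul]
      rw [this, ← Finset.sum_sub_distrib]
      refine Finset.sum_congr rfl fun a _ => ?_
      rw [map_mul, map_sub, mul_sub]
    rw [e]
    refine hv.sum_lt _ _ (by positivity) fun a _ => ?_
    rw [map_mul]
    have h1 : v (l a (c - if D a then 1 else 0)) < δ := hc a
    calc v (l a f) * v (l a (c - if D a then 1 else 0)) ≤ B * v (l a (c - if D a then 1 else 0)) := by
          gcongr; exact (hB0 a).le
      _ < B * δ := by gcongr
      _ = ε * v (n : Ω) := by rw [hδ]; field_simp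
  refine ⟨y0 / n, E.div_mem hy0 (_root_.natCast_mem E n), ?_⟩
  have hn' : (n : Ω) ≠ 0 := by exact_mod_cast hn
  have : f - y0 / n = -((y0 - n * f) / n) := by field_simp; ring
  rw [this, map_neg_eq_map, map_div₀, div_lt_iff₀ hvn]
  exact hest

variable (E : IntermediateField ℚ Ω) [FiniteDimensional ℚ E]

theorem DF_approx (hv : IsPl p v) {x : Ω} (hx : x ∈ DF v E) (hx0 : x ≠ 0) :
    ∃ y ∈ E, v (y - x) < v x ∧ v y = v x := by
  obtain ⟨y, hy, h⟩ := density hv E hx (v.pos hx0)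
  have h' : v (y - x) < v x := by rw [← neg_sub, map_neg_eq_map]; exact h
  exact ⟨y, hy, h', hv.eq_of_sub_lt h'⟩

theorem DF_val (hv : IsPl p v) {π : Ω} (hd : ∀ x ∈ E, x ≠ 0 → ∃ n : ℤ, v x = v π ^ n)
    {x : Ω} (hx : x ∈ DF v E) (hx0 : x ≠ 0) : ∃ n : ℤ, v x = v π ^ n := by
  obtain ⟨y, hy, -, h⟩ := DF_approx E hv hx hx0
  rw [← h]
  refine hd y hy ?_
  rintro rfl
  rw [map_zero] at h
  exact hx0 ((v.eq_zero).1 h.symm)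

theorem IsPl.pow_sub_one_lt (hv : IsPl p v) {x : Ω} (h : v (x - 1) < 1) (n : ℕ) :
    v (x ^ n - 1) < 1 := by
  induction n with
  | zero => simp
  | succ n ih =>
    have : x ^ (n + 1) - 1 = x ^ n * (x - 1) + (x ^ n - 1) := by ring
    rw [this]
    refine hv.add_lt ?_ ih
    rw [map_mul, map_pow, hv.eq_one_of_sub_lt h, one_pow, one_mul]; exact h

theorem IsPl.root_unity (hv : IsPl p v) {l : ℕ} (hl : l.Prime) (hpl : l ≠ p) {ζ : Ω}
    (hζ : ζ ^ l = 1) (h : v (ζ - 1) < 1) : ζ = 1 := by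
  by_contra hne
  have h0 : ∑ j ∈ Finset.range l, ζ ^ j = 0 := by
    have := mul_geom_sum ζ l
    rw [hζ, sub_self, mul_eq_zero] at this
    exact this.resolve_left (sub_ne_zero.2 hne)
  have h1 : (l : Ω) = - ∑ j ∈ Finset.range l, (ζ ^ j - 1) := by
    rw [Finset.sum_sub_distrib, h0]; simp
  have h2 : v (l : Ω) < 1 := by
    rw [h1, map_neg_eq_map]
    exact hv.sum_lt _ _ one_pos fun j _ => hv.pow_sub_one_lt h j
  exact hpl (hv.p_unique hl h2)

theorem IsPl.vroot_unity {ζ : Ω} {l : ℕ} (hl : l ≠ 0) (hζ : ζ ^ l = 1) : v ζ = 1 := by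
  have : v ζ ^ l = 1 := by rw [← map_pow, hζ, map_one]
  exact (pow_eq_one_iff_of_nonneg (v.nonneg _) hl).1 this

theorem IsPl.exists_root (hv : IsPl p v) {l : ℕ} (hl : l.Prime) {x : Ω} (hx : v (x - 1) < 1) :
    ∃ z, z ^ l = x ∧ v (z - 1) < 1 := by
  obtain ⟨z, hz⟩ := IsAlgClosed.exists_pow_nat_eq x (n := l) hl.pos
  haveI : NeZero (l : Ω) := ⟨by exact_mod_cast hl.ne_zero⟩
  obtain ⟨η, hη⟩ := HasEnoughRootsOfUnity.exists_primitiveRoot Ω l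
  have h1 := congrArg (Polynomial.eval z) (Polynomial.X_pow_sub_one_eq_prod hl.pos hη)
  rw [Polynomial.eval_prod] at h1
  simp only [Polynomial.eval_sub, Polynomial.eval_pow, Polynomial.eval_X, Polynomial.eval_one,
    Polynomial.eval_C] at h1
  rw [hz] at h1
  rw [h1, map_prod] at hx
  obtain ⟨ζ, hζ, hlt⟩ : ∃ ζ ∈ Polynomial.nthRootsFinset l (1 : Ω), v (z - ζ) < 1 := by
    by_contra hcon
    push Not at hcon
    have : (1 : ℝ) ≤ ∏ i ∈ Polynomial.nthRootsFinset l (1 : Ω), v (z - i) := by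
      rw [← Finset.prod_const_one (s := Polynomial.nthRootsFinset l (1 : Ω))]
      exact Finset.prod_le_prod (fun _ _ => zero_le_one) hcon
    linarith
  have hζ1 : ζ ^ l = 1 := (Polynomial.mem_nthRootsFinset hl.pos _).1 hζ
  have hζ0 : ζ ≠ 0 := by rintro rfl; rw [zero_pow hl.ne_zero] at hζ1; exact zero_ne_one hζ1
  refine ⟨z / ζ, by rw [div_pow, hz, hζ1, div_one], ?_⟩
  have : z / ζ - 1 = (z - ζ) / ζ := by field_simp
  rw [this, map_div₀, IsPl.vroot_unity hl.ne_zero hζ1, div_one]; exact hlt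

theorem DF_root (hv : IsPl p v) {l : ℕ} (hl : l.Prime) (hpl : l ≠ p) {x : Ω} (hx : x ∈ DF v E)
    (h : v (x - 1) < 1) : ∃ z ∈ DF v E, z ^ l = x := by
  obtain ⟨z, hz, hz1⟩ := hv.exists_root hl h
  refine ⟨z, mem_fixedField'.2 fun g hg => ?_, hz⟩
  have hvz : v z = 1 := hv.eq_one_of_sub_lt hz1
  have hz0 : z ≠ 0 := by rintro rfl; simp at hvz
  have h1 : v (g z - 1) < 1 := by
    have := mem_Dec'.1 hg.1 (z - 1)
    rw [map_sub, map_one] at this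
    rw [this]; exact hz1
  have h2 : (g z / z) ^ l = 1 := by
    rw [div_pow, ← map_pow, hz, mem_fixedField'.1 hx g hg]
    refine div_self ?_
    rw [← hz]; exact pow_ne_zero _ hz0
  have h3 := hv.root_unity hl hpl h2 (by
    have : g z / z - 1 = ((g z - 1) - (z - 1)) / z := by field_simp; ring
    rw [this, map_div₀, hvz, div_one]
    exact hv.sub_lt h1 hz1)
  rwa [div_eq_one_iff_eq hz0] at h3

/-- a generator of the residue field -/
theorem IsPl.exists_gen (hv : IsPl p v) : ∃ g ∈ E, v g = 1 ∧
    (∀ u ∈ E, v u = 1 → ∃ m : ℕ, v (u - g ^ m) < 1) ∧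
    (p ≠ 2 → ∀ m : ℕ, v (g ^ m - 1) < 1 → 2 ∣ m) := by
  classical
  let y := hv.pid E
  haveI : Fact p.Prime := ⟨hv.prime⟩
  haveI hyp : y.IsPrime := (hv.hos E).isPrime
  have hy0 : y ≠ ⊥ := (hv.hos E).ne_bot
  haveI : y.IsMaximal := hyp.isMaximal hy0
  letI : Field (𝓞 E ⧸ y) := Ideal.Quotient.field y
  haveI : Finite (𝓞 E ⧸ y) := Ideal.finiteQuotientOfFreeOfNeBot y hy0
  haveI := Fintype.ofFinite (𝓞 E ⧸ y)
  haveI : CharP (𝓞 E ⧸ y) p := by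
    refine (CharP.charP_iff_prime_eq_zero hv.prime).2 ?_
    have := Ideal.Quotient.eq_zero_iff_mem.2 (hv.p_mem_pid E)
    simpa using this
  obtain ⟨γ, hγ⟩ := IsCyclic.exists_monoid_generator (α := (𝓞 E ⧸ y)ˣ)
  obtain ⟨g, hg⟩ := Ideal.Quotient.mk_surjective (γ : 𝓞 E ⧸ y)
  have hun : ∀ s : 𝓞 E, v ((s : E) : Ω) = 1 → Ideal.Quotient.mk y s ≠ 0 := by
    intro s hs h
    rw [Ideal.Quotient.eq_zero_iff_mem] at h
    exact (hv.not_mem_pid E).2 hs h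
  refine ⟨((g : E) : Ω), (g : E).2, ?_, ?_, ?_⟩
  · refine (hv.not_mem_pid E).1 fun h => ?_
    rw [← Ideal.Quotient.eq_zero_iff_mem, hg] at h
    exact γ.ne_zero h
  · intro u hu hvu
    obtain ⟨s, t, ht, hst⟩ := hv.exists_denom E (x := ⟨u, hu⟩) hvu.le
    have e1 : u * ((t : E) : Ω) = ((s : E) : Ω) := congrArg (fun z : E => (z : Ω)) hst
    have hs : v ((s : E) : Ω) = 1 := by rw [← e1, map_mul, hvu, ht, mul_one]
    let su : (𝓞 E ⧸ y)ˣ := Units.mk0 _ (hun s hs)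
    let tu : (𝓞 E ⧸ y)ˣ := Units.mk0 _ (hun t ht)
    obtain ⟨m, hm⟩ := (Submonoid.mem_powers_iff _ _).1 (hγ (su * tu⁻¹))
    refine ⟨m, ?_⟩
    have h1 : s - g ^ m * t ∈ y := by
      rw [← Ideal.Quotient.eq_zero_iff_mem, map_sub, map_mul, map_pow, hg]
      have h2 : su = γ ^ m * tu := by rw [hm]; group
      have h3 : (Ideal.Quotient.mk y s) = (γ : 𝓞 E ⧸ y) ^ m * Ideal.Quotient.mk y t := by
        have := congrArg Units.val h2
        simpa [su, tu] using this
      rw [h3, sub_self]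
    have h4 : v (((s : E) : Ω) - ((g : E) : Ω) ^ m * ((t : E) : Ω)) < 1 := h1
    rw [← e1, ← sub_mul, map_mul, ht, mul_one] at h4
    exact h4
  · intro hp2 m hm
    have h1 : g ^ m - 1 ∈ y := hm
    rw [← Ideal.Quotient.eq_zero_iff_mem, map_sub, map_pow, hg, map_one, sub_eq_zero] at h1
    have h2 : γ ^ m = 1 := Units.ext (by simpa using h1)
    have h3 : orderOf γ = Fintype.card (𝓞 E ⧸ y) - 1 := by
      rw [← Fintype.card_units, ← Nat.card_eq_fintype_card]
      exact orderOf_eq_card_of_forall_mem_powers hγ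
    have h4 := orderOf_dvd_of_pow_eq_one h2
    obtain ⟨k, hk, hcard⟩ := FiniteField.card (𝓞 E ⧸ y) p
    rw [h3, hcard] at h4
    refine dvd_trans ?_ h4
    have hodd : Odd (p ^ (k : ℕ)) := (hv.prime.odd_of_ne_two hp2).pow
    obtain ⟨a, ha⟩ := hodd
    exact ⟨a, by omega⟩

end Density

end NU

namespace NU

open IntermediateField NumberField IsDedekindDomain

section ThmB

variable {Ω : Type*} [Field Ω] [CharZero Ω] [Algebra.IsAlgebraic ℚ Ω] [IsAlgClosed Ω]
variable {p q : ℕ} {v w : AbsoluteValue Ω ℝ}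

theorem index_le' {F : IntermediateField ℚ Ω} {l : ℕ} (hl : l ≠ 0) {I : Type} [Fintype I] (f : I → Ω)
    (hf : ∀ i, f i ∈ F) (hf0 : ∀ i, f i ≠ 0)
    (h : ∀ x ∈ F, x ≠ 0 → ∃ i, ∃ z ∈ F, x = f i * z ^ l) :
    (powSub l F).index ≠ 0 ∧ (powSub l F).index ≤ Fintype.card I := by
  let u : I → (F)ˣ := fun i => Units.mk0 (⟨f i, hf i⟩ : F) (by
    intro h0; exact hf0 i (congrArg Subtype.val h0))
  have hs : Function.Surjective (fun i : I => (u i : (F)ˣ ⧸ powSub l F)) := by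
    intro x
    obtain ⟨x, rfl⟩ := QuotientGroup.mk_surjective x
    obtain ⟨i, z, hz, hx⟩ := h ((x : F) : Ω) (x : F).2 (by
      intro h0; exact x.ne_zero (Subtype.ext h0))
    refine ⟨i, (QuotientGroup.eq).2 ((mem_powSub' hl).2 ⟨⟨z, hz⟩, ?_⟩)⟩
    apply Subtype.ext
    simp only [Units.val_mul, Units.val_inv_eq_inv_val, u, Units.val_mk0]
    simp only [SubmonoidClass.coe_pow, MulMemClass.coe_mul]
    have : ((((⟨f i, hf i⟩ : F)⁻¹ : F)) : Ω) = (f i)⁻¹ := rfl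
    rw [this, hx, inv_mul_cancel_left₀ (hf0 i)]
  haveI : Finite ((F)ˣ ⧸ powSub l F) := Finite.of_surjective _ hs
  refine ⟨?_, ?_⟩
  · rw [Subgroup.index]; exact Nat.card_pos.ne'
  · rw [Subgroup.index, ← Nat.card_eq_fintype_card]
    exact Nat.card_le_card_of_surjective _ hs

theorem index_ge' {F : IntermediateField ℚ Ω} {l : ℕ} (hl : l ≠ 0) {I : Type} [Fintype I] (f : I → Ω)
    (hf : ∀ i, f i ∈ F) (hf0 : ∀ i, f i ≠ 0)
    (h : ∀ i j, ∀ z ∈ F, f i = f j * z ^ l → i = j) :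
    (powSub l F).index = 0 ∨ Fintype.card I ≤ (powSub l F).index := by
  let u : I → (F)ˣ := fun i => Units.mk0 (⟨f i, hf i⟩ : F) (by
    intro h0; exact hf0 i (congrArg Subtype.val h0))
  have hs : Function.Injective (fun i : I => (u i : (F)ˣ ⧸ powSub l F)) := by
    intro i j hij
    obtain ⟨z, hz⟩ := (mem_powSub' hl).1 ((QuotientGroup.eq).1 hij.symm)
    refine h i j z z.2 ?_
    have hz := congrArg Subtype.val hz
    simp only [Units.val_mul, Units.val_inv_eq_inv_val, u, Units.val_mk0] at hz
    simp only [SubmonoidClass.coe_pow, MulMemClass.coe_mul] at hz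
    have h1 : ((((⟨f j, hf j⟩ : F)⁻¹ : F)) : Ω) = (f j)⁻¹ := rfl
    rw [hz, h1, mul_inv_cancel_left₀ (hf0 j)]
  rcases finite_or_infinite ((F)ˣ ⧸ powSub l F) with hfin | hinf
  · right
    rw [Subgroup.index, ← Nat.card_eq_fintype_card]
    exact Nat.card_le_card_of_injective _ hs
  · left; rw [Subgroup.index]; exact Nat.card_eq_zero_of_infinite

variable (E : IntermediateField ℚ Ω) [FiniteDimensional ℚ E]

theorem zpow_inj' {r : ℝ} (h0 : 0 < r) (h1 : r < 1) {a b : ℤ} (h : r ^ a = r ^ b) : a = b :=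
  zpow_right_injective₀ h0 h1.ne h

theorem DF_decomp (hv : IsPl p v) {l : ℕ} (hl : l.Prime) (hlp : l ≠ p) {π g : Ω} (hπ : π ∈ E)
    (hπ0 : 0 < v π) (hd : ∀ x ∈ E, x ≠ 0 → ∃ n : ℤ, v x = v π ^ n) (hg : g ∈ E) (hg1 : v g = 1)
    (hgen : ∀ u ∈ E, v u = 1 → ∃ m : ℕ, v (u - g ^ m) < 1) {x : Ω} (hx : x ∈ DF v E) (hx0 : x ≠ 0) :
    ∃ i : Fin l × Fin l, ∃ z ∈ DF v E, x = (π ^ (i.1 : ℕ) * g ^ (i.2 : ℕ)) * z ^ l := by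
  have hπne : π ≠ 0 := by rintro rfl; simp at hπ0
  have hgne : g ≠ 0 := by rintro rfl; simp at hg1
  obtain ⟨y, hy, hyx, hvy⟩ := DF_approx E hv hx hx0
  obtain ⟨n, hn⟩ := DF_val E hv hd hx hx0
  have hpn : v π ^ n ≠ 0 := (zpow_pos hπ0 n).ne'
  obtain ⟨m, hm⟩ := hgen (y / π ^ n) (div_mem hy (zpow_mem hπ n)) (by
    rw [map_div₀, map_zpow₀, hvy, hn, div_self hpn])
  have hpn' : π ^ n ≠ 0 := zpow_ne_zero _ hπne
  have hpn2 : g ^ m ≠ 0 := pow_ne_zero _ hgne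
  have hπF : π ∈ DF v E := le_DF v E hπ
  have hgF : g ∈ DF v E := le_DF v E hg
  have h1 : v (x / (π ^ n * g ^ m) - 1) < 1 := by
    have : x / (π ^ n * g ^ m) - 1 = ((y / π ^ n - g ^ m) - (y - x) / π ^ n) / g ^ m := by
      field_simp; ring
    rw [this, map_div₀, map_pow, hg1, one_pow, div_one]
    refine hv.sub_lt hm ?_
    rw [map_div₀, map_zpow₀, ← hn, div_lt_one (v.pos hx0)]; exact hyx
  obtain ⟨z, hz, hzx⟩ := DF_root E hv hl hlp
    (div_mem hx (mul_mem (zpow_mem hπF n) (pow_mem hgF m))) h1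
  have hl0 : (l : ℤ) ≠ 0 := by exact_mod_cast hl.ne_zero
  have hnn : 0 ≤ n % l := Int.emod_nonneg _ hl0
  obtain ⟨a, ha⟩ := Int.eq_ofNat_of_zero_le hnn
  have hal : a < l := by
    have := Int.emod_lt_of_pos n (b := l) (by exact_mod_cast hl.pos)
    rw [ha] at this; exact_mod_cast this
  refine ⟨(⟨a, hal⟩, ⟨m % l, Nat.mod_lt _ hl.pos⟩), π ^ (n / l) * g ^ (m / l) * z,
    mul_mem (mul_mem (zpow_mem hπF _) (pow_mem hgF _)) hz, ?_⟩
  have e1 : π ^ n = π ^ a * (π ^ (n / l)) ^ l := by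
    rw [← zpow_natCast, ← zpow_natCast (π ^ (n / (l : ℤ))), ← zpow_mul, ← zpow_add₀ hπne]
    congr 1
    have h2 := Int.emod_add_mul_ediv n l
    rw [ha] at h2
    rw [mul_comm (n / (l : ℤ))]; exact h2.symm
  have e2 : g ^ m = g ^ (m % l) * (g ^ (m / l)) ^ l := by
    rw [← pow_mul, ← pow_add]
    congr 1
    have h2 := Nat.mod_add_div m l
    rw [mul_comm (m / l)]; exact h2.symm
  have e3 : x = π ^ n * g ^ m * z ^ l := by rw [hzx]; field_simp
  simp only
  rw [e3, e1, e2]; ring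

theorem DF_index_le (hv : IsPl p v) {l : ℕ} (hl : l.Prime) (hlp : l ≠ p) :
    (powSub l (DF v E)).index ≠ 0 ∧ (powSub l (DF v E)).index ≤ l ^ 2 := by
  obtain ⟨π, hπ, hπ0, hπ1, hd⟩ := hv.discrete E
  obtain ⟨g, hg, hg1, hgen, -⟩ := hv.exists_gen E
  have hπne : π ≠ 0 := by rintro rfl; simp at hπ0
  have hgne : g ≠ 0 := by rintro rfl; simp at hg1
  have := index_le' (F := DF v E) hl.ne_zero
    (fun i : Fin l × Fin l => π ^ (i.1 : ℕ) * g ^ (i.2 : ℕ))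
    (fun i => mul_mem (pow_mem (le_DF v E hπ) _) (pow_mem (le_DF v E hg) _))
    (fun i => mul_ne_zero (pow_ne_zero _ hπne) (pow_ne_zero _ hgne))
    (fun x hx hx0 => DF_decomp E hv hl hlp hπ hπ0 hd hg hg1 hgen hx hx0)
  rwa [Fintype.card_prod, Fintype.card_fin, ← sq] at this

theorem DF_index_two (hv : IsPl p v) (hp : p ≠ 2) : (powSub 2 (DF v E)).index = 4 := by
  obtain ⟨π, hπ, hπ0, hπ1, hd⟩ := hv.discrete E
  obtain ⟨g, hg, hg1, hgen, hpar⟩ := hv.exists_gen E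
  have hπne : π ≠ 0 := by rintro rfl; simp at hπ0
  have hgne : g ≠ 0 := by rintro rfl; simp at hg1
  have hpar' : ∀ a b : ℕ, a ≤ b → v (g ^ a - g ^ b) < 1 → 2 ∣ b - a := by
    intro a b hab h
    apply hpar hp
    have : g ^ (b - a) - 1 = -((g ^ a - g ^ b) / g ^ a) := by
      rw [show g ^ b = g ^ a * g ^ (b - a) by rw [← pow_add]; congr 1; omega]
      field_simp; ring
    rw [this, map_neg_eq_map, map_div₀, map_pow, hg1, one_pow, div_one]; exact h
  have h1 := index_ge' (F := DF v E) two_ne_zero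
    (fun i : Fin 2 × Fin 2 => π ^ (i.1 : ℕ) * g ^ (i.2 : ℕ))
    (fun i => mul_mem (pow_mem (le_DF v E hπ) _) (pow_mem (le_DF v E hg) _))
    (fun i => mul_ne_zero (pow_ne_zero _ hπne) (pow_ne_zero _ hgne))
    (by
      rintro ⟨a, b⟩ ⟨c, d⟩ z hz h
      simp only at h
      have hz0 : z ≠ 0 := by
        rintro rfl
        rw [zero_pow two_ne_zero, mul_zero] at h
        exact mul_ne_zero (pow_ne_zero _ hπne) (pow_ne_zero _ hgne) h
      obtain ⟨n, hn⟩ := DF_val E hv hd hz hz0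
      have hvv := congrArg v h
      simp only [map_mul, map_pow, hg1, one_pow, mul_one, hn] at hvv
      rw [← zpow_natCast, ← zpow_natCast, ← zpow_natCast, ← zpow_mul, ← zpow_add₀ hπ0.ne'] at hvv
      have hac := zpow_inj' hπ0 hπ1 hvv
      have ha := a.2
      have hc := c.2
      push_cast at hac
      have hac' : (a : ℕ) = c := by omega
      have hn0 : n = 0 := by omega
      rw [hn0, zpow_zero] at hn
      rw [hac', mul_assoc] at h
      have h := mul_left_cancel₀ (pow_ne_zero _ hπne) h
      obtain ⟨y, hy, hyz, hvy⟩ := DF_approx E hv hz hz0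
      rw [hn] at hyz hvy
      obtain ⟨m, hm⟩ := hgen y hy hvy
      have hzm : v (z - g ^ m) < 1 := by
        have : z - g ^ m = (y - g ^ m) - (y - z) := by ring
        rw [this]; exact hv.sub_lt hm hyz
      have hb : v (g ^ (b : ℕ) - g ^ ((d : ℕ) + 2 * m)) < 1 := by
        have : g ^ (b : ℕ) - g ^ ((d : ℕ) + 2 * m) = g ^ (d : ℕ) * ((z + g ^ m) * (z - g ^ m)) := by
          rw [h, pow_add, mul_comm 2 m, pow_mul]; ring
        rw [this, map_mul, map_pow, hg1, one_pow, one_mul, map_mul]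
        have h3 : v (z + g ^ m) ≤ 1 := hv.add_le hn.le (by rw [map_pow, hg1, one_pow])
        exact mul_lt_one_of_nonneg_of_lt_one_right h3 (v.nonneg _) hzm
      have hbd : (b : ℕ) = d := by
        have hb2 := b.2
        have hd2 := d.2
        rcases le_total (b : ℕ) ((d : ℕ) + 2 * m) with h4 | h4
        · have := hpar' _ _ h4 hb
          omega
        · have := hpar' _ _ h4 (by rwa [← neg_sub, map_neg_eq_map])
          omega
      exact Prod.ext (Fin.ext hac') (Fin.ext hbd))
  obtain ⟨h2, h3⟩ := DF_index_le E hv Nat.prime_two hp.symm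
  rw [Fintype.card_prod, Fintype.card_fin] at h1
  omega

theorem finiteDimensional_of_open {V : Subgroup (Ω ≃ₐ[ℚ] Ω)} (hV : IsOpen (V : Set (Ω ≃ₐ[ℚ] Ω))) :
    FiniteDimensional ℚ (fixedField V) := by
  rw [← InfiniteGalois.isOpen_iff_finite]
  rw [fixing_fixed (Subgroup.isClosed_of_isOpen V hV)]
  exact hV

theorem isOpen_fixing : IsOpen (E.fixingSubgroup : Set (Ω ≃ₐ[ℚ] Ω)) := IntermediateField.fixingSubgroup_isOpen E

theorem Dec_inf_open {V : Subgroup (Ω ≃ₐ[ℚ] Ω)} (hV : IsOpen (V : Set (Ω ≃ₐ[ℚ] Ω))) :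
    fixedField (Dec v ⊓ V) = DF v (fixedField V) := by
  rw [DF, fixing_fixed (Subgroup.isClosed_of_isOpen V hV)]

theorem isClosed_Dec_inf {V : Subgroup (Ω ≃ₐ[ℚ] Ω)} (hV : IsOpen (V : Set (Ω ≃ₐ[ℚ] Ω))) :
    IsClosed ((Dec v ⊓ V : Subgroup (Ω ≃ₐ[ℚ] Ω)) : Set (Ω ≃ₐ[ℚ] Ω)) := by
  rw [Subgroup.coe_inf]
  exact (isClosed_Dec v).inter (Subgroup.isClosed_of_isOpen V hV)

theorem TT_Dec (hv : IsPl p v) (hp : p ≠ 2) {U : Subgroup (Ω ≃ₐ[ℚ] Ω)}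
    (hU : IsOpen (U : Set (Ω ≃ₐ[ℚ] Ω))) (hi : ∃ i ∈ fixedField U, i ^ 2 = -1) : TT (Dec v ⊓ U) := by
  refine ⟨isClosed_Dec_inf hU, ?_, ?_⟩
  · obtain ⟨i, hi, h⟩ := hi
    exact ⟨i, fixedField_mono inf_le_right hi, h⟩
  · intro V hV
    have hUV : IsOpen ((U ⊓ V : Subgroup (Ω ≃ₐ[ℚ] Ω)) : Set (Ω ≃ₐ[ℚ] Ω)) := hU.inter hV
    rw [inf_assoc, kummer_card Nat.prime_two (isClosed_Dec_inf hUV) mu_two, Dec_inf_open hUV]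
    haveI := finiteDimensional_of_open hUV
    exact DF_index_two _ hv hp

theorem chCard_ne (hv : IsPl p v) {U : Subgroup (Ω ≃ₐ[ℚ] Ω)}
    (hU : IsOpen (U : Set (Ω ≃ₐ[ℚ] Ω))) {l : ℕ} (hl : l.Prime) (hlp : l ≠ p)
    (hμ : ∀ z : Ω, z ^ l = 1 → z ∈ fixedField U) :
    chCard l Ω ↥(Dec v ⊓ U) ≠ 0 ∧ chCard l Ω ↥(Dec v ⊓ U) ≤ l ^ 2 := by
  rw [kummer_card hl (isClosed_Dec_inf hU) (fun z hz => fixedField_mono inf_le_right (hμ z hz)),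
    Dec_inf_open hU]
  haveI := finiteDimensional_of_open hU
  exact DF_index_le _ hv hl hlp

theorem IsPl.one_add_pow (hv : IsPl p v) {x : Ω} (hx : v x ≤ 1) (k : ℕ) :
    v ((1 + x) ^ k - 1 - k * x) ≤ v x ^ 2 := by
  induction k with
  | zero => simp
  | succ k ih =>
    have : (1 + x) ^ (k + 1) - 1 - ((k + 1 : ℕ) : Ω) * x =
        ((1 + x) ^ k - 1 - k * x) * (1 + x) + k * x ^ 2 := by push_cast; ring
    rw [this]
    refine hv.add_le ?_ ?_
    · rw [map_mul]
      have h1 : v (1 + x) ≤ 1 := hv.add_le (by simp) hx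
      calc _ ≤ v x ^ 2 * 1 := mul_le_mul ih h1 (v.nonneg _) (by positivity)
        _ = _ := mul_one _
    · rw [map_mul, map_pow]
      exact mul_le_of_le_one_left (by positivity) (hv.natCast_le k)

theorem IsPl.pow_p (hv : IsPl p v) {w : Ω} (hw : v w ≤ 1) :
    v ((1 + w) ^ p - 1 - w ^ p) ≤ v (p : Ω) := by
  let R : Subring Ω :=
    { carrier := {x | v x ≤ 1}
      mul_mem' := fun {a b} ha hb => by
        change v (a * b) ≤ 1
        rw [map_mul]; exact mul_le_one₀ ha (v.nonneg _) hb
      one_mem' := by simp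
      add_mem' := fun {a b} ha hb => hv.add_le ha hb
      zero_mem' := by simp
      neg_mem' := fun {a} ha => by
        change v (-a) ≤ 1
        rwa [map_neg_eq_map] }
  obtain ⟨r, hr⟩ := exists_add_pow_prime_eq hv.prime (1 : R) (⟨w, hw⟩ : R)
  have hr' := congrArg Subtype.val hr
  simp only [one_pow] at hr'
  push_cast at hr'
  have : (1 + w) ^ p - 1 - w ^ p = p * (w * r) := by
    rw [hr']; ring
  rw [this, map_mul]
  refine mul_le_of_le_one_right (v.nonneg _) ?_
  rw [map_mul]
  exact mul_le_one₀ hw (v.nonneg _) r.2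

theorem no_root (hv : IsPl p v) (hp : p ≠ 2) {π : Ω} (hπ0 : 0 < v π) (hπ1 : v π < 1)
    (hd : ∀ x ∈ E, x ≠ 0 → ∃ n : ℤ, v x = v π ^ n) (hvp : v (p : Ω) ≤ v π ^ 3)
    {z : Ω} (hz : z ∈ DF v E) (hz1 : v z = 1) {s : ℕ} (hs0 : s ≠ 0) (hs3 : s < 3)
    (h : v (z ^ p - 1) = v π ^ s) : False := by
  have hw : v (z - 1) ≤ 1 := hv.sub_le hz1.le (by simp)
  have h1 := hv.pow_p hw
  rw [add_sub_cancel] at h1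
  have h2 : v π ^ 3 < v π ^ s := pow_lt_pow_right_of_lt_one₀ hπ0 hπ1 hs3
  have h3 : v ((z - 1) ^ p) = v (z ^ p - 1) := by
    apply hv.eq_of_sub_lt
    rw [h, ← neg_sub, map_neg_eq_map]
    exact (h1.trans hvp).trans_lt h2
  have hz0 : z - 1 ≠ 0 := by
    intro h0
    rw [h0, zero_pow hv.prime.ne_zero, map_zero, h] at h3
    exact (pow_pos hπ0 s).ne h3
  obtain ⟨n, hn⟩ := DF_val E hv hd (sub_mem hz (one_mem _)) hz0
  rw [map_pow, hn, h, ← zpow_natCast, ← zpow_natCast, ← zpow_mul] at h3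
  have h4 := zpow_inj' hπ0 hπ1 h3
  have h5 : p ∣ s := by
    have : (p : ℤ) ∣ s := ⟨n, by rw [← h4]; ring⟩
    exact_mod_cast this
  have h6 := Nat.le_of_dvd (Nat.pos_of_ne_zero hs0) h5
  have := hv.prime.two_le
  omega

theorem IsPl.val_diff (hv : IsPl p v) {a b : ℕ} (ha : a < p) (hb : b < p) (hab : a ≠ b) :
    v ((a : Ω) - b) = 1 := by
  rcases lt_or_gt_of_ne hab with h | h
  · rw [← neg_sub, map_neg_eq_map, ← Nat.cast_sub h.le]
    exact hv.natCast_eq_one fun hd => by have := Nat.le_of_dvd (by omega) hd; omega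
  · rw [← Nat.cast_sub h.le]
    exact hv.natCast_eq_one fun hd => by have := Nat.le_of_dvd (by omega) hd; omega

theorem IsPl.one_add_eq (hv : IsPl p v) {x : Ω} (hx : v x < 1) : v (1 + x) = 1 :=
  hv.eq_one_of_sub_lt (by rwa [add_sub_cancel_left])

theorem DF_index_ge (hv : IsPl p v) (hp : p ≠ 2) (hρ : ∃ ρ ∈ E, ρ ^ 3 = (p : Ω)) :
    (powSub p (DF v E)).index = 0 ∨ p ^ 3 ≤ (powSub p (DF v E)).index := by
  obtain ⟨π, hπ, hπ0, hπ1, hd⟩ := hv.discrete E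
  have hπne : π ≠ 0 := by rintro rfl; simp at hπ0
  have hvp : v (p : Ω) ≤ v π ^ 3 := by
    obtain ⟨ρ, hρE, hρ⟩ := hρ
    have h3 : v ρ ^ 3 = v (p : Ω) := by rw [← map_pow, hρ]
    have hlt : v ρ < 1 := by
      by_contra h
      push Not at h
      have := one_le_pow₀ h (n := 3)
      rw [h3] at this
      exact absurd hv.vp_lt (not_lt.2 this)
    have hρ0 : ρ ≠ 0 := by
      rintro rfl
      rw [map_zero, zero_pow three_ne_zero, hv.vp] at h3
      have := hv.prime.pos
      have : (0 : ℝ) < (p : ℝ)⁻¹ := by positivity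
      linarith
    obtain ⟨n, hn⟩ := hd ρ hρE hρ0
    have hn1 : 1 ≤ n := by
      by_contra hlt'
      have : (1 : ℝ) ≤ v π ^ n := one_le_zpow_of_nonpos₀ hπ0 hπ1.le (by omega)
      rw [← hn] at this
      linarith
    rw [← h3]
    refine pow_le_pow_left₀ (v.nonneg _) ?_ 3
    rw [hn]
    calc v π ^ n ≤ v π ^ (1 : ℤ) := zpow_le_zpow_right_of_le_one₀ hπ0 hπ1.le hn1
      _ = _ := zpow_one _
  have hπ2 : v (π ^ 2) < 1 := by rw [map_pow]; exact pow_lt_one₀ hπ0.le hπ1 two_ne_zero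
  have hA := hv.one_add_eq hπ1
  have hB := hv.one_add_eq hπ2
  have hAne : 1 + π ≠ 0 := by intro h; rw [h, map_zero] at hA; exact zero_ne_one hA
  have hBne : 1 + π ^ 2 ≠ 0 := by intro h; rw [h, map_zero] at hB; exact zero_ne_one hB
  have hπF := le_DF v E hπ
  have h1 := index_ge' (F := DF v E) hv.prime.ne_zero
    (fun i : Fin p × Fin p × Fin p => π ^ (i.1 : ℕ) * ((1 + π) ^ (i.2.1 : ℕ) * (1 + π ^ 2) ^ (i.2.2 : ℕ)))
    (fun i => mul_mem (pow_mem hπF _) (mul_mem (pow_mem (add_mem (one_mem _) hπF) _)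
      (pow_mem (add_mem (one_mem _) (pow_mem hπF 2)) _)))
    (fun i => mul_ne_zero (pow_ne_zero _ hπne) (mul_ne_zero (pow_ne_zero _ hAne) (pow_ne_zero _ hBne)))
    (by
      rintro ⟨a, b, c⟩ ⟨a', b', c'⟩ z hz h
      simp only at h
      have hz0 : z ≠ 0 := by
        rintro rfl
        rw [zero_pow hv.prime.ne_zero, mul_zero] at h
        exact mul_ne_zero (pow_ne_zero _ hπne)
          (mul_ne_zero (pow_ne_zero _ hAne) (pow_ne_zero _ hBne)) h
      obtain ⟨n, hn⟩ := DF_val E hv hd hz hz0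
      have hvv := congrArg v h
      simp only [map_mul, map_pow v, hA, hB, one_pow, mul_one, hn] at hvv
      rw [← zpow_natCast, ← zpow_natCast, ← zpow_natCast, ← zpow_mul, ← zpow_add₀ hπ0.ne'] at hvv
      have hac := zpow_inj' hπ0 hπ1 hvv
      have ha := a.2
      have hc := a'.2
      have hn0 : n = 0 := by
        by_contra hne
        rcases lt_or_gt_of_ne hne with h | h
        · nlinarith
        · nlinarith
      have hac' : (a : ℕ) = a' := by rw [hn0] at hac; omega
      rw [hn0, zpow_zero] at hn
      rw [hac', mul_assoc] at h
      have h := mul_left_cancel₀ (pow_ne_zero _ hπne) h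
      have hbb : (b : ℕ) = b' := by
        by_contra hne
        apply no_root E hv hp hπ0 hπ1 hd hvp hz hn (s := 1) one_ne_zero (by norm_num)
        have e1 : z ^ p - 1 = ((1 + π) ^ (b : ℕ) * (1 + π ^ 2) ^ (c : ℕ) -
            (1 + π) ^ (b' : ℕ) * (1 + π ^ 2) ^ (c' : ℕ)) /
            ((1 + π) ^ (b' : ℕ) * (1 + π ^ 2) ^ (c' : ℕ)) := by
          rw [h]; field_simp
        rw [e1, map_div₀, map_mul v ((1 + π) ^ (b' : ℕ)), map_pow v, map_pow v, hA, hB, one_pow, one_pow, mul_one, div_one,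
          pow_one]
        have hdiff : v ((((b : ℕ) : Ω) - (b' : ℕ)) * π) = v π := by
          rw [map_mul, hv.val_diff b.2 b'.2 hne, one_mul]
        rw [← hdiff]
        apply hv.eq_of_sub_lt
        rw [hdiff]
        have hsq : v π ^ 2 < v π := by
          calc v π ^ 2 < v π ^ 1 := pow_lt_pow_right_of_lt_one₀ hπ0 hπ1 (by norm_num)
            _ = _ := pow_one _
        have hC : ∀ m : ℕ, v ((1 + π ^ 2) ^ m - 1) ≤ v π ^ 2 := by
          intro m
          have h5 := hv.one_add_pow hπ2.le m
          have : (1 + π ^ 2) ^ m - 1 = ((1 + π ^ 2) ^ m - 1 - m * π ^ 2) + m * π ^ 2 := by ring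
          rw [this]
          refine hv.add_le (h5.trans ?_) ?_
          · rw [map_pow]
            exact pow_le_of_le_one (by positivity) (pow_le_one₀ hπ0.le hπ1.le) two_ne_zero
          · rw [map_mul, map_pow]
            exact mul_le_of_le_one_left (by positivity) (hv.natCast_le m)
        have hD := fun k => hv.one_add_pow hπ1.le k
        have hAle : ∀ k : ℕ, v ((1 + π) ^ k) ≤ 1 := fun k => by rw [map_pow, hA, one_pow]
        have hm1 : ∀ k m : ℕ, v ((1 + π) ^ k * (1 + π ^ 2) ^ m - 1 - k * π) ≤ v π ^ 2 := by
          intro k m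
          have : (1 + π) ^ k * (1 + π ^ 2) ^ m - 1 - k * π =
            (1 + π) ^ k * ((1 + π ^ 2) ^ m - 1) + ((1 + π) ^ k - 1 - k * π) := by ring
          rw [this]
          refine hv.add_le ?_ (hD k)
          rw [map_mul]
          exact (mul_le_of_le_one_left (v.nonneg _) (hAle k)).trans (hC m)
        have e2 : (1 + π) ^ (b : ℕ) * (1 + π ^ 2) ^ (c : ℕ) -
            (1 + π) ^ (b' : ℕ) * (1 + π ^ 2) ^ (c' : ℕ) - (((b : ℕ) : Ω) - (b' : ℕ)) * π =
            ((1 + π) ^ (b : ℕ) * (1 + π ^ 2) ^ (c : ℕ) - 1 - (b : ℕ) * π) -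
            ((1 + π) ^ (b' : ℕ) * (1 + π ^ 2) ^ (c' : ℕ) - 1 - (b' : ℕ) * π) := by ring
        rw [e2]
        exact (hv.sub_le (hm1 _ _) (hm1 _ _)).trans_lt hsq
      rw [hbb, mul_assoc] at h
      have h := mul_left_cancel₀ (pow_ne_zero _ hAne) h
      have hcc : (c : ℕ) = c' := by
        by_contra hne
        apply no_root E hv hp hπ0 hπ1 hd hvp hz hn (s := 2) two_ne_zero (by norm_num)
        have e1 : z ^ p - 1 = ((1 + π ^ 2) ^ (c : ℕ) - (1 + π ^ 2) ^ (c' : ℕ)) /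
            ((1 + π ^ 2) ^ (c' : ℕ)) := by
          rw [h]; field_simp
        rw [e1, map_div₀, map_pow v (1 + π ^ 2) (c' : ℕ), hB, one_pow, div_one]
        have hdiff : v ((((c : ℕ) : Ω) - (c' : ℕ)) * π ^ 2) = v π ^ 2 := by
          rw [map_mul, hv.val_diff c.2 c'.2 hne, one_mul, map_pow]
        rw [← hdiff]
        apply hv.eq_of_sub_lt
        rw [hdiff]
        have e2 : (1 + π ^ 2) ^ (c : ℕ) - (1 + π ^ 2) ^ (c' : ℕ) - (((c : ℕ) : Ω) - (c' : ℕ)) * π ^ 2 =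
            ((1 + π ^ 2) ^ (c : ℕ) - 1 - (c : ℕ) * π ^ 2) -
            ((1 + π ^ 2) ^ (c' : ℕ) - 1 - (c' : ℕ) * π ^ 2) := by ring
        rw [e2]
        refine (hv.sub_le (hv.one_add_pow hπ2.le _) (hv.one_add_pow hπ2.le _)).trans_lt ?_
        rw [map_pow, ← pow_mul]
        exact pow_lt_pow_right_of_lt_one₀ hπ0 hπ1 (by norm_num)
      exact Prod.ext (Fin.ext hac') (Prod.ext (Fin.ext hbb) (Fin.ext hcc)))
  rw [Fintype.card_prod, Fintype.card_prod, Fintype.card_fin] at h1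
  rwa [pow_succ', sq]

theorem chCard_eq (hv : IsPl p v) (hp : p ≠ 2) {U : Subgroup (Ω ≃ₐ[ℚ] Ω)}
    (hU : IsOpen (U : Set (Ω ≃ₐ[ℚ] Ω)))
    (hμ : ∀ z : Ω, z ^ p = 1 → z ∈ fixedField U) (hρ : ∃ ρ ∈ fixedField U, ρ ^ 3 = (p : Ω)) :
    chCard p Ω ↥(Dec v ⊓ U) = 0 ∨ p ^ 3 ≤ chCard p Ω ↥(Dec v ⊓ U) := by
  rw [kummer_card hv.prime (isClosed_Dec_inf hU) (fun z hz => fixedField_mono inf_le_right (hμ z hz)),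
    Dec_inf_open hU]
  haveI := finiteDimensional_of_open hU
  exact DF_index_ge _ hv hp hρ

end ThmB

end NU

namespace NU

open IntermediateField NumberField IsDedekindDomain

section LC

variable {Ω : Type*} [Field Ω] [CharZero Ω] [Algebra.IsAlgebraic ℚ Ω] [IsAlgClosed Ω]
variable {p q : ℕ} {v w : AbsoluteValue Ω ℝ}

/-- open subgroup -/
abbrev Op (H : Subgroup (Ω ≃ₐ[ℚ] Ω)) : Prop := IsOpen (H : Set (Ω ≃ₐ[ℚ] Ω))

theorem Op.inf {H H' : Subgroup (Ω ≃ₐ[ℚ] Ω)} (h : Op H) (hq : Op H') : Op (H ⊓ H') :=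
  IsOpen.inter h hq

/-- a topological isomorphism of open subgroups -/
structure LI (A B : Subgroup (Ω ≃ₐ[ℚ] Ω)) where
  e : A ≃* B
  c1 : Continuous e
  c2 : Continuous e.symm
  oA : Op A
  oB : Op B

variable {A B : Subgroup (Ω ≃ₐ[ℚ] Ω)}

/-- inverse -/
def LI.symm (e : LI A B) : LI B A := ⟨e.e.symm, e.c2, e.c1, e.oB, e.oA⟩

/-- transport of subgroups -/
def LI.tr (e : LI A B) (H : Subgroup (Ω ≃ₐ[ℚ] Ω)) : Subgroup (Ω ≃ₐ[ℚ] Ω) :=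
  ((H.subgroupOf A).map e.e.toMonoidHom).map B.subtype

theorem LI.mem_tr (e : LI A B) {H : Subgroup (Ω ≃ₐ[ℚ] Ω)} {x : Ω ≃ₐ[ℚ] Ω} :
    x ∈ e.tr H ↔ ∃ a : A, (a : Ω ≃ₐ[ℚ] Ω) ∈ H ∧ (e.e a : Ω ≃ₐ[ℚ] Ω) = x := by
  simp only [LI.tr, Subgroup.mem_map, Subgroup.mem_subgroupOf]
  constructor
  · rintro ⟨_, ⟨a, ha, rfl⟩, rfl⟩; exact ⟨a, ha, rfl⟩
  · rintro ⟨a, ha, rfl⟩; exact ⟨_, ⟨a, ha, rfl⟩, rfl⟩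

theorem LI.apply_mem (e : LI A B) {H : Subgroup (Ω ≃ₐ[ℚ] Ω)} {a : A} :
    (e.e a : Ω ≃ₐ[ℚ] Ω) ∈ e.tr H ↔ (a : Ω ≃ₐ[ℚ] Ω) ∈ H := by
  rw [e.mem_tr]
  constructor
  · rintro ⟨b, hb, h⟩
    have := e.e.injective (Subtype.ext h)
    rwa [← this]
  · intro h; exact ⟨a, h, rfl⟩

theorem LI.symm_apply (e : LI A B) (a : A) : e.symm.e (e.e a) = a := e.e.symm_apply_apply a

theorem LI.apply_symm (e : LI A B) (b : B) : e.e (e.symm.e b) = b := e.e.apply_symm_apply b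

theorem LI.tr_le (e : LI A B) (H : Subgroup (Ω ≃ₐ[ℚ] Ω)) : e.tr H ≤ B := by
  intro x hx
  obtain ⟨a, -, rfl⟩ := e.mem_tr.1 hx
  exact (e.e a).2

theorem LI.mem_tr_symm (e : LI A B) {H : Subgroup (Ω ≃ₐ[ℚ] Ω)} {a : A} :
    (a : Ω ≃ₐ[ℚ] Ω) ∈ e.symm.tr H ↔ (e.e a : Ω ≃ₐ[ℚ] Ω) ∈ H := by
  conv_lhs => rw [← e.symm_apply a]
  exact e.symm.apply_mem

theorem LI.symm_tr_tr (e : LI A B) {H : Subgroup (Ω ≃ₐ[ℚ] Ω)} (h : H ≤ A) : e.symm.tr (e.tr H) = H := by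
  ext x
  constructor
  · intro hx
    have hxA := e.symm.tr_le _ hx
    exact e.apply_mem.1 (e.mem_tr_symm (a := ⟨x, hxA⟩).1 hx)
  · intro hx
    exact e.mem_tr_symm (a := ⟨x, h hx⟩).2 (e.apply_mem.2 hx)

theorem LI.tr_inf (e : LI A B) (H H' : Subgroup (Ω ≃ₐ[ℚ] Ω)) : e.tr (H ⊓ H') = e.tr H ⊓ e.tr H' := by
  ext x
  constructor
  · intro hx
    obtain ⟨a, ha, rfl⟩ := e.mem_tr.1 hx
    exact ⟨e.apply_mem.2 ha.1, e.apply_mem.2 ha.2⟩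
  · rintro ⟨hx, hx'⟩
    obtain ⟨a, ha, rfl⟩ := e.mem_tr.1 hx
    exact e.apply_mem.2 ⟨ha, e.apply_mem.1 hx'⟩

theorem LI.tr_mono (e : LI A B) {H H' : Subgroup (Ω ≃ₐ[ℚ] Ω)} (h : H ≤ H') : e.tr H ≤ e.tr H' := by
  intro x hx
  obtain ⟨a, ha, rfl⟩ := e.mem_tr.1 hx
  exact e.apply_mem.2 (h ha)

theorem LI.tr_coe (e : LI A B) (H : Subgroup (Ω ≃ₐ[ℚ] Ω)) :
    (e.tr H : Set (Ω ≃ₐ[ℚ] Ω)) = Subtype.val '' (e.e.symm ⁻¹' (Subtype.val ⁻¹' (H : Set (Ω ≃ₐ[ℚ] Ω)))) := by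
  ext x
  constructor
  · intro hx
    obtain ⟨a, ha, rfl⟩ := e.mem_tr.1 hx
    refine ⟨e.e a, ?_, rfl⟩
    change ((e.e.symm (e.e a) : A) : Ω ≃ₐ[ℚ] Ω) ∈ H
    rwa [e.e.symm_apply_apply]
  · rintro ⟨b, hb, rfl⟩
    exact e.mem_tr.2 ⟨e.e.symm b, hb, congrArg _ (e.e.apply_symm_apply b)⟩

theorem LI.tr_open (e : LI A B) {H : Subgroup (Ω ≃ₐ[ℚ] Ω)} (hH : Op H) : Op (e.tr H) := by
  rw [Op, e.tr_coe]
  exact e.oB.isOpenMap_subtype_val _ ((hH.preimage continuous_subtype_val).preimage e.c2)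

theorem LI.tr_closed (e : LI A B) {H : Subgroup (Ω ≃ₐ[ℚ] Ω)} (hH : IsClosed (H : Set (Ω ≃ₐ[ℚ] Ω))) :
    IsClosed (e.tr H : Set (Ω ≃ₐ[ℚ] Ω)) := by
  rw [e.tr_coe]
  exact (Subgroup.isClosed_of_isOpen B e.oB).isClosedMap_subtype_val _
    ((hH.preimage continuous_subtype_val).preimage e.c2)

theorem LI.chCard_tr (e : LI A B) {H : Subgroup (Ω ≃ₐ[ℚ] Ω)} (hH : H ≤ A) (l : ℕ) :
    chCard l Ω ↥(e.tr H) = chCard l Ω ↥H := by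
  symm
  let f : H ≃* e.tr H :=
    { toFun := fun h => ⟨e.e ⟨h, hH h.2⟩, e.apply_mem.2 h.2⟩
      invFun := fun x => ⟨e.e.symm ⟨x, e.tr_le _ x.2⟩, e.apply_mem.1 (by
        rw [e.e.apply_symm_apply]; exact x.2)⟩
      left_inv := fun h => by
        apply Subtype.ext
        have := congrArg Subtype.val (e.e.symm_apply_apply ⟨h, hH h.2⟩)
        exact this
      right_inv := fun x => by
        apply Subtype.ext
        have := congrArg Subtype.val (e.e.apply_symm_apply ⟨x, e.tr_le _ x.2⟩)
        exact this
      map_mul' := fun x y => by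
        apply Subtype.ext
        have := congrArg Subtype.val (e.e.map_mul ⟨x, hH x.2⟩ ⟨y, hH y.2⟩)
        exact this }
  refine chCard_congr l Ω f ?_ ?_
  · refine Continuous.subtype_mk ?_ _
    exact continuous_subtype_val.comp (e.c1.comp (Continuous.subtype_mk continuous_subtype_val _))
  · refine Continuous.subtype_mk ?_ _
    exact continuous_subtype_val.comp (e.c2.comp (Continuous.subtype_mk continuous_subtype_val _))

theorem LI.tr_TT (e : LI A B) {H : Subgroup (Ω ≃ₐ[ℚ] Ω)} (hH : H ≤ A) (h : TT H)
    (hi : ∃ i ∈ fixedField (e.tr H), i ^ 2 = -1) : TT (e.tr H) := by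
  refine ⟨e.tr_closed h.closed, hi, fun V hV => ?_⟩
  have : e.tr H ⊓ V = e.tr (H ⊓ e.symm.tr V) := by
    ext x
    constructor
    · rintro ⟨hx, hx'⟩
      obtain ⟨a, ha, rfl⟩ := e.mem_tr.1 hx
      exact e.apply_mem.2 ⟨ha, e.mem_tr_symm.2 hx'⟩
    · intro hx
      obtain ⟨a, ha, rfl⟩ := e.mem_tr.1 hx
      exact ⟨e.apply_mem.2 ha.1, e.mem_tr_symm.1 ha.2⟩
  rw [this, e.chCard_tr (inf_le_left.trans hH)]
  exact h.cnt _ (e.symm.tr_open hV)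

/-- correspondence of places -/
def LI.Cor (e : LI A B) (v w : AbsoluteValue Ω ℝ) : Prop :=
  ∃ W : Subgroup (Ω ≃ₐ[ℚ] Ω), Op W ∧ e.tr (Dec v ⊓ W) ≤ Dec w

/-- an open subgroup fixing finitely many elements, also after transport -/
theorem LI.exists_small (e : LI A B) (s : Finset Ω) : ∃ U : Subgroup (Ω ≃ₐ[ℚ] Ω), Op U ∧ U ≤ A ∧
    (∀ x ∈ s, x ∈ fixedField U) ∧ ∀ x ∈ s, x ∈ fixedField (e.tr U) := by
  classical
  haveI : FiniteDimensional ℚ (adjoin ℚ (s : Set Ω)) :=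
    finiteDimensional_adjoin fun x _ => Algebra.IsIntegral.isIntegral x
  let G := (adjoin ℚ (s : Set Ω)).fixingSubgroup
  have hG : Op G := isOpen_fixing _
  have hs : ∀ x ∈ s, ∀ g ∈ G, g x = x := fun x hx g hg => mem_fixing.1 hg x (subset_adjoin _ _ hx)
  refine ⟨A ⊓ G ⊓ e.symm.tr G, (e.oA.inf hG).inf (e.symm.tr_open hG), inf_le_left.trans inf_le_left,
    fun x hx => mem_fixedField'.2 fun g hg => hs x hx g hg.1.2, fun x hx =>
    mem_fixedField'.2 fun g hg => ?_⟩
  obtain ⟨a, ha, rfl⟩ := e.mem_tr.1 hg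
  exact hs x hx _ (e.mem_tr_symm.1 ha.2)

theorem TT.of_le {H : Subgroup (Ω ≃ₐ[ℚ] Ω)} (hH : TT H) {q' : ℕ} {w' : AbsoluteValue Ω ℝ} (hq : q ≠ 2)
    (hw : IsPl q w) (hq' : q' ≠ 2) (hw' : IsPl q' w') (h : H ≤ Dec w) (h' : H ≤ Dec w') : w = w' := by
  obtain ⟨_, _, -, -, -, hu⟩ := hH.thmA
  rw [hu q w hq hw h, hu q' w' hq' hw' h']

theorem LI.small_TT (e : LI A B) (hp : p ≠ 2) (hv : IsPl p v) {W : Subgroup (Ω ≃ₐ[ℚ] Ω)} (hW : Op W) :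
    ∃ U, Op U ∧ U ≤ A ∧ U ≤ W ∧ TT (Dec v ⊓ U) ∧ TT (e.tr (Dec v ⊓ U)) := by
  obtain ⟨i, hi⟩ := IsAlgClosed.exists_pow_nat_eq (-1 : Ω) (n := 2) two_pos
  obtain ⟨U, hU, hUA, h1, h2⟩ := e.exists_small {i}
  have hT : TT (Dec v ⊓ (U ⊓ W)) := TT_Dec hv hp (hU.inf hW)
    ⟨i, fixedField_mono inf_le_left (h1 i (by simp)), hi⟩
  refine ⟨U ⊓ W, hU.inf hW, inf_le_left.trans hUA, inf_le_right, hT, ?_⟩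
  refine e.tr_TT (inf_le_right.trans (inf_le_left.trans hUA)) hT
    ⟨i, fixedField_mono (e.tr_mono (inf_le_right.trans inf_le_left)) (h2 i (by simp)), hi⟩

theorem LI.cor_exists (e : LI A B) (hp : p ≠ 2) (hv : IsPl p v) :
    ∃ q w, q ≠ 2 ∧ IsPl q w ∧ e.Cor v w := by
  obtain ⟨U, hU, -, -, -, hT⟩ := e.small_TT hp hv (W := A) e.oA
  obtain ⟨q, w, hq, hw, hle, -⟩ := hT.thmA
  exact ⟨q, w, hq, hw, U, hU, hle⟩

theorem LI.cor_unique (e : LI A B) (hp : p ≠ 2) (hv : IsPl p v) {q' : ℕ} {w' : AbsoluteValue Ω ℝ}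
    (hq : q ≠ 2) (hw : IsPl q w) (hq' : q' ≠ 2) (hw' : IsPl q' w') (h : e.Cor v w) (h' : e.Cor v w') :
    w = w' := by
  obtain ⟨W, hW, hl⟩ := h
  obtain ⟨W', hW', hl'⟩ := h'
  obtain ⟨U, hU, -, hUW, -, hT⟩ := e.small_TT hp hv (hW.inf hW')
  exact hT.of_le hq hw hq' hw' ((e.tr_mono (inf_le_inf_left _ (hUW.trans inf_le_left))).trans hl)
    ((e.tr_mono (inf_le_inf_left _ (hUW.trans inf_le_right))).trans hl')

theorem LI.cor_symm (e : LI A B) (hp : p ≠ 2) (hv : IsPl p v) (hq : q ≠ 2) (hw : IsPl q w)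
    (h : e.Cor v w) : e.symm.Cor w v := by
  obtain ⟨p', v', hp', hv', W', hW', hl'⟩ := e.symm.cor_exists hq hw
  obtain ⟨W, hW, hl⟩ := h
  obtain ⟨U, hU, hUA, hUW, hT, -⟩ := e.small_TT hp hv (hW.inf (e.symm.tr_open hW'))
  have : v = v' := by
    refine hT.of_le hp hv hp' hv' inf_le_left fun x hx => hl' ?_
    have hxA := hUA hx.2
    refine e.mem_tr_symm (a := ⟨x, hxA⟩).2 ⟨hl (e.apply_mem.2 ⟨hx.1, (hUW hx.2).1⟩), ?_⟩
    exact e.mem_tr_symm.1 (hUW hx.2).2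
  rw [this]
  exact ⟨W', hW', hl'⟩

theorem mem_Dec_pull {g h : Ω ≃ₐ[ℚ] Ω} : h ∈ Dec (pull v g) ↔ g * h * g⁻¹ ∈ Dec v := by
  rw [mem_Dec, mem_Dec, ← pull_mul]
  constructor
  · intro h1
    rw [pull_mul, h1, ← pull_mul, mul_inv_cancel, pull_one]
  · intro h1
    have := congrArg (fun u => pull u g) h1
    simp only [← pull_mul] at this
    rwa [inv_mul_cancel_right] at this

theorem LI.cor_pull (e : LI A B) (h : e.Cor v w) (a : A) :
    e.Cor (pull v a) (pull w (e.e a)) := by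
  obtain ⟨W, hW, hl⟩ := h
  refine ⟨W.comap (MulAut.conj (a : Ω ≃ₐ[ℚ] Ω)).toMonoidHom, ?_, ?_⟩
  · have hc : Continuous (fun x : Ω ≃ₐ[ℚ] Ω => (a : Ω ≃ₐ[ℚ] Ω) * x * (a : Ω ≃ₐ[ℚ] Ω)⁻¹) := by fun_prop
    exact hW.preimage hc
  · intro x hx
    obtain ⟨b, hb, rfl⟩ := e.mem_tr.1 hx
    rw [mem_Dec_pull]
    have : (e.e (a * b * a⁻¹) : Ω ≃ₐ[ℚ] Ω) ∈ Dec w :=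
      hl (e.apply_mem.2 ⟨mem_Dec_pull.1 hb.1, hb.2⟩)
    rw [map_mul, map_mul, map_inv] at this
    exact this

theorem LI.cor_dec1 (e : LI A B) (hp : p ≠ 2) (hv : IsPl p v) (hq : q ≠ 2) (hw : IsPl q w)
    (h : e.Cor v w) {a : A} (ha : (a : Ω ≃ₐ[ℚ] Ω) ∈ Dec v) : (e.e a : Ω ≃ₐ[ℚ] Ω) ∈ Dec w := by
  have h1 := e.cor_pull h a
  rw [mem_Dec.1 ha] at h1
  exact (e.cor_unique hp hv hq hw hq (hw.pull _) h h1).symm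

theorem LI.cor_dec (e : LI A B) (hp : p ≠ 2) (hv : IsPl p v) (hq : q ≠ 2) (hw : IsPl q w)
    (h : e.Cor v w) (a : A) : (e.e a : Ω ≃ₐ[ℚ] Ω) ∈ Dec w ↔ (a : Ω ≃ₐ[ℚ] Ω) ∈ Dec v := by
  refine ⟨fun h1 => ?_, e.cor_dec1 hp hv hq hw h⟩
  have := e.symm.cor_dec1 hq hw hp hv (e.cor_symm hp hv hq hw h) h1
  rwa [e.symm_apply] at this

theorem LI.cor_char (e : LI A B) (hp : p ≠ 2) (hv : IsPl p v) (hq : q ≠ 2) (hw : IsPl q w)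
    (h : e.Cor v w) : q = p := by
  classical
  by_contra hne
  obtain ⟨ρ, hρ⟩ := IsAlgClosed.exists_pow_nat_eq (p : Ω) (n := 3) three_pos
  obtain ⟨U, hU, hUA, h1, h2⟩ := e.exists_small (insert ρ (Polynomial.nthRootsFinset p (1 : Ω)))
  have hμ : ∀ z : Ω, z ^ p = 1 → z ∈ insert ρ (Polynomial.nthRootsFinset p (1 : Ω)) := fun z hz =>
    Finset.mem_insert_of_mem ((Polynomial.mem_nthRootsFinset hv.prime.pos _).2 hz)
  have e1 := chCard_eq hv hp hU (fun z hz => h1 z (hμ z hz)) ⟨ρ, h1 ρ (Finset.mem_insert_self _ _), hρ⟩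
  have e2 := chCard_ne hw (e.tr_open hU) hv.prime (Ne.symm hne) (fun z hz => h2 z (hμ z hz))
  have e3 : Dec w ⊓ e.tr U = e.tr (Dec v ⊓ U) := by
    ext x
    constructor
    · rintro ⟨hx, hx'⟩
      obtain ⟨a, ha, rfl⟩ := e.mem_tr.1 hx'
      exact e.apply_mem.2 ⟨(e.cor_dec hp hv hq hw h a).1 hx, ha⟩
    · intro hx
      obtain ⟨a, ha, rfl⟩ := e.mem_tr.1 hx
      exact ⟨(e.cor_dec hp hv hq hw h a).2 ha.1, e.apply_mem.2 ha.2⟩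
  rw [e3, e.chCard_tr (inf_le_right.trans hUA)] at e2
  have : p ^ 2 < p ^ 3 := Nat.pow_lt_pow_right hv.prime.one_lt (by norm_num)
  omega

/-- local correspondence -/
theorem LI.cor (e : LI A B) (hp : p ≠ 2) (hv : IsPl p v) : ∃ w, IsPl p w ∧ e.Cor v w := by
  obtain ⟨q, w, hq, hw, h⟩ := e.cor_exists hp hv
  obtain rfl := e.cor_char hp hv hq hw h
  exact ⟨w, hw, h⟩

end LC

end NU

namespace NU

open IntermediateField NumberField IsDedekindDomain

section E1

variable {Ω : Type*} [Field Ω] [CharZero Ω] [Algebra.IsAlgebraic ℚ Ω] [IsAlgClosed Ω]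
variable {p q : ℕ} {v w : AbsoluteValue Ω ℝ}
variable {A B U : Subgroup (Ω ≃ₐ[ℚ] Ω)}

/-- totally split -/
def Split (U : Subgroup (Ω ≃ₐ[ℚ] Ω)) (p : ℕ) : Prop := ∀ v, IsPl p v → Dec v ≤ U

/-- orbit relation on places -/
def orb (U : Subgroup (Ω ≃ₐ[ℚ] Ω)) (p : ℕ) : Setoid {v : AbsoluteValue Ω ℝ // IsPl p v} where
  r v w := ∃ u ∈ U, pull v.1 u = w.1
  iseqv :=
    { refl := fun v => ⟨1, U.one_mem, pull_one _⟩
      symm := by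
        rintro v w ⟨u, hu, h⟩
        exact ⟨u⁻¹, U.inv_mem hu, by rw [← h, ← pull_mul, mul_inv_cancel, pull_one]⟩
      trans := by
        rintro v w z ⟨u, hu, h⟩ ⟨t, ht, h'⟩
        exact ⟨u * t, U.mul_mem hu ht, by rw [pull_mul, h, h']⟩ }

/-- number of orbits -/
noncomputable def nOrb (U : Subgroup (Ω ≃ₐ[ℚ] Ω)) (p : ℕ) : ℕ := Nat.card (Quotient (orb U p))

theorem finite_quot (hU : Op U) : Finite ((Ω ≃ₐ[ℚ] Ω) ⧸ U) := Subgroup.quotient_finite_of_isOpen U hU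

theorem index_ne_zero (hU : Op U) : U.index ≠ 0 := by
  haveI := finite_quot hU
  exact ne_of_gt Nat.card_pos

/-- cosets to orbits -/
noncomputable def toOrb (U : Subgroup (Ω ≃ₐ[ℚ] Ω)) (hv : IsPl p v) : ((Ω ≃ₐ[ℚ] Ω) ⧸ U) → Quotient (orb U p) :=
  Quotient.map' (fun g => ⟨pull v g, hv.pull g⟩) (by
    intro g h hgh
    rw [QuotientGroup.leftRel_apply] at hgh
    exact ⟨g⁻¹ * h, hgh, by rw [← pull_mul, mul_inv_cancel_left]⟩)

theorem toOrb_surj (hv : IsPl p v) : Function.Surjective (toOrb U hv) := by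
  intro x
  obtain ⟨⟨w, hw⟩, rfl⟩ := Quotient.exists_rep x
  obtain ⟨g, rfl⟩ := trans_all hv hw
  exact ⟨(g : (Ω ≃ₐ[ℚ] Ω) ⧸ U), rfl⟩

theorem nOrb_le (hU : Op U) (hp : p.Prime) : nOrb U p ≤ U.index := by
  obtain ⟨v, hv⟩ := exists_isPl (Ω := Ω) hp
  haveI := finite_quot hU
  exact Nat.card_le_card_of_surjective _ (toOrb_surj (U := U) hv)

theorem nOrb_eq_iff (hU : Op U) (hp : p.Prime) : nOrb U p = U.index ↔ Split U p := by
  obtain ⟨v, hv⟩ := exists_isPl (Ω := Ω) hp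
  haveI := finite_quot hU
  constructor
  · intro h w hw d hd
    have hb : Function.Bijective (toOrb U hv) := (toOrb_surj hv).bijective_of_nat_card_le h.ge
    obtain ⟨g, rfl⟩ := trans_all hv hw
    have h1 : toOrb U hv ((g * d : Ω ≃ₐ[ℚ] Ω) : (Ω ≃ₐ[ℚ] Ω) ⧸ U) = toOrb U hv (g : (Ω ≃ₐ[ℚ] Ω) ⧸ U) := by
      have : (⟨pull v (g * d), hv.pull _⟩ : {v : AbsoluteValue Ω ℝ // IsPl p v}) =
          ⟨pull v g, hv.pull g⟩ := Subtype.ext ((pull_mul v g d).trans hd)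
      exact congrArg (Quotient.mk (orb U p)) this
    have h2 := QuotientGroup.eq.1 (hb.1 h1)
    have h3 : d⁻¹ ∈ U := by simpa [mul_assoc] using h2
    simpa using U.inv_mem h3
  · intro hs
    refine (Nat.card_eq_of_bijective (toOrb U hv) ⟨?_, toOrb_surj hv⟩).symm
    intro x y hxy
    obtain ⟨g, rfl⟩ := QuotientGroup.mk_surjective x
    obtain ⟨h, rfl⟩ := QuotientGroup.mk_surjective y
    obtain ⟨u, hu, hgu⟩ := Quotient.exact hxy
    simp only at hgu
    rw [← pull_mul] at hgu
    rw [QuotientGroup.eq]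
    have hd : h⁻¹ * (g * u) ∈ Dec (pull v h) := by
      rw [mem_Dec, ← pull_mul, mul_inv_cancel_left, hgu]
    have h1 := hs _ (hv.pull h) hd
    have h2 : g⁻¹ * h = u * (h⁻¹ * (g * u))⁻¹ := by group
    rw [h2]
    exact U.mul_mem hu (U.inv_mem h1)

theorem LI.nOrb_tr (e : LI A B) (hp : p ≠ 2) (hU : U ≤ A) : nOrb U p = nOrb (e.tr U) p := by
  choose f hf hc using fun (v : AbsoluteValue Ω ℝ) (hv : IsPl p v) => e.cor hp hv
  have huniq : ∀ {v w w' : AbsoluteValue Ω ℝ}, IsPl p v → IsPl p w → IsPl p w' → e.Cor v w →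
    e.Cor v w' → w = w' := fun hv hw hw' h h' => e.cor_unique hp hv hp hw hp hw' h h'
  have huniq' : ∀ {v v' w : AbsoluteValue Ω ℝ}, IsPl p v → IsPl p v' → IsPl p w → e.Cor v w →
    e.Cor v' w → v = v' := fun hv hv' hw h h' =>
      e.symm.cor_unique hp hw hp hv hp hv' (e.cor_symm hp hv hp hw h) (e.cor_symm hp hv' hp hw h')
  let F : Quotient (orb U p) → Quotient (orb (e.tr U) p) :=
    Quotient.map (fun v => ⟨f v.1 v.2, hf v.1 v.2⟩) (by
      rintro ⟨v, hv⟩ ⟨w, hw⟩ ⟨u, hu, h⟩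
      simp only at h
      refine ⟨e.e ⟨u, hU hu⟩, e.apply_mem.2 hu, ?_⟩
      refine huniq hw ((hf v hv).pull _) (hf w hw) ?_ (hc w hw)
      rw [← h]
      exact e.cor_pull (hc v hv) ⟨u, hU hu⟩)
  refine Nat.card_eq_of_bijective F ⟨?_, ?_⟩
  · intro x y hxy
    obtain ⟨⟨v, hv⟩, rfl⟩ := Quotient.exists_rep x
    obtain ⟨⟨w, hw⟩, rfl⟩ := Quotient.exists_rep y
    obtain ⟨b, hb, hvb⟩ := Quotient.exact hxy
    obtain ⟨a, ha, rfl⟩ := e.mem_tr.1 hb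
    simp only at hvb
    refine Quotient.sound ⟨a, ha, ?_⟩
    have h1 := e.cor_pull (hc v hv) a
    rw [hvb] at h1
    exact huniq' (hv.pull _) hw (hf w hw) h1 (hc w hw)
  · intro y
    obtain ⟨⟨w, hw⟩, rfl⟩ := Quotient.exists_rep y
    obtain ⟨v, hv, h⟩ := e.symm.cor hp hw
    have h1 : e.Cor v w := e.symm.cor_symm hp hw hp hv h
    refine ⟨Quotient.mk _ ⟨v, hv⟩, ?_⟩
    have h2 : (⟨f v hv, hf v hv⟩ : {v : AbsoluteValue Ω ℝ // IsPl p v}) = ⟨w, hw⟩ :=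
      Subtype.ext (huniq hv (hf v hv) hw (hc v hv) h1)
    exact congrArg (Quotient.mk _) h2

theorem Split.mono {U V : Subgroup (Ω ≃ₐ[ℚ] Ω)} (h : Split U p) (hUV : U ≤ V) : Split V p :=
  fun v hv => (h v hv).trans hUV

theorem LI.index_tr (e : LI A B)
    (hex : ∀ V : Subgroup (Ω ≃ₐ[ℚ] Ω), Op V → ∃ p, p ≠ 2 ∧ p.Prime ∧ Split V p)
    (hUA : U ≤ A) (hU : Op U) : (e.tr U).index = U.index := by
  obtain ⟨p, hp, hpp, hs⟩ := hex _ (hU.inf (e.tr_open hU))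
  rw [← (nOrb_eq_iff hU hpp).2 (hs.mono inf_le_left),
    ← (nOrb_eq_iff (e.tr_open hU) hpp).2 (hs.mono inf_le_right), e.nOrb_tr hp hUA]

theorem LI.split_tr (e : LI A B)
    (hex : ∀ V : Subgroup (Ω ≃ₐ[ℚ] Ω), Op V → ∃ p, p ≠ 2 ∧ p.Prime ∧ Split V p)
    (hUA : U ≤ A) (hU : Op U) (hp : p ≠ 2) (hpp : p.Prime) (h : Split U p) : Split (e.tr U) p := by
  rw [← nOrb_eq_iff (e.tr_open hU) hpp, e.index_tr hex hUA hU, ← e.nOrb_tr hp hUA]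
  exact (nOrb_eq_iff hU hpp).2 h

theorem Split.of_normal (hN : U.Normal) (hv : IsPl p v) (h : Dec v ≤ U) : Split U p := by
  intro w hw d hd
  obtain ⟨g, rfl⟩ := trans_all hv hw
  have h1 := h (mem_Dec_pull.1 hd)
  have := hN.conj_mem _ h1 g⁻¹
  simpa [mul_assoc] using this

theorem Split.normalCore (h : Split U p) : Split U.normalCore p := by
  intro v hv d hd g
  have h1 : g * d * g⁻¹ ∈ Dec (pull v g⁻¹) := by
    rw [mem_Dec_pull]; simpa [mul_assoc] using hd
  exact h _ (hv.pull _) h1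

end E1

end NU

namespace NU

open NumberField IsDedekindDomain Filter Topology

section An

theorem card_fin_ideal (F : Type*) [Field F] [NumberField F] (n : ℕ) :
    {I : Ideal (𝓞 F) | Ideal.absNorm I = n}.Finite := Ideal.finite_setOfPred_absNorm_eq n

theorem zeta_spec (F : Type*) [Field F] [NumberField F] : ∃ R : ℝ → ℝ,
    Tendsto (fun s => (s - 1) * R s) (𝓝[>] 1) (𝓝 (dedekindZeta_residue F)) ∧
    ∀ᶠ s in 𝓝[>] (1 : ℝ),
      (∀ J : Finset (Ideal (𝓞 F)), (∀ I ∈ J, I ≠ ⊥) →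
        ∑ I ∈ J, (Ideal.absNorm I : ℝ) ^ (-s) ≤ R s) ∧
      (∀ X : ℝ, (∀ J : Finset (Ideal (𝓞 F)), (∀ I ∈ J, I ≠ ⊥) →
        ∑ I ∈ J, (Ideal.absNorm I : ℝ) ^ (-s) ≤ X) → R s ≤ X) := by
  classical
  let c : ℕ → ℕ := fun n => Nat.card {I : Ideal (𝓞 F) // Ideal.absNorm I = n}
  let T : ℝ → ℕ → ℝ := fun s n => if n = 0 then 0 else (c n : ℝ) * (n : ℝ) ^ (-s)
  have hterm : ∀ (s : ℝ) (n : ℕ), LSeries.term (fun n => (c n : ℂ)) s n = (T s n : ℂ) := by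
    intro s n
    rw [LSeries.term_def]
    simp only [T]
    split_ifs with h
    · simp
    · rw [Complex.ofReal_mul, Complex.ofReal_cpow (Nat.cast_nonneg n), div_eq_mul_inv,
        Complex.ofReal_neg, Complex.cpow_neg]
      simp
  have hz : ∀ s : ℝ, dedekindZeta F s = ((∑' n, T s n : ℝ) : ℂ) := by
    intro s
    rw [dedekindZeta, LSeries, Complex.ofReal_tsum]
    exact tsum_congr (hterm s)
  have hlim := tendsto_sub_one_mul_dedekindZeta_nhdsGT F
  have hlim' : Tendsto (fun s : ℝ => (s - 1) * ∑' n, T s n) (𝓝[>] 1) (𝓝 (dedekindZeta_residue F)) := by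
    have := (Complex.continuous_re.tendsto _).comp hlim
    refine this.congr fun s => ?_
    simp only [Function.comp]
    rw [hz s, ← Complex.ofReal_one, ← Complex.ofReal_sub, ← Complex.ofReal_mul, Complex.ofReal_re]
  refine ⟨fun s => ∑' n, T s n, hlim', ?_⟩
  have hne := hlim'.eventually_ne (dedekindZeta_residue_ne_zero F)
  filter_upwards [hne] with s hs
  have hsum : Summable (T s) := by
    by_contra h
    rw [tsum_eq_zero_of_not_summable h, mul_zero] at hs
    exact hs rfl
  have hT0 : ∀ n, 0 ≤ T s n := by
    intro n; simp only [T]; split_ifs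
    · exact le_rfl
    · positivity
  constructor
  · intro J hJ
    have h1 : ∑ I ∈ J, (Ideal.absNorm I : ℝ) ^ (-s) ≤
        ∑ n ∈ J.image (fun I => Ideal.absNorm I), T s n := by
      rw [← Finset.sum_fiberwise_of_maps_to (g := fun I => Ideal.absNorm I)
        (t := J.image (fun I => Ideal.absNorm I)) (fun I hI => Finset.mem_image_of_mem _ hI)]
      refine Finset.sum_le_sum fun n hn => ?_
      have hn0 : n ≠ 0 := by
        obtain ⟨I, hI, rfl⟩ := Finset.mem_image.1 hn
        rw [Ne, Ideal.absNorm_eq_zero_iff]; exact hJ I hI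
      simp only [T, if_neg hn0]
      rw [Finset.sum_congr rfl (g := fun _ => (n : ℝ) ^ (-s)) (by
        intro I hI; rw [(Finset.mem_filter.1 hI).2]), Finset.sum_const, nsmul_eq_mul]
      refine mul_le_mul_of_nonneg_right ?_ (by positivity)
      norm_cast
      have : c n = ((card_fin_ideal F n).toFinset).card := by
        rw [← Nat.card_eq_card_finite_toFinset (card_fin_ideal F n)]; rfl
      rw [this]
      refine Finset.card_le_card fun I hI => ?_
      rw [Set.Finite.mem_toFinset]
      exact (Finset.mem_filter.1 hI).2
    exact h1.trans (hsum.sum_le_tsum _ (fun n _ => hT0 n))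
  · intro X hX
    refine hsum.tsum_le_of_sum_le fun M => ?_
    let J : Finset (Ideal (𝓞 F)) := (M.filter (· ≠ 0)).biUnion fun n => (card_fin_ideal F n).toFinset
    have hJ : ∀ I ∈ J, Ideal.absNorm I ∈ M.filter (· ≠ 0) := by
      intro I hI
      obtain ⟨n, hn, hI⟩ := Finset.mem_biUnion.1 hI
      rw [Set.Finite.mem_toFinset] at hI
      have hI' : Ideal.absNorm I = n := hI
      rwa [hI']
    refine le_trans (le_of_eq ?_) (hX J ?_)
    · rw [← Finset.sum_fiberwise_of_maps_to hJ, Finset.sum_filter]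
      refine Finset.sum_congr rfl fun n hn => ?_
      by_cases hn0 : n = 0
      · simp [T, hn0]
      · simp only [T, if_neg hn0, ne_eq, hn0, not_false_eq_true, if_true]
        rw [Finset.sum_congr rfl (g := fun _ => (n : ℝ) ^ (-s)) (by
          intro I hI; rw [(Finset.mem_filter.1 hI).2]), Finset.sum_const, nsmul_eq_mul]
        congr 2
        have : c n = ((card_fin_ideal F n).toFinset).card := by
          rw [← Nat.card_eq_card_finite_toFinset (card_fin_ideal F n)]; rfl
        rw [this]
        congr 1
        ext I
        rw [Set.Finite.mem_toFinset, Finset.mem_filter]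
        constructor
        · intro h
          have h' : Ideal.absNorm I = n := h
          refine ⟨Finset.mem_biUnion.2 ⟨n, Finset.mem_filter.2 ⟨hn, hn0⟩, ?_⟩, h'⟩
          rw [Set.Finite.mem_toFinset]; exact h
        · intro h; exact h.2
    · intro I hI h0
      have := (Finset.mem_filter.1 (hJ I hI)).2
      rw [h0] at this
      simp at this

end An

end NU

namespace NU

open NumberField IsDedekindDomain Filter Topology

section Euler

variable {F : Type*} [Field F] [NumberField F]

/-- norm of a prime -/
noncomputable abbrev nm (y : HeightOneSpectrum (𝓞 F)) : ℕ := Ideal.absNorm y.asIdeal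

theorem nm_pp (y : HeightOneSpectrum (𝓞 F)) : ∃ p k : ℕ, p.Prime ∧ k ≠ 0 ∧ nm y = p ^ k := by
  haveI := y.isMaximal
  letI : Field (𝓞 F ⧸ y.asIdeal) := Ideal.Quotient.field y.asIdeal
  haveI : Finite (𝓞 F ⧸ y.asIdeal) := Ideal.finiteQuotientOfFreeOfNeBot y.asIdeal y.ne_bot
  haveI := Fintype.ofFinite (𝓞 F ⧸ y.asIdeal)
  obtain ⟨p, hp⟩ := CharP.exists (𝓞 F ⧸ y.asIdeal)
  obtain ⟨n, hp, hc⟩ := FiniteField.card (𝓞 F ⧸ y.asIdeal) p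
  refine ⟨p, n, hp, n.ne_zero, ?_⟩
  rw [← hc, ← Nat.card_eq_fintype_card]
  rfl

/-- residue characteristic -/
noncomputable def rc (y : HeightOneSpectrum (𝓞 F)) : ℕ := (nm y).minFac

theorem rc_eq (y : HeightOneSpectrum (𝓞 F)) : (rc y).Prime ∧ ∃ k : ℕ, k ≠ 0 ∧ nm y = rc y ^ k := by
  obtain ⟨p, k, hp, hk, h⟩ := nm_pp y
  have : rc y = p := by rw [rc, h, Nat.Prime.pow_minFac hp hk]
  rw [this]; exact ⟨hp, k, hk, h⟩

theorem rc_mem (y : HeightOneSpectrum (𝓞 F)) : ((rc y : ℕ) : 𝓞 F) ∈ y.asIdeal := by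
  obtain ⟨-, k, hk, h⟩ := rc_eq y
  have h1 := Ideal.absNorm_mem y.asIdeal
  change ((nm y : ℕ) : 𝓞 F) ∈ y.asIdeal at h1
  rw [h, Nat.cast_pow] at h1
  exact y.isPrime.mem_of_pow_mem _ h1

theorem nm_eq_rc {y : HeightOneSpectrum (𝓞 F)} (h : (nm y).Prime) : rc y = nm y := by
  rw [rc, Nat.Prime.minFac_eq h]

theorem rc_sq_le {y : HeightOneSpectrum (𝓞 F)} (h : ¬ (nm y).Prime) : rc y ^ 2 ≤ nm y := by
  obtain ⟨hp, k, hk, h1⟩ := rc_eq y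
  have : k ≠ 1 := by rintro rfl; rw [pow_one] at h1; rw [h1] at h; exact h hp
  rw [h1]
  exact Nat.pow_le_pow_right hp.pos (by omega)

theorem card_le_of_rc (S : Finset (HeightOneSpectrum (𝓞 F))) {p : ℕ} (hp : p.Prime)
    (hS : ∀ y ∈ S, (p : 𝓞 F) ∈ y.asIdeal) : S.card ≤ Module.finrank ℚ F := by
  classical
  have h1 : ∏ y ∈ S, y.asIdeal ∣ Ideal.span {(p : 𝓞 F)} := by
    have : ∏ y ∈ S, y.asIdeal = ∏ I ∈ S.image (fun y => y.asIdeal), I := by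
      rw [Finset.prod_image]
      intro a _ b _ h; exact HeightOneSpectrum.ext h
    rw [this]
    refine Finset.prod_primes_dvd _ ?_ ?_
    · intro I hI
      obtain ⟨y, hy, rfl⟩ := Finset.mem_image.1 hI
      exact y.prime
    · intro I hI
      obtain ⟨y, hy, rfl⟩ := Finset.mem_image.1 hI
      rw [Ideal.dvd_span_singleton]; exact hS y hy
  have h2 := map_dvd Ideal.absNorm h1
  rw [Ideal.absNorm_span_natCast, map_prod, RingOfIntegers.rank] at h2
  have h3 : ∀ y ∈ S, p ≤ Ideal.absNorm y.asIdeal := by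
    intro y hy
    have h4 : Ideal.absNorm y.asIdeal ∣ p ^ (Module.finrank ℚ F) := by
      have := map_dvd Ideal.absNorm ((Ideal.dvd_span_singleton).2 (hS y hy))
      rwa [Ideal.absNorm_span_natCast, RingOfIntegers.rank] at this
    obtain ⟨k, -, hk⟩ := (Nat.dvd_prime_pow hp).1 h4
    have hk0 : k ≠ 0 := by
      rintro rfl
      rw [pow_zero, Ideal.absNorm_eq_one_iff] at hk
      exact y.isPrime.ne_top hk
    rw [hk]
    exact Nat.le_self_pow hk0 p
  have h5 : p ^ S.card ≤ p ^ (Module.finrank ℚ F) := by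
    refine le_trans ?_ (Nat.le_of_dvd (pow_pos hp.pos _) h2)
    rw [← Finset.prod_const]
    exact Finset.prod_le_prod' h3
  exact (Nat.pow_le_pow_iff_right hp.one_lt).1 h5

theorem finite_nm (F : Type*) [Field F] [NumberField F] (p : ℕ) :
    {y : HeightOneSpectrum (𝓞 F) | nm y = p}.Finite := by
  refine Set.Finite.of_finite_image (f := fun y => y.asIdeal) ((card_fin_ideal F p).subset ?_) ?_
  · rintro _ ⟨y, hy, rfl⟩; exact hy
  · intro a _ b _ h; exact HeightOneSpectrum.ext h

/-- primes of norm p -/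
noncomputable def pn (F : Type*) [Field F] [NumberField F] (p : ℕ) : Finset (HeightOneSpectrum (𝓞 F)) :=
  (finite_nm F p).toFinset

theorem mem_pn {p : ℕ} {y : HeightOneSpectrum (𝓞 F)} : y ∈ pn F p ↔ nm y = p := by
  rw [pn, Set.Finite.mem_toFinset]; rfl

theorem pn_card_le {p : ℕ} (hp : p.Prime) : (pn F p).card ≤ Module.finrank ℚ F := by
  refine card_le_of_rc _ hp fun y hy => ?_
  rw [mem_pn] at hy
  have := Ideal.absNorm_mem y.asIdeal
  change ((nm y : ℕ) : 𝓞 F) ∈ y.asIdeal at this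
  rwa [hy] at this

theorem nm_pos (y : HeightOneSpectrum (𝓞 F)) : 1 < nm y := by
  obtain ⟨p, k, hp, hk, h⟩ := nm_pp y
  rw [h]; exact Nat.one_lt_pow hk hp.one_lt

theorem nm_rpow_lt (y : HeightOneSpectrum (𝓞 F)) {s : ℝ} (hs : 0 < s) :
    0 < (nm y : ℝ) ^ (-s) ∧ (nm y : ℝ) ^ (-s) < 1 := by
  have h1 : (1 : ℝ) < nm y := by exact_mod_cast nm_pos y
  exact ⟨by positivity, Real.rpow_lt_one_of_one_lt_of_neg h1 (by linarith)⟩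

theorem euler_le (J : Finset (Ideal (𝓞 F))) (hJ : ∀ I ∈ J, I ≠ ⊥) {s : ℝ} (hs : 0 < s) :
    ∃ S : Finset (HeightOneSpectrum (𝓞 F)),
      ∑ I ∈ J, (Ideal.absNorm I : ℝ) ^ (-s) ≤ ∏ y ∈ S, (1 - (nm y : ℝ) ^ (-s))⁻¹ := by
  classical
  let e : Ideal (𝓞 F) → HeightOneSpectrum (𝓞 F) → ℕ := fun I y =>
    (Associates.mk y.asIdeal).count (Associates.mk I).factors
  have hfin : ∀ I : Ideal (𝓞 F), ∃ S : Finset (HeightOneSpectrum (𝓞 F)), I ∈ J →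
      ∀ S', S ⊆ S' → I = ∏ y ∈ S', y.asIdeal ^ e I y := by
    intro I
    by_cases hI : I ∈ J
    · have hf := Ideal.hasFiniteMulSupport (hJ I hI)
      refine ⟨Set.Finite.toFinset hf, fun _ S' hS' => ?_⟩
      conv_lhs => rw [← Ideal.finprod_heightOneSpectrum_factorization (hJ I hI)]
      rw [finprod_eq_prod_of_mulSupport_subset (s := S')]
      · rfl
      · intro y hy
        exact hS' ((Set.Finite.mem_toFinset hf).2 hy)
    · exact ⟨∅, fun h => absurd h hI⟩
  choose S0 hS0 using hfin
  let S := J.biUnion S0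
  have hprod : ∀ I ∈ J, I = ∏ y ∈ S, y.asIdeal ^ e I y := fun I hI =>
    hS0 I hI S (Finset.subset_biUnion_of_mem _ hI)
  let k := (J ×ˢ S).sup fun x => e x.1 x.2
  have hk : ∀ I ∈ J, ∀ y ∈ S, e I y ≤ k := fun I hI y hy =>
    Finset.le_sup (f := fun x : Ideal (𝓞 F) × HeightOneSpectrum (𝓞 F) => e x.1 x.2)
      (b := (I, y)) (Finset.mem_product.2 ⟨hI, hy⟩)
  refine ⟨S, ?_⟩
  let x : HeightOneSpectrum (𝓞 F) → ℝ := fun y => (nm y : ℝ) ^ (-s)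
  have hx0 : ∀ y, 0 < x y := fun y => (nm_rpow_lt y hs).1
  have hx1 : ∀ y, x y < 1 := fun y => (nm_rpow_lt y hs).2
  have hterm : ∀ I ∈ J, (Ideal.absNorm I : ℝ) ^ (-s) = ∏ y : S, x y ^ e I y := by
    intro I hI
    conv_lhs => rw [hprod I hI]
    rw [map_prod, Nat.cast_prod, ← Real.finsetProd_rpow _ _ (fun _ _ => Nat.cast_nonneg _),
      ← Finset.prod_coe_sort]
    refine Finset.prod_congr rfl fun y _ => ?_
    rw [map_pow, Nat.cast_pow, ← Real.rpow_natCast, ← Real.rpow_natCast,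
      ← Real.rpow_mul (Nat.cast_nonneg _), ← Real.rpow_mul (Nat.cast_nonneg _), mul_comm]
  have hinj : Set.InjOn (fun I (y : S) => e I y) (J : Set (Ideal (𝓞 F))) := by
    intro I hI I' hI' h
    rw [hprod I hI, hprod I' hI']
    refine Finset.prod_congr rfl fun y hy => ?_
    have h2 : e I y = e I' y := congrFun h ⟨y, hy⟩
    rw [h2]
  calc ∑ I ∈ J, (Ideal.absNorm I : ℝ) ^ (-s)
      = ∑ I ∈ J, ∏ y : S, x y ^ ((fun I (y : S) => e I y) I y) := Finset.sum_congr rfl hterm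
    _ = ∑ f ∈ J.image (fun I (y : S) => e I y), ∏ y : S, x y ^ f y := by
        rw [Finset.sum_image hinj]
    _ ≤ ∑ f ∈ Fintype.piFinset (fun _ : S => Finset.range (k + 1)), ∏ y : S, x y ^ f y := by
        refine Finset.sum_le_sum_of_subset_of_nonneg ?_ (fun f _ _ =>
          Finset.prod_nonneg fun y _ => pow_nonneg (hx0 _).le _)
        intro f hf
        obtain ⟨I, hI, rfl⟩ := Finset.mem_image.1 hf
        rw [Fintype.mem_piFinset]
        intro y
        rw [Finset.mem_range]
        have := hk I hI y y.2
        omega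
    _ = ∏ y : S, ∑ j ∈ Finset.range (k + 1), x y ^ j := by rw [Finset.prod_univ_sum]
    _ ≤ ∏ y : S, (1 - x y)⁻¹ := by
        refine Finset.prod_le_prod (fun y _ => Finset.sum_nonneg fun j _ => pow_nonneg (hx0 _).le _) ?_
        intro y _
        rw [← tsum_geometric_of_lt_one (hx0 y).le (hx1 y)]
        exact (summable_geometric_of_lt_one (hx0 y).le (hx1 y)).sum_le_tsum _
          (fun j _ => pow_nonneg (hx0 _).le _)
    _ = ∏ y ∈ S, (1 - (nm y : ℝ) ^ (-s))⁻¹ := Finset.prod_coe_sort S (fun y => (1 - x y)⁻¹)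

theorem euler_ge (T : Finset (HeightOneSpectrum (𝓞 F))) (s : ℝ) :
    ∃ J : Finset (Ideal (𝓞 F)), (∀ I ∈ J, I ≠ ⊥) ∧
      ∏ y ∈ T, (1 + (nm y : ℝ) ^ (-s)) = ∑ I ∈ J, (Ideal.absNorm I : ℝ) ^ (-s) := by
  classical
  refine ⟨T.powerset.image fun t => ∏ y ∈ t, y.asIdeal, ?_, ?_⟩
  · intro I hI
    obtain ⟨t, -, rfl⟩ := Finset.mem_image.1 hI
    exact Finset.prod_ne_zero_iff.2 fun y _ => y.ne_bot
  · rw [Finset.sum_image, Finset.prod_one_add]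
    · refine Finset.sum_congr rfl fun t _ => ?_
      rw [map_prod, Nat.cast_prod, ← Real.finsetProd_rpow _ _ (fun _ _ => Nat.cast_nonneg _)]
    · intro t _ t' _ h
      have key : ∀ t : Finset (HeightOneSpectrum (𝓞 F)), ∀ y, y ∈ t ↔ y.asIdeal ∣ ∏ z ∈ t, z.asIdeal := by
        intro t y
        constructor
        · intro hy; exact Finset.dvd_prod_of_mem (fun z : HeightOneSpectrum (𝓞 F) => z.asIdeal) hy
        · intro hy
          obtain ⟨z, hz, hd⟩ := (Prime.dvd_finsetProd_iff y.prime _).1 hy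
          have h1 : z.asIdeal ≤ y.asIdeal := Ideal.dvd_iff_le.1 hd
          have h2 := z.isMaximal.eq_of_le y.isPrime.ne_top h1
          rwa [← HeightOneSpectrum.ext h2]
      ext y
      simp only at h
      rw [key, key, h]

theorem prod_sq_ge (T : Finset ℕ) (hT : ∀ n ∈ T, 2 ≤ n) :
    ∏ n ∈ T, (1 - ((n : ℝ) ^ 2)⁻¹)⁻¹ ≤ 2 := by
  have hT' : T ⊆ Finset.Ico 2 (T.sup id + 2) := fun n hn =>
    Finset.mem_Ico.2 ⟨hT n hn, by have := Finset.le_sup (f := id) hn; simp at this; omega⟩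
  generalize T.sup id = M at hT'
  have hpos : ∀ n : ℕ, 2 ≤ n → 0 < 1 - ((n : ℝ) ^ 2)⁻¹ := by
    intro n hn
    have : (2 : ℝ) ≤ n := by exact_mod_cast hn
    have : ((n : ℝ) ^ 2)⁻¹ < 1 := inv_lt_one_of_one_lt₀ (by nlinarith)
    linarith
  have h1 : ∀ M : ℕ, ∏ n ∈ Finset.Ico 2 (M + 2), (1 - ((n : ℝ) ^ 2)⁻¹) = (M + 2) / (2 * (M + 1)) := by
    intro M
    induction M with
    | zero => norm_num
    | succ M ih =>
      rw [show M + 1 + 2 = (M + 2) + 1 by ring, Finset.prod_Ico_succ_top (by omega), ih]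
      push_cast
      have : (M : ℝ) + 1 ≠ 0 := by positivity
      have : (M : ℝ) + 2 ≠ 0 := by positivity
      have : (M : ℝ) + 1 + 1 ≠ 0 := by positivity
      field_simp
      ring
  have h2 : (1 : ℝ) / 2 ≤ ∏ n ∈ T, (1 - ((n : ℝ) ^ 2)⁻¹) := by
    have h3 : ∏ n ∈ Finset.Ico 2 (M + 2), (1 - ((n : ℝ) ^ 2)⁻¹) ≤ ∏ n ∈ T, (1 - ((n : ℝ) ^ 2)⁻¹) := by
      rw [← Finset.prod_sdiff hT']
      refine mul_le_of_le_one_left (Finset.prod_nonneg fun n hn => (hpos n (hT n hn)).le) ?_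
      refine Finset.prod_le_one (fun n hn => ?_) (fun n hn => ?_)
      · exact (hpos n (Finset.mem_Ico.1 (Finset.mem_sdiff.1 hn).1).1).le
      · have : 0 ≤ ((n : ℝ) ^ 2)⁻¹ := by positivity
        linarith
    refine le_trans ?_ h3
    rw [h1, div_le_div_iff₀ (by positivity) (by positivity)]
    nlinarith
  rw [Finset.prod_inv_distrib]
  have := inv_anti₀ (by norm_num) h2
  simpa using this

theorem factor_bound (y : HeightOneSpectrum (𝓞 F)) {s : ℝ} (hs : 1 ≤ s) :
    (1 - (nm y : ℝ) ^ (-s))⁻¹ ≤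
      (if (nm y).Prime then 1 + (nm y : ℝ) ^ (-s) else 1) * (1 - ((rc y : ℝ) ^ 2)⁻¹)⁻¹ := by
  obtain ⟨hx0, hx1⟩ := nm_rpow_lt y (s := s) (by linarith)
  have hn : (1 : ℝ) < nm y := by exact_mod_cast nm_pos y
  have hx : (nm y : ℝ) ^ (-s) ≤ (nm y : ℝ)⁻¹ := by
    rw [← Real.rpow_neg_one]
    exact Real.rpow_le_rpow_of_exponent_le hn.le (by linarith)
  have hr2 : (2 : ℝ) ≤ rc y := by exact_mod_cast (rc_eq y).1.two_le
  have hrpos : 0 < 1 - ((rc y : ℝ) ^ 2)⁻¹ := by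
    have : ((rc y : ℝ) ^ 2)⁻¹ < 1 := inv_lt_one_of_one_lt₀ (by nlinarith)
    linarith
  generalize (nm y : ℝ) ^ (-s) = x at *
  split_ifs with h
  · have h1 : (1 - x)⁻¹ = (1 + x) * (1 - x ^ 2)⁻¹ := by
      have : 1 - x ≠ 0 := by linarith
      have : 1 - x ^ 2 ≠ 0 := by nlinarith
      field_simp; ring
    rw [h1]
    refine mul_le_mul_of_nonneg_left ?_ (by linarith)
    apply inv_anti₀ hrpos
    rw [nm_eq_rc h, ← inv_pow]
    have : x ^ 2 ≤ ((nm y : ℝ)⁻¹) ^ 2 := pow_le_pow_left₀ hx0.le hx 2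
    linarith
  · rw [one_mul]
    apply inv_anti₀ hrpos
    have h1 : (rc y : ℝ) ^ 2 ≤ nm y := by exact_mod_cast rc_sq_le h
    have h2 : (nm y : ℝ)⁻¹ ≤ ((rc y : ℝ) ^ 2)⁻¹ := inv_anti₀ (by positivity) h1
    linarith

theorem prod_rc_le (S : Finset (HeightOneSpectrum (𝓞 F))) :
    ∏ y ∈ S, (1 - ((rc y : ℝ) ^ 2)⁻¹)⁻¹ ≤ 2 ^ (Module.finrank ℚ F) := by
  classical
  have hge : ∀ n : ℕ, 2 ≤ n → 1 ≤ (1 - ((n : ℝ) ^ 2)⁻¹)⁻¹ := by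
    intro n hn
    have h2 : (2 : ℝ) ≤ n := by exact_mod_cast hn
    have h3 : ((n : ℝ) ^ 2)⁻¹ < 1 := inv_lt_one_of_one_lt₀ (by nlinarith)
    have h4 : 0 ≤ ((n : ℝ) ^ 2)⁻¹ := by positivity
    exact (one_le_inv₀ (by linarith)).2 (by linarith)
  have hT : ∀ n ∈ S.image (fun y => rc y), n.Prime := by
    intro n hn
    obtain ⟨y, hy, rfl⟩ := Finset.mem_image.1 hn
    exact (rc_eq y).1
  rw [← Finset.prod_fiberwise_of_maps_to (g := fun y => rc y)
        (t := S.image (fun y => rc y)) (fun I hI => Finset.mem_image_of_mem _ hI)]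
  calc _ ≤ ∏ n ∈ S.image (fun y => rc y), ((1 - ((n : ℝ) ^ 2)⁻¹)⁻¹) ^ (Module.finrank ℚ F) := by
        refine Finset.prod_le_prod (fun n hn => Finset.prod_nonneg fun y hy => ?_) (fun n hn => ?_)
        · exact zero_le_one.trans (hge _ (rc_eq y).1.two_le)
        · rw [Finset.prod_congr rfl (g := fun _ => (1 - ((n : ℝ) ^ 2)⁻¹)⁻¹) (by
            intro y hy; rw [(Finset.mem_filter.1 hy).2]), Finset.prod_const]
          refine pow_le_pow_right₀ (hge n (hT n hn).two_le) ?_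
          refine card_le_of_rc _ (hT n hn) fun y hy => ?_
          have := rc_mem y
          rwa [(Finset.mem_filter.1 hy).2] at this
    _ = (∏ n ∈ S.image (fun y => rc y), (1 - ((n : ℝ) ^ 2)⁻¹)⁻¹) ^ (Module.finrank ℚ F) := by
        rw [Finset.prod_pow]
    _ ≤ _ := by
        refine pow_le_pow_left₀ (Finset.prod_nonneg fun n hn => zero_le_one.trans (hge _ (hT n hn).two_le)) ?_ _
        exact prod_sq_ge _ fun n hn => (hT n hn).two_le

/-- the comparison theorem -/
theorem an1 (F F' : Type*) [Field F] [NumberField F] [Field F'] [NumberField F'] (Bad : Finset ℕ)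
    (h : ∀ p : ℕ, p.Prime → p ∉ Bad → 2 * (pn F p).card ≤ (pn F' p).card) : False := by
  classical
  obtain ⟨R, hR, hR2⟩ := zeta_spec F
  obtain ⟨R', hR', hR2'⟩ := zeta_spec F'
  set d := Module.finrank ℚ F with hd
  set C : ℝ := 2 ^ d * (2 ^ d) ^ Bad.card with hC
  have hC0 : 0 < C := by positivity
  have hkey : ∀ᶠ s in 𝓝[>] (1 : ℝ), R s ^ 2 ≤ C ^ 2 * R' s := by
    filter_upwards [hR2, hR2', self_mem_nhdsWithin] with s h1 h1' hs
    have hs : 1 < s := hs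
    have hR0 : 0 ≤ R s := by simpa using h1.1 ∅ (by simp)
    have hR0' : 0 ≤ R' s := by simpa using h1'.1 ∅ (by simp)
    have hb : R s ≤ C * Real.sqrt (R' s) := by
      refine h1.2 _ fun J hJ => ?_
      obtain ⟨S, hS⟩ := euler_le J hJ (s := s) (by linarith)
      refine hS.trans ?_
      have hp1 : ∀ n : ℕ, 1 ≤ 1 + (n : ℝ) ^ (-s) := fun n => by
        have : 0 ≤ (n : ℝ) ^ (-s) := by positivity
        linarith
      have hs1 : ∏ y ∈ S, (1 - (nm y : ℝ) ^ (-s))⁻¹ ≤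
          (∏ y ∈ S, if (nm y).Prime then 1 + (nm y : ℝ) ^ (-s) else 1) * 2 ^ d := by
        refine (Finset.prod_le_prod (fun y _ => ?_) (fun y _ => factor_bound y hs.le)).trans ?_
        · have := (nm_rpow_lt y (s := s) (by linarith)).2
          exact inv_nonneg.2 (by linarith)
        · rw [Finset.prod_mul_distrib]
          refine mul_le_mul_of_nonneg_left (prod_rc_le S) ?_
          refine Finset.prod_nonneg fun y _ => ?_
          split_ifs
          · exact zero_le_one.trans (hp1 _)
          · exact zero_le_one
      let S1 := S.filter fun y => (nm y).Prime
      let T := S1.image fun y => nm y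
      have hT : ∀ n ∈ T, n.Prime := by
        intro n hn
        obtain ⟨y, hy, rfl⟩ := Finset.mem_image.1 hn
        exact (Finset.mem_filter.1 hy).2
      have hs2 : (∏ y ∈ S, if (nm y).Prime then 1 + (nm y : ℝ) ^ (-s) else 1) ≤
          ∏ n ∈ T, (1 + (n : ℝ) ^ (-s)) ^ (pn F n).card := by
        rw [← Finset.prod_filter, ← Finset.prod_fiberwise_of_maps_to (s := S1) (g := fun y => nm y)
          (t := T) (fun I hI => Finset.mem_image_of_mem _ hI)]
        refine Finset.prod_le_prod (fun n hn => Finset.prod_nonneg fun y hy => ?_) (fun n hn => ?_)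
        · exact zero_le_one.trans (hp1 _)
        · rw [Finset.prod_congr rfl (g := fun _ => (1 + (n : ℝ) ^ (-s))) (by
            intro y hy; rw [(Finset.mem_filter.1 hy).2]), Finset.prod_const]
          refine pow_le_pow_right₀ (hp1 n) (Finset.card_le_card fun y hy => ?_)
          exact mem_pn.2 (Finset.mem_filter.1 hy).2
      have hs3 : ∏ n ∈ T, (1 + (n : ℝ) ^ (-s)) ^ (pn F n).card ≤
          (2 ^ d) ^ Bad.card * ∏ n ∈ T \ Bad, (1 + (n : ℝ) ^ (-s)) ^ (pn F n).card := by
        rw [← Finset.prod_inter_mul_prod_sdiff T Bad]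
        refine mul_le_mul_of_nonneg_right ?_ (Finset.prod_nonneg fun n _ =>
          pow_nonneg (zero_le_one.trans (hp1 _)) _)
        calc _ ≤ ∏ n ∈ T ∩ Bad, (2 : ℝ) ^ d := by
              refine Finset.prod_le_prod (fun n _ => pow_nonneg (zero_le_one.trans (hp1 _)) _) ?_
              intro n hn
              have hnp := hT n (Finset.mem_inter.1 hn).1
              have h2 : 1 + (n : ℝ) ^ (-s) ≤ 2 := by
                have : (n : ℝ) ^ (-s) ≤ 1 := Real.rpow_le_one_of_one_le_of_nonpos
                  (by exact_mod_cast hnp.one_lt.le) (by linarith)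
                linarith
              calc _ ≤ (2 : ℝ) ^ (pn F n).card := pow_le_pow_left₀ (zero_le_one.trans (hp1 _)) h2 _
                _ ≤ _ := pow_le_pow_right₀ (by norm_num) (pn_card_le hnp)
          _ = ((2 : ℝ) ^ d) ^ (T ∩ Bad).card := by rw [Finset.prod_const]
          _ ≤ _ := pow_le_pow_right₀ (one_le_pow₀ (by norm_num))
              (Finset.card_le_card Finset.inter_subset_right)
      set Q : ℝ := ∏ n ∈ T \ Bad, (1 + (n : ℝ) ^ (-s)) ^ (pn F n).card with hQ
      have hQ0 : 0 ≤ Q := Finset.prod_nonneg fun n _ => pow_nonneg (zero_le_one.trans (hp1 _)) _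
      have hQ2 : Q ^ 2 ≤ R' s := by
        let T' := (T \ Bad).biUnion fun n => pn F' n
        have hT' : ∀ y ∈ T', nm y ∈ T \ Bad := by
          intro y hy
          obtain ⟨n, hn, hy⟩ := Finset.mem_biUnion.1 hy
          rwa [mem_pn.1 hy]
        have e1 : ∏ y ∈ T', (1 + (nm y : ℝ) ^ (-s)) =
            ∏ n ∈ T \ Bad, (1 + (n : ℝ) ^ (-s)) ^ (pn F' n).card := by
          rw [← Finset.prod_fiberwise_of_maps_to hT']
          refine Finset.prod_congr rfl fun n hn => ?_
          rw [Finset.prod_congr rfl (g := fun _ => (1 + (n : ℝ) ^ (-s))) (by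
            intro y hy; rw [(Finset.mem_filter.1 hy).2]), Finset.prod_const]
          congr 2
          ext y
          rw [Finset.mem_filter, mem_pn]
          refine ⟨fun h => h.2, fun h => ⟨Finset.mem_biUnion.2 ⟨n, hn, mem_pn.2 h⟩, h⟩⟩
        obtain ⟨J', hJ', hJe⟩ := euler_ge T' s
        have e2 := h1'.1 J' hJ'
        rw [← hJe, e1] at e2
        refine le_trans ?_ e2
        rw [hQ, ← Finset.prod_pow]
        refine Finset.prod_le_prod (fun n _ => by positivity) fun n hn => ?_
        rw [← pow_mul, mul_comm]
        refine pow_le_pow_right₀ (hp1 n) (h n (hT n (Finset.mem_sdiff.1 hn).1) (Finset.mem_sdiff.1 hn).2)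
      have hQ3 : Q ≤ Real.sqrt (R' s) := Real.le_sqrt_of_sq_le hQ2
      calc _ ≤ _ := hs1
        _ ≤ ((2 ^ d) ^ Bad.card * Q) * 2 ^ d :=
            mul_le_mul_of_nonneg_right (hs2.trans hs3) (by positivity)
        _ = C * Q := by rw [hC]; ring
        _ ≤ _ := mul_le_mul_of_nonneg_left hQ3 hC0.le
    calc R s ^ 2 ≤ (C * Real.sqrt (R' s)) ^ 2 := pow_le_pow_left₀ hR0 hb 2
      _ = C ^ 2 * R' s := by rw [mul_pow, Real.sq_sqrt hR0']
  have hL : Tendsto (fun s : ℝ => ((s - 1) * R s) ^ 2) (𝓝[>] 1) (𝓝 (dedekindZeta_residue F ^ 2)) :=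
    hR.pow 2
  have hs0 : Tendsto (fun s : ℝ => s - 1) (𝓝[>] 1) (𝓝 0) := by
    have : Tendsto (fun s : ℝ => s - 1) (𝓝 1) (𝓝 (1 - 1)) := (continuous_sub_right 1).tendsto 1
    rw [sub_self] at this
    exact this.mono_left nhdsWithin_le_nhds
  have hL' : Tendsto (fun s : ℝ => C ^ 2 * ((s - 1) * ((s - 1) * R' s))) (𝓝[>] 1) (𝓝 0) := by
    have := (hs0.mul hR').const_mul (C ^ 2)
    simpa using this
  have hle := le_of_tendsto_of_tendsto hL hL' (by
    filter_upwards [hkey] with s hs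
    calc ((s - 1) * R s) ^ 2 = (s - 1) ^ 2 * R s ^ 2 := by ring
      _ ≤ (s - 1) ^ 2 * (C ^ 2 * R' s) := mul_le_mul_of_nonneg_left hs (by positivity)
      _ = _ := by ring)
  have := dedekindZeta_residue_pos F
  nlinarith [pow_pos this 2]

theorem an2 (F : Type*) [Field F] [NumberField F] (Bad : Finset ℕ) :
    ∃ p : ℕ, p.Prime ∧ p ∉ Bad ∧ (pn F p).card ≠ 0 := by
  by_contra hc
  push Not at hc
  exact an1 F F Bad fun p hp hb => by rw [hc p hp hb]

end Euler

end NU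

namespace NU

open IntermediateField NumberField IsDedekindDomain

section ClaimC

variable {Ω : Type*} [Field Ω] [CharZero Ω] [Algebra.IsAlgebraic ℚ Ω] [IsAlgClosed Ω]
variable {p q : ℕ} {v w : AbsoluteValue Ω ℝ}
variable {A B U : Subgroup (Ω ≃ₐ[ℚ] Ω)}

theorem bad_diff {d : Ω} (hd : d ≠ 0) : ∃ n : ℕ, n ≠ 0 ∧ ∀ (p : ℕ) (v : AbsoluteValue Ω ℝ), IsPl p v →
    v d < 1 → p ∣ n := by
  have halg : IsAlgebraic ℤ (d⁻¹) :=
    (IsFractionRing.isAlgebraic_iff ℤ ℚ Ω).2 (Algebra.IsAlgebraic.isAlgebraic _)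
  obtain ⟨n, hn0, hn⟩ := halg.exists_integral_multiple
  refine ⟨n.natAbs, by simpa using hn0, fun p v hv hvd => ?_⟩
  rw [← hv.natCast_lt_iff]
  have h1 := hv.le_one_of_isIntegral hn
  rw [zsmul_eq_mul, map_mul, map_inv₀] at h1
  have h0 : 0 < v d := v.pos hd
  have h2 : v (n : Ω) ≤ v d := by
    rw [← div_eq_mul_inv, div_le_one h0] at h1; exact h1
  have h3 : v ((n.natAbs : ℕ) : Ω) = v (n : Ω) := by
    rcases Int.natAbs_eq n with h | h
    · conv_rhs => rw [h]
      simp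
    · conv_rhs => rw [h]
      simp
  rw [h3]; linarith

theorem residue_nat (E : IntermediateField ℚ Ω) [FiniteDimensional ℚ E] (hv : IsPl p v)
    (h : nm (hv.hos E) = p) (x : 𝓞 E) : ∃ n : ℤ, v (((x : E) : Ω) - n) < 1 := by
  have hc : Nat.card (𝓞 E ⧸ hv.pid E) = p := by
    refine Eq.trans ?_ h; rfl
  have : Fact p.Prime := ⟨hv.prime⟩
  have h1 : (1 : 𝓞 E ⧸ hv.pid E) ≠ 0 := by
    have := (hv.hos E).isPrime.ne_top
    have : Nontrivial (𝓞 E ⧸ hv.pid E) := Ideal.Quotient.nontrivial_iff.2 this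
    exact one_ne_zero
  obtain ⟨n, hn⟩ := mem_zmultiples_of_prime_card (p := p) hc h1 (g' := Ideal.Quotient.mk _ x)
  refine ⟨n, ?_⟩
  have h2 : x - (n : 𝓞 E) ∈ hv.pid E := by
    rw [← Ideal.Quotient.eq, ← hn]
    simp
  rw [hv.mem_pid E] at h2
  simpa using h2

theorem deg_one (Y : Subgroup (Ω ≃ₐ[ℚ] Ω)) (hY : Op Y) (E : IntermediateField ℚ Ω) [FiniteDimensional ℚ E]
    (hE : E = fixedField Y) : ∃ Bad : Finset ℕ, 2 ∈ Bad ∧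
    ∀ (p : ℕ) (v : AbsoluteValue Ω ℝ) (hv : IsPl p v), p ∉ Bad → nm (hv.hos E) = p → Dec v ≤ Y := by
  classical
  obtain ⟨α, hα⟩ := Field.exists_primitive_element ℚ E
  have halg : IsAlgebraic ℤ α :=
    (IsFractionRing.isAlgebraic_iff ℤ ℚ E).2 (Algebra.IsAlgebraic.isAlgebraic _)
  obtain ⟨n, hn0, hn⟩ := halg.exists_integral_multiple
  choose! N hN0 hN using fun (d : Ω) (hd : d ≠ 0) => bad_diff hd
  set β : Ω := ((n • α : E) : Ω) with hβ
  refine ⟨{2} ∪ ((minpoly ℚ β).rootSet_finite Ω).toFinset.biUnion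
    (fun b => (N (b - β)).primeFactors), by simp, fun p v hv hp hnm σ hσ => ?_⟩
  have hfix : σ β = β := by
    by_contra hne
    apply hp
    rw [Finset.mem_union]; right
    rw [Finset.mem_biUnion]
    have hd : σ β - β ≠ 0 := sub_ne_zero.2 hne
    refine ⟨σ β, ?_, ?_⟩
    · rw [Set.Finite.mem_toFinset, Polynomial.mem_rootSet]
      refine ⟨minpoly.ne_zero (Algebra.IsIntegral.isIntegral β), ?_⟩
      rw [Polynomial.aeval_algHom_apply, minpoly.aeval, map_zero]
    · rw [Nat.mem_primeFactors]
      refine ⟨hv.prime, hN _ hd p v hv ?_, hN0 _ hd⟩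
      obtain ⟨k, hk⟩ := residue_nat E hv hnm ⟨n • α, hn⟩
      have hk : v (β - k) < 1 := hk
      have h2 : v (σ β - k) < 1 := by
        have := (mem_Dec'.1 hσ (β - k))
        rw [map_sub, map_intCast] at this
        rwa [this]
      have := hv.sub_lt h2 hk
      simpa using this
  have hfix2 : σ (α : Ω) = α := by
    rw [hβ] at hfix
    have h3 : (n : Ω) * σ α = n * α := by
      simpa using hfix
    exact mul_left_cancel₀ (by exact_mod_cast hn0) h3
  rw [← fixing_fixed (Subgroup.isClosed_of_isOpen Y hY), ← hE, mem_fixing]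
  intro x hx
  have : (⟨x, hx⟩ : E) ∈ ℚ⟮α⟯ := by rw [hα]; trivial
  have key : ∀ y : E, y ∈ ℚ⟮α⟯ → σ (y : Ω) = y := by
    intro y hy
    induction hy using IntermediateField.adjoin_induction with
    | mem z hz => rw [Set.mem_singleton_iff.1 hz]; exact hfix2
    | algebraMap r => simp
    | add a b _ _ ha hb => simp [ha, hb]
    | inv a _ ha => simp [ha]
    | mul a b _ _ ha hb => simp [ha, hb]
  exact key _ this

end ClaimC

end NU

namespace NU

open IntermediateField NumberField IsDedekindDomain

section ClaimC2

variable {Ω : Type*} [Field Ω] [CharZero Ω] [Algebra.IsAlgebraic ℚ Ω] [IsAlgClosed Ω]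
variable {p q : ℕ} {v w : AbsoluteValue Ω ℝ}
variable {A B U : Subgroup (Ω ≃ₐ[ℚ] Ω)}

theorem rat_approx (hv : IsPl p v) (y : ℚ) (hy : v (y : Ω) ≤ 1) : ∃ n : ℤ, v ((y : Ω) - n) < 1 := by
  have hden : ¬ p ∣ y.den := by
    intro hd
    have h1 : v ((y.den : ℕ) : Ω) < 1 := (hv.natCast_lt_iff _).2 hd
    have h2 : ¬ p ∣ y.num.natAbs := fun h => hv.prime.one_lt.ne' (Nat.dvd_one.1 (by
      have := y.reduced
      rw [← Nat.Coprime.gcd_eq_one this]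
      exact Nat.dvd_gcd h hd))
    have h3 := hv.natCast_eq_one h2
    have h4 : v (y.num : Ω) = 1 := by
      rw [← h3]
      rcases Int.natAbs_eq y.num with h | h
      · conv_lhs => rw [h]
        simp
      · conv_lhs => rw [h]
        simp
    have h5 : (y.num : Ω) = y * y.den := by
      exact_mod_cast (Rat.mul_den_eq_num y).symm
    rw [h5, map_mul] at h4
    nlinarith [v.nonneg (y : Ω), v.nonneg ((y.den : ℕ) : Ω)]
  have hd1 := hv.natCast_eq_one hden
  have hcop : IsCoprime (y.den : ℤ) (p : ℤ) := by
    rw [Nat.isCoprime_iff_coprime]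
    exact ((Nat.Prime.coprime_iff_not_dvd hv.prime).2 hden).symm
  obtain ⟨a, b, hab⟩ := hcop
  refine ⟨a * y.num, ?_⟩
  have hden0 : (y.den : Ω) ≠ 0 := by exact_mod_cast y.den_ne_zero
  have h5 : (y.num : Ω) = y * y.den := by
    exact_mod_cast (Rat.mul_den_eq_num y).symm
  have hab' : (a : Ω) * y.den + b * p = 1 := by exact_mod_cast hab
  have h6 : (y : Ω) - ((a * y.num : ℤ) : Ω) = y * b * p := by
    push_cast
    rw [h5]
    linear_combination (-(y : Ω)) * hab'
  rw [h6, map_mul, map_mul]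
  have h7 := hv.intCast_le b
  have h8 := hv.vp_lt
  have h9 : v (y : Ω) * v (b : Ω) ≤ 1 := mul_le_one₀ hy (v.nonneg _) h7
  nlinarith [v.nonneg (p : Ω), mul_nonneg (v.nonneg (y : Ω)) (v.nonneg (b : Ω))]

theorem split_nm (E : IntermediateField ℚ Ω) [FiniteDimensional ℚ E]
    (hE : E = fixedField U) (hv : IsPl p v) (h : Dec v ≤ U) : nm (hv.hos E) = p := by
  have hp : Fact p.Prime := ⟨hv.prime⟩
  have hrc : rc (hv.hos E) = p := by
    refine hv.p_unique (rc_eq _).1 ?_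
    have := rc_mem (hv.hos E)
    have := (hv.mem_pid E).1 this
    simpa using this
  have hapx : ∀ x : 𝓞 E, ∃ n : ℤ, v (((x : E) : Ω) - n) < 1 := by
    intro x
    have hx : ((x : E) : Ω) ∈ DF v ⊥ := by
      rw [mem_fixedField']
      intro g hg
      have h1 : ((x : E) : Ω) ∈ fixedField U := hE ▸ (x : E).2
      exact (mem_fixedField'.1 h1) g (h hg.1)
    obtain ⟨y, hy, hxy⟩ := density hv ⊥ hx one_pos
    obtain ⟨r, rfl⟩ := mem_bot.1 hy
    have hx1 := hv.le_one_of_isIntegral (ringOfIntegers_isIntegral E x)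
    have hr : v ((r : ℚ) : Ω) ≤ 1 := by
      have := hv.sub_le hx1 hxy.le
      simpa using this
    obtain ⟨n, hn⟩ := rat_approx hv r hr
    refine ⟨n, ?_⟩
    have := hv.add_lt hxy hn
    simpa using this
  have hcast : ((p : ℕ) : 𝓞 E ⧸ hv.pid E) = 0 := by
    rw [← map_natCast (Ideal.Quotient.mk (hv.pid E)), Ideal.Quotient.eq_zero_iff_mem]
    exact hv.p_mem_pid E
  have hle : nm (hv.hos E) ≤ p := by
    have : Nat.card (𝓞 E ⧸ hv.pid E) ≤ Nat.card (ZMod p) := by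
      let f : ℤ →+ (𝓞 E ⧸ hv.pid E) := (Int.castRingHom _ : ℤ →+* (𝓞 E ⧸ hv.pid E)).toAddMonoidHom
      refine Nat.card_le_card_of_surjective (ZMod.lift p ⟨f, by simpa [f] using hcast⟩) ?_
      intro z
      obtain ⟨x, rfl⟩ := Ideal.Quotient.mk_surjective z
      obtain ⟨n, hn⟩ := hapx x
      refine ⟨(n : ZMod p), ?_⟩
      rw [ZMod.lift_coe]
      have : Ideal.Quotient.mk (hv.pid E) (n : 𝓞 E) = Ideal.Quotient.mk (hv.pid E) x := by
        rw [eq_comm, Ideal.Quotient.eq, hv.mem_pid E]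
        simpa using hn
      rw [← this]
      simp [f]
    rw [Nat.card_zmod] at this
    exact this
  obtain ⟨k, hk, hk2⟩ := (rc_eq (hv.hos E)).2
  rw [hrc] at hk2
  refine le_antisymm hle ?_
  calc p = p ^ 1 := (pow_one p).symm
    _ ≤ p ^ k := Nat.pow_le_pow_right hp.out.pos (Nat.one_le_iff_ne_zero.2 hk)
    _ = _ := hk2.symm

theorem split_card (hU : Op U) (hp : p.Prime) (E : IntermediateField ℚ Ω) [FiniteDimensional ℚ E]
    (hE : E = fixedField U) (h : Split U p) : U.index ≤ (pn E p).card := by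
  classical
  rw [← (nOrb_eq_iff hU hp).2 h, nOrb]
  have hf : (pn E p).card = Nat.card (pn E p) := by simp
  rw [hf]
  let φ : Quotient (orb U p) → pn E p := fun o =>
    ⟨(Quotient.out o).2.hos E, mem_pn.2 (split_nm E hE _ (h _ (Quotient.out o).2))⟩
  refine Nat.card_le_card_of_injective φ ?_
  intro o o' ho
  have h1 : (Quotient.out o).2.hos E = (Quotient.out o').2.hos E := congrArg Subtype.val ho
  have h2 : (Quotient.out o).2.pid E = (Quotient.out o').2.pid E := congrArg HeightOneSpectrum.asIdeal h1
  have h3 := (Quotient.out o).2.eq_of_pid_eq E (Quotient.out o').2 h2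
  rw [← Quotient.out_eq o, ← Quotient.out_eq o']
  refine Quotient.sound ?_
  rw [hE] at h3
  exact trans_H (Subgroup.isClosed_of_isOpen U hU) (Quotient.out o).2 (Quotient.out o').2 h3

theorem finrank_le (hU : Op U) : Module.finrank ℚ (fixedField U) ≤ U.index := by
  have h := IntermediateField.finrank_eq_fixingSubgroup_index (L := fixedField U)
  rw [fixing_fixed (Subgroup.isClosed_of_isOpen U hU)] at h
  exact le_of_eq h

theorem exists_place_of_pn (E : IntermediateField ℚ Ω) [FiniteDimensional ℚ E] (hp : p.Prime)
    (h : (pn E p).card ≠ 0) : ∃ (v : AbsoluteValue Ω ℝ) (hv : IsPl p v), nm (hv.hos E) = p := by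
  obtain ⟨y, hy⟩ := Finset.card_ne_zero.1 h
  rw [mem_pn] at hy
  obtain ⟨v, hv⟩ := exists_isPl (Ω := Ω) hp
  have := y.isPrime
  have hmem : ((p : ℕ) : 𝓞 E) ∈ y.asIdeal := by
    have := rc_mem y
    rwa [nm_eq_rc (by rw [hy]; exact hp), hy] at this
  obtain ⟨g, hg⟩ := exists_pid hv E y.asIdeal hmem
  refine ⟨pull v g, hv.pull g, ?_⟩
  refine Eq.trans ?_ hy
  show Ideal.absNorm ((hv.pull g).pid E) = _
  rw [hg]

theorem claimC {Y M : Subgroup (Ω ≃ₐ[ℚ] Ω)} (hY : Op Y) (hM : Op M) (hMn : M.Normal) (hMY : M < Y) :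
    ∃ (p : ℕ) (v : AbsoluteValue Ω ℝ), IsPl p v ∧ p ≠ 2 ∧ Dec v ≤ Y ∧ ¬ Dec v ≤ M := by
  by_contra hcon
  push Not at hcon
  have := finiteDimensional_of_open hY
  have := finiteDimensional_of_open hM
  obtain ⟨Bad, h2, hBad⟩ := deg_one Y hY (fixedField Y) rfl
  refine an1 (fixedField Y) (fixedField M) Bad fun p hp hpb => ?_
  by_cases h0 : (pn (fixedField Y) p).card = 0
  · rw [h0]; simp
  obtain ⟨v, hv, hvn⟩ := exists_place_of_pn _ hp h0
  have h3 := hBad p v hv hpb hvn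
  have h4 := hcon p v hv (fun h => hpb (h ▸ h2)) h3
  have h5 := split_card hM hp (fixedField M) rfl (Split.of_normal hMn hv h4)
  have h6 := (pn_card_le (F := fixedField Y) hp).trans (finrank_le hY)
  refine le_trans ?_ h5
  have h7 : M.relIndex Y * Y.index = M.index := Subgroup.relIndex_mul_index hMY.le
  have h8 : M.relIndex Y ≠ 1 := fun h => not_le_of_gt hMY (Subgroup.relIndex_eq_one.1 h)
  have h9 : M.relIndex Y ≠ 0 := fun h => index_ne_zero hM (by rw [← h7, h, zero_mul])
  have h10 : 2 ≤ M.relIndex Y := by omega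
  rw [← h7]
  exact Nat.mul_le_mul h10 h6

theorem hex_all (V : Subgroup (Ω ≃ₐ[ℚ] Ω)) (hV : Op V) (S : Finset ℕ) :
    ∃ p, p ≠ 2 ∧ p ∉ S ∧ p.Prime ∧ Split V p := by
  have hV' : Op V.normalCore := by
    have := finite_quot hV
    have hfi : V.normalCore.FiniteIndex := by
      have : V.FiniteIndex := ⟨index_ne_zero hV⟩
      infer_instance
    have hc : IsClosed (V.normalCore : Set (Ω ≃ₐ[ℚ] Ω)) :=
      Subgroup.normalCore_isClosed V (Subgroup.isClosed_of_isOpen V hV)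
    exact Subgroup.isOpen_of_isClosed_of_finiteIndex _ hc
  have := finiteDimensional_of_open hV'
  obtain ⟨Bad, h2, hBad⟩ := deg_one V.normalCore hV' (fixedField V.normalCore) rfl
  obtain ⟨p, hp, hpb, h0⟩ := an2 (fixedField V.normalCore) (Bad ∪ S)
  rw [Finset.mem_union, not_or] at hpb
  obtain ⟨v, hv, hvn⟩ := exists_place_of_pn _ hp h0
  have h3 := hBad p v hv hpb.1 hvn
  refine ⟨p, fun h => hpb.1 (h ▸ h2), hpb.2, hp, ?_⟩
  exact (Split.of_normal inferInstance hv h3).mono (Subgroup.normalCore_le V)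

end ClaimC2

end NU

namespace NU

open IntermediateField NumberField IsDedekindDomain

section E2

variable {Ω : Type*} [Field Ω] [CharZero Ω] [Algebra.IsAlgebraic ℚ Ω] [IsAlgClosed Ω]
variable {p q : ℕ} {v w : AbsoluteValue Ω ℝ}
variable {A B U : Subgroup (Ω ≃ₐ[ℚ] Ω)}

theorem hex' (V : Subgroup (Ω ≃ₐ[ℚ] Ω)) (hV : Op V) : ∃ p, p ≠ 2 ∧ p.Prime ∧ Split V p := by
  obtain ⟨p, h1, -, h2, h3⟩ := hex_all V hV ∅
  exact ⟨p, h1, h2, h3⟩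

theorem open_core {V : Subgroup (Ω ≃ₐ[ℚ] Ω)} (hV : Op V) : Op V.normalCore := by
  have : V.FiniteIndex := ⟨index_ne_zero hV⟩
  have hc : IsClosed (V.normalCore : Set (Ω ≃ₐ[ℚ] Ω)) :=
    Subgroup.normalCore_isClosed V (Subgroup.isClosed_of_isOpen V hV)
  exact Subgroup.isOpen_of_isClosed_of_finiteIndex _ hc

theorem LI.tr_normal (e : LI A B) {N : Subgroup (Ω ≃ₐ[ℚ] Ω)} (hN : N.Normal) (hNo : Op N) (hNA : N ≤ A) :
    e.tr N = N := by
  have hNo' : Op (e.tr N) := e.tr_open hNo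
  have hMo := open_core (hNo.inf hNo')
  have hMN : (N ⊓ e.tr N).normalCore ≤ N := (Subgroup.normalCore_le _).trans inf_le_left
  have hMeq : (N ⊓ e.tr N).normalCore = N := by
    by_contra hne
    obtain ⟨p, v, hv, hp2, h1, h2⟩ := claimC hNo hMo inferInstance (lt_of_le_of_ne hMN hne)
    have h3 := Split.of_normal hN hv h1
    have h4 := e.split_tr hex' hNA hNo hp2 hv.prime h3
    have h5 : Split (N ⊓ e.tr N) p := fun w hw => le_inf (h3 w hw) (h4 w hw)
    exact h2 (h5.normalCore v hv)
  have hle : N ≤ e.tr N := by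
    conv_lhs => rw [← hMeq]
    exact (Subgroup.normalCore_le _).trans inf_le_right
  have hidx := e.index_tr hex' hNA hNo
  refine le_antisymm ?_ hle
  have h7 := Subgroup.relIndex_mul_index hle
  rw [hidx] at h7
  have h8 : N.relIndex (e.tr N) = 1 := by
    have := index_ne_zero hNo
    exact Nat.eq_of_mul_eq_mul_right (Nat.pos_of_ne_zero this) (by rw [h7, one_mul])
  exact Subgroup.relIndex_eq_one.1 h8

theorem LI.conj (e : LI A B) {M : Subgroup (Ω ≃ₐ[ℚ] Ω)} (hM : M.Normal) (hMo : Op M) (hMA : M ≤ A)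
    (a : A) (ha : (a : Ω ≃ₐ[ℚ] Ω) * a ∈ M) :
    ∃ g : Ω ≃ₐ[ℚ] Ω, (a : Ω ≃ₐ[ℚ] Ω)⁻¹ * (g * (e.e a) * g⁻¹) ∈ M := by
  have htr := e.tr_normal hM hMo hMA
  by_cases haM : (a : Ω ≃ₐ[ℚ] Ω) ∈ M
  · refine ⟨1, M.mul_mem (M.inv_mem haM) ?_⟩
    have : ((e.e a : B) : Ω ≃ₐ[ℚ] Ω) ∈ e.tr M := e.apply_mem.2 haM
    rw [htr] at this
    simpa using this
  let Y : Subgroup (Ω ≃ₐ[ℚ] Ω) := (Subgroup.zpowers (QuotientGroup.mk' M a)).comap (QuotientGroup.mk' M)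
  have hY : ∀ x ∈ Y, x ∉ M → (a : Ω ≃ₐ[ℚ] Ω)⁻¹ * x ∈ M := by
    intro x hx hxM
    obtain ⟨k, hk⟩ := Subgroup.mem_zpowers_iff.1 (Subgroup.mem_comap.1 hx)
    have h2 : (QuotientGroup.mk' M a) * (QuotientGroup.mk' M a) = 1 := by
      rw [← map_mul]; exact (QuotientGroup.eq_one_iff _).2 ha
    rcases Int.even_or_odd' k with ⟨m, rfl | rfl⟩
    · exfalso
      rw [zpow_mul, zpow_two, h2, one_zpow] at hk
      exact hxM ((QuotientGroup.eq_one_iff _).1 hk.symm)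
    · rw [zpow_add, zpow_mul, zpow_two, h2, one_zpow, one_mul, zpow_one] at hk
      exact QuotientGroup.eq.1 hk
  have hMY : M ≤ Y := fun x hx => by
    rw [Subgroup.mem_comap]
    have : QuotientGroup.mk' M x = 1 := (QuotientGroup.eq_one_iff _).2 hx
    rw [this]; exact one_mem _
  have haY : (a : Ω ≃ₐ[ℚ] Ω) ∈ Y := Subgroup.mem_zpowers _
  have hYo : Op Y := Subgroup.isOpen_mono hMY hMo
  have hYA : Y ≤ A := by
    intro x hx
    by_cases hxM : x ∈ M
    · exact hMA hxM
    have := A.mul_mem a.2 (hMA (hY x hx hxM))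
    simpa using this
  obtain ⟨p, v, hv, hp2, h1, h2⟩ := claimC hYo hMo hM (lt_of_le_of_ne hMY (fun h => haM (h ▸ haY)))
  obtain ⟨d, hd, hdM⟩ := Set.not_subset.1 h2
  have hdY := h1 hd
  obtain ⟨w, hw, hcor⟩ := e.cor hp2 hv
  obtain ⟨g, hg⟩ := trans_all hv hw
  have h3 : ((e.e ⟨d, hYA hdY⟩ : B) : Ω ≃ₐ[ℚ] Ω) ∈ Dec w :=
    (e.cor_dec hp2 hv hp2 hw hcor ⟨d, hYA hdY⟩).2 hd
  rw [← hg, mem_Dec_pull] at h3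
  have h4 := h1 h3
  have h5 : ((e.e ⟨d, hYA hdY⟩ : B) : Ω ≃ₐ[ℚ] Ω) ∉ M := by
    intro h
    rw [← htr, e.apply_mem] at h
    exact hdM h
  have h6 : g * ((e.e ⟨d, hYA hdY⟩ : B) : Ω ≃ₐ[ℚ] Ω) * g⁻¹ ∉ M := by
    intro h
    apply h5
    have := hM.conj_mem _ h g⁻¹
    simpa [mul_assoc] using this
  have h7 := hY _ h4 h6
  refine ⟨g, ?_⟩
  have h8 : ((e.e (⟨d, hYA hdY⟩⁻¹ * a) : B) : Ω ≃ₐ[ℚ] Ω) ∈ M := by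
    rw [← htr, e.apply_mem]
    have := M.inv_mem (hY d hdY hdM)
    simpa using this
  have h9 := M.mul_mem h7 (hM.conj_mem _ h8 g)
  simpa [mul_assoc] using h9

end E2

end NU

namespace NU

open IntermediateField NumberField IsDedekindDomain

section E3

variable {Ω : Type*} [Field Ω] [CharZero Ω] [Algebra.IsAlgebraic ℚ Ω] [IsAlgClosed Ω]
variable {p q : ℕ} {v w : AbsoluteValue Ω ℝ}
variable {A B U : Subgroup (Ω ≃ₐ[ℚ] Ω)}

theorem exists_x {N : Subgroup (Ω ≃ₐ[ℚ] Ω)} (hN : N.Normal) (hNo : Op N) (hv : IsPl p v) (hw : IsPl q w)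
    (hpq : p ≠ q) (hd : Dec v ≤ N) {π : Ω} (hπ : π ∈ fixedField N) (h0 : 0 < v π) (h1 : v π < 1) :
    ∃ x ∈ fixedField N, v x = v π ∧ (∀ σ ∉ N, v (σ x - 1) < 1) ∧ ∀ σ : Ω ≃ₐ[ℚ] Ω, w (σ x - 1) < 1 := by
  classical
  have := finite_quot hNo
  let t : Bool × ((Ω ≃ₐ[ℚ] Ω) ⧸ N) → Ω := fun i => if i.1 = true ∧ i.2 = 1 then π else 1
  let V : Bool × ((Ω ≃ₐ[ℚ] Ω) ⧸ N) → AbsoluteValue Ω ℝ := fun i =>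
    pull (if i.1 = true then v else w) (Quotient.out i.2)
  have hdiff : ∀ g h, (∀ x ∈ fixedField N, pull v g x = pull w h x) → False := by
    intro g h hgh
    apply hpq
    refine hw.p_unique hv.prime ?_
    have := hgh p (_root_.natCast_mem _ p)
    rw [pull_apply, pull_apply, map_natCast g, map_natCast h] at this
    rw [← this]; exact hv.vp_lt
  have hsame : ∀ g h, (∀ x ∈ fixedField N, pull v g x = pull v h x) →
      (g : (Ω ≃ₐ[ℚ] Ω) ⧸ N) = h := by
    intro g h hgh
    obtain ⟨n, hn, hgn⟩ := trans_H (Subgroup.isClosed_of_isOpen N hNo) (hv.pull g) (hv.pull h) hgh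
    have h2 : g * n * h⁻¹ ∈ N := hd (by
      rw [mem_Dec, pull_mul, pull_mul, hgn, ← pull_mul, mul_inv_cancel, pull_one])
    have h3 := (QuotientGroup.eq_one_iff _).2 h2
    have h4 := (QuotientGroup.eq_one_iff _).2 hn
    rw [QuotientGroup.mk_mul, QuotientGroup.mk_mul, h4, mul_one, QuotientGroup.mk_inv,
      mul_inv_eq_one] at h3
    exact h3
  obtain ⟨x, hx, hxt⟩ := weak_approx (fixedField N) V (by
      rintro ⟨i, c⟩
      cases i
      · exact ⟨q, hw.pull _⟩
      · exact ⟨p, hv.pull _⟩) t (by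
      intro i
      simp only [t]
      split_ifs
      · exact hπ
      · exact one_mem _) (by
      rintro ⟨i, c⟩ ⟨j, d⟩ hij
      cases i <;> cases j
      · simp [t]
      · exact (hdiff (Quotient.out d) (Quotient.out c) fun x hx => (hij x hx).symm).elim
      · exact (hdiff _ _ hij).elim
      · have := hsame _ _ hij
        rw [QuotientGroup.out_eq', QuotientGroup.out_eq'] at this
        have h6 : c = d := this
        rw [h6]) h0
  have hfix : ∀ (σ : Ω ≃ₐ[ℚ] Ω), ∀ y ∈ fixedField N, (Quotient.out (σ : (Ω ≃ₐ[ℚ] Ω) ⧸ N)) y = σ y := by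
    intro σ y hy
    obtain ⟨n, hn⟩ := QuotientGroup.mk_out_eq_mul N σ
    have h5 : (Quotient.out (σ : (Ω ≃ₐ[ℚ] Ω) ⧸ N)) = σ * n := hn
    rw [h5, AlgEquiv.mul_apply, mem_fixedField'.1 hy n n.2]
  refine ⟨x, hx, ?_, fun σ hσ => ?_, fun σ => ?_⟩
  · have h5 : v ((Quotient.out ((1 : Ω ≃ₐ[ℚ] Ω) : (Ω ≃ₐ[ℚ] Ω) ⧸ N))
        (x - t (true, ((1 : Ω ≃ₐ[ℚ] Ω) : (Ω ≃ₐ[ℚ] Ω) ⧸ N)))) < v π :=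
      hxt (true, ((1 : Ω ≃ₐ[ℚ] Ω) : (Ω ≃ₐ[ℚ] Ω) ⧸ N))
    have h6 : t (true, ((1 : Ω ≃ₐ[ℚ] Ω) : (Ω ≃ₐ[ℚ] Ω) ⧸ N)) = π := if_pos ⟨rfl, rfl⟩
    rw [h6, hfix _ _ (sub_mem hx hπ), AlgEquiv.one_apply] at h5
    exact hv.eq_of_sub_lt h5
  · have h5 : v ((Quotient.out (σ : (Ω ≃ₐ[ℚ] Ω) ⧸ N))
        (x - t (true, (σ : (Ω ≃ₐ[ℚ] Ω) ⧸ N)))) < v π := hxt (true, (σ : (Ω ≃ₐ[ℚ] Ω) ⧸ N))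
    have h6 : t (true, (σ : (Ω ≃ₐ[ℚ] Ω) ⧸ N)) = 1 :=
      if_neg fun h => hσ ((QuotientGroup.eq_one_iff _).1 h.2)
    rw [h6, hfix _ _ (sub_mem hx (one_mem _)), map_sub, map_one] at h5
    exact h5.trans h1
  · have h5 : w ((Quotient.out (σ : (Ω ≃ₐ[ℚ] Ω) ⧸ N))
        (x - t (false, (σ : (Ω ≃ₐ[ℚ] Ω) ⧸ N)))) < v π := hxt (false, (σ : (Ω ≃ₐ[ℚ] Ω) ⧸ N))
    have h6 : t (false, (σ : (Ω ≃ₐ[ℚ] Ω) ⧸ N)) = 1 := by simp [t]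
    rw [h6, hfix _ _ (sub_mem hx (one_mem _)), map_sub, map_one] at h5
    exact h5.trans h1

/-- the set of conjugates of `x` whose square roots are moved by `a` -/
def Fl (x : Ω) (a : Ω ≃ₐ[ℚ] Ω) : Set (Ω ≃ₐ[ℚ] Ω) := {σ | ∃ y, y ^ 2 = σ x ∧ a y ≠ y}

theorem mem_Fl {x : Ω} {a σ : Ω ≃ₐ[ℚ] Ω} : σ ∈ Fl x a ↔ ∃ y, y ^ 2 = σ x ∧ a y ≠ y := Iff.rfl

theorem not_mem_Fl {x : Ω} {a σ : Ω ≃ₐ[ℚ] Ω} : σ ∉ Fl x a ↔ ∀ y, y ^ 2 = σ x → a y = y := by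
  rw [mem_Fl]; push Not; rfl

theorem Fl_conj1 {x : Ω} {a g σ : Ω ≃ₐ[ℚ] Ω} (h : σ ∈ Fl x a) : g * σ ∈ Fl x (g * a * g⁻¹) := by
  obtain ⟨y, hy, hay⟩ := h
  refine ⟨g y, ?_, ?_⟩
  · rw [← map_pow, hy]; rfl
  · intro h
    apply hay
    have h2 : (g * a * g⁻¹) (g y) = g (a y) := by
      show g (a (g.symm (g y))) = g (a y)
      rw [g.symm_apply_apply]
    rw [h2] at h
    exact g.injective h

theorem Fl_conj {x : Ω} {a g σ : Ω ≃ₐ[ℚ] Ω} : g * σ ∈ Fl x (g * a * g⁻¹) ↔ σ ∈ Fl x a := by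
  refine ⟨fun h => ?_, Fl_conj1⟩
  have := Fl_conj1 (g := g⁻¹) h
  simpa [mul_assoc] using this

theorem Fl_mul_left {x : Ω} {a b σ : Ω ≃ₐ[ℚ] Ω} (h : σ ∉ Fl x b) : σ ∈ Fl x (a * b) ↔ σ ∈ Fl x a := by
  rw [not_mem_Fl] at h
  constructor
  · rintro ⟨y, hy, h2⟩
    rw [AlgEquiv.mul_apply, h y hy] at h2
    exact ⟨y, hy, h2⟩
  · rintro ⟨y, hy, h2⟩
    refine ⟨y, hy, ?_⟩
    rwa [AlgEquiv.mul_apply, h y hy]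

theorem fix_conj {N : Subgroup (Ω ≃ₐ[ℚ] Ω)} (hN : N.Normal) {x : Ω} (hx : x ∈ fixedField N)
    {b : Ω ≃ₐ[ℚ] Ω} (hb : b ∈ N) (σ : Ω ≃ₐ[ℚ] Ω) : b (σ x) = σ x := by
  have h1 := hN.conj_mem b hb σ⁻¹
  have h2 := mem_fixedField'.1 hx _ h1
  have h3 : σ ((σ⁻¹ * b * σ⁻¹⁻¹) x) = b (σ x) := by
    rw [inv_inv]
    exact σ.apply_symm_apply _
  rw [h2] at h3
  exact h3.symm

theorem Fl_mul_right {N : Subgroup (Ω ≃ₐ[ℚ] Ω)} (hN : N.Normal) {x : Ω} (hx : x ∈ fixedField N)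
    {a b σ : Ω ≃ₐ[ℚ] Ω} (hb : b ∈ N) (h : σ ∉ Fl x a) : σ ∈ Fl x (a * b) ↔ σ ∈ Fl x b := by
  rw [not_mem_Fl] at h
  have h2 : ∀ y, y ^ 2 = σ x → (a * b) y = b y := fun y hy =>
    h (b y) (by rw [← map_pow, hy, fix_conj hN hx hb])
  constructor
  · rintro ⟨y, hy, h3⟩
    rw [h2 y hy] at h3
    exact ⟨y, hy, h3⟩
  · rintro ⟨y, hy, h3⟩
    refine ⟨y, hy, ?_⟩
    rwa [h2 y hy]

/-- an element flipping only the square root of `x` -/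
theorem exists_flip {N : Subgroup (Ω ≃ₐ[ℚ] Ω)} (hN : N.Normal) (hNo : Op N) (hv : IsPl p v) (hp : p ≠ 2)
    {x x' π : Ω} (hx : x ∈ fixedField N) (hx' : x' ∈ fixedField N) (h0 : 0 < v π) (h1 : v π < 1)
    (hdisc : ∀ x ∈ fixedField N, x ≠ 0 → ∃ n : ℤ, v x = v π ^ n)
    (hvx : v x = v π) (hx1 : ∀ σ ∉ N, v (σ x - 1) < 1) (hx2 : ∀ σ : Ω ≃ₐ[ℚ] Ω, v (σ x' - 1) < 1) :
    ∃ a ∈ N, (∀ σ, σ ∈ Fl x a ↔ σ ∈ N) ∧ ∀ σ, σ ∉ Fl x' a := by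
  have := finiteDimensional_of_open hNo
  have hDF : fixedField (Dec v ⊓ N) = DF v (fixedField N) := Dec_inf_open hNo
  have hmem : ∀ z ∈ fixedField N, ∀ σ : Ω ≃ₐ[ℚ] Ω, σ z ∈ fixedField N := fun z hz σ =>
    mem_fixedField'.2 fun b hb => fix_conj hN hz hb σ
  have hroot : ∀ z ∈ fixedField N, v (z - 1) < 1 → ∀ y, y ^ 2 = z → ∀ a ∈ Dec v ⊓ N, a y = y := by
    intro z hz hz1 y hy a ha
    obtain ⟨u, hu, huz⟩ := DF_root (fixedField N) hv Nat.prime_two hp.symm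
      (le_DF v (fixedField N) hz) hz1
    rw [← hDF] at hu
    have hau := mem_fixedField'.1 hu a ha
    rcases sq_eq_sq_iff_eq_or_eq_neg.1 (hy.trans huz.symm) with h | h
    · rw [h, hau]
    · rw [h, map_neg, hau]
  obtain ⟨y, hy⟩ := IsAlgClosed.exists_pow_nat_eq x (n := 2) (by norm_num)
  have hy0 : y ≠ 0 := by
    rintro rfl
    rw [← hy] at hvx
    simp at hvx
    exact h0.ne hvx
  have hyn : y ∉ fixedField (Dec v ⊓ N) := by
    intro h
    rw [hDF] at h
    obtain ⟨n, hn⟩ := DF_val (fixedField N) hv hdisc h hy0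
    rw [← hy, map_pow, hn, ← zpow_natCast, ← zpow_mul] at hvx
    have := zpow_inj' h0 h1 (hvx.trans (zpow_one _).symm)
    omega
  rw [mem_fixedField'] at hyn
  push Not at hyn
  obtain ⟨a, ha, hay⟩ := hyn
  refine ⟨a, ha.2, fun σ => ⟨fun h => ?_, fun h => ?_⟩, fun σ => ?_⟩
  · by_contra hσ
    obtain ⟨z, hz, hza⟩ := h
    exact hza (hroot _ (hmem x hx σ) (hx1 σ hσ) z hz a ha)
  · exact ⟨y, by rw [hy, mem_fixedField'.1 hx σ h], hay⟩
  · rw [not_mem_Fl]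
    exact fun z hz => hroot _ (hmem x' hx' σ) (hx2 σ) z hz a ha

end E3

end NU

namespace NU

open IntermediateField NumberField IsDedekindDomain

section E4

variable {Ω : Type*} [Field Ω] [CharZero Ω] [Algebra.IsAlgebraic ℚ Ω] [IsAlgClosed Ω]
variable {p q : ℕ} {v w : AbsoluteValue Ω ℝ}
variable {A B U : Subgroup (Ω ≃ₐ[ℚ] Ω)}

/-- elements of `N` moving no square root of a conjugate of `x` or `x'` -/
def MM (N : Subgroup (Ω ≃ₐ[ℚ] Ω)) (x x' : Ω) : Subgroup (Ω ≃ₐ[ℚ] Ω) where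
  carrier := {a | a ∈ N ∧ ∀ σ, σ ∉ Fl x a ∧ σ ∉ Fl x' a}
  one_mem' := ⟨N.one_mem, fun σ => ⟨not_mem_Fl.2 fun _ _ => rfl, not_mem_Fl.2 fun _ _ => rfl⟩⟩
  mul_mem' := by
    rintro a b ⟨ha, ha'⟩ ⟨hb, hb'⟩
    exact ⟨N.mul_mem ha hb, fun σ => ⟨fun h => (ha' σ).1 ((Fl_mul_left (hb' σ).1).1 h),
      fun h => (ha' σ).2 ((Fl_mul_left (hb' σ).2).1 h)⟩⟩
  inv_mem' := by
    rintro a ⟨ha, ha'⟩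
    have key : ∀ y : Ω, a y = y → a⁻¹ y = y := by
      intro y hy
      conv_lhs => rw [← hy]
      exact a.symm_apply_apply y
    exact ⟨N.inv_mem ha, fun σ => ⟨not_mem_Fl.2 fun y hy => key y (not_mem_Fl.1 (ha' σ).1 y hy),
      not_mem_Fl.2 fun y hy => key y (not_mem_Fl.1 (ha' σ).2 y hy)⟩⟩

variable {N : Subgroup (Ω ≃ₐ[ℚ] Ω)} {x x' : Ω}

theorem mem_MM {a : Ω ≃ₐ[ℚ] Ω} : a ∈ MM N x x' ↔ a ∈ N ∧ ∀ σ, σ ∉ Fl x a ∧ σ ∉ Fl x' a := Iff.rfl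

theorem MM_normal (hN : N.Normal) : (MM N x x').Normal := by
  refine ⟨fun a ha g => ⟨hN.conj_mem a ha.1 g, fun σ => ?_⟩⟩
  have h1 := ha.2 (g⁻¹ * σ)
  rw [← Fl_conj (g := g), ← Fl_conj (x := x') (g := g), mul_inv_cancel_left] at h1
  exact h1

theorem MM_open (hNo : Op N) : Op (MM N x x') := by
  classical
  obtain ⟨y, hy⟩ := IsAlgClosed.exists_pow_nat_eq x (n := 2) (by norm_num)
  obtain ⟨y', hy'⟩ := IsAlgClosed.exists_pow_nat_eq x' (n := 2) (by norm_num)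
  obtain ⟨V, hV, hVo, hVs⟩ := exists_open_normal ({y, y'} : Finset Ω)
  refine Subgroup.isOpen_mono (H₁ := V ⊓ N) ?_ (Op.inf hVo hNo)
  rintro a ⟨ha, haN⟩
  have key : ∀ u z : Ω, u ∈ ({y, y'} : Finset Ω) → u ^ 2 = z → ∀ σ, σ ∉ Fl z a := by
    intro u z hu hz σ
    rw [not_mem_Fl]
    intro t ht
    have hu' : u ∈ fixedField V := mem_fixedField'.2 fun g hg => hVs g hg u hu
    have h2 := fix_conj hV hu' ha σ
    rw [← hz, map_pow] at ht
    rcases sq_eq_sq_iff_eq_or_eq_neg.1 ht with h | h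
    · rw [h, h2]
    · rw [h, map_neg, h2]
  exact ⟨haN, fun σ => ⟨key y x (by simp) hy σ, key y' x' (by simp) hy' σ⟩⟩

theorem MM_sq (hN : N.Normal) (hx : x ∈ fixedField N) (hx' : x' ∈ fixedField N) {a : Ω ≃ₐ[ℚ] Ω}
    (ha : a ∈ N) : a * a ∈ MM N x x' := by
  have key : ∀ z ∈ fixedField N, ∀ σ, σ ∉ Fl z (a * a) := by
    intro z hz σ
    rw [not_mem_Fl]
    intro y hy
    have h1 : (a y) ^ 2 = y ^ 2 := by rw [← map_pow, hy, fix_conj hN hz ha]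
    rw [AlgEquiv.mul_apply]
    rcases sq_eq_sq_iff_eq_or_eq_neg.1 h1 with h | h
    · rw [h, h]
    · rw [h, map_neg, h, neg_neg]
  exact ⟨N.mul_mem ha ha, fun σ => ⟨key x hx σ, key x' hx' σ⟩⟩

theorem MM_Fl {a b : Ω ≃ₐ[ℚ] Ω} (h : a⁻¹ * b ∈ MM N x x') (σ : Ω ≃ₐ[ℚ] Ω) :
    (σ ∈ Fl x b ↔ σ ∈ Fl x a) ∧ (σ ∈ Fl x' b ↔ σ ∈ Fl x' a) := by
  have hb : b = a * (a⁻¹ * b) := by group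
  rw [hb]
  exact ⟨Fl_mul_left (h.2 σ).1, Fl_mul_left (h.2 σ).2⟩

theorem LI.main_aux (e : LI A B) (hN : N.Normal) (hNo : Op N) (hNA : N ≤ A) :
    ∃ g : Ω ≃ₐ[ℚ] Ω, ∀ τ : A, ((τ : Ω ≃ₐ[ℚ] Ω) * g)⁻¹ * (g * e.e τ) ∈ N := by
  have htr := e.tr_normal hN hNo hNA
  have := finiteDimensional_of_open hNo
  obtain ⟨p, hp2, -, hp, hps⟩ := hex_all N hNo ∅
  obtain ⟨q, hq2, hqp, hq, hqs⟩ := hex_all N hNo {p}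
  have hpq : p ≠ q := fun h => hqp (by simp [h])
  obtain ⟨v, hv⟩ := exists_isPl (Ω := Ω) hp
  obtain ⟨w, hw⟩ := exists_isPl (Ω := Ω) hq
  obtain ⟨π, hπ, hπ0, hπ1, hπd⟩ := hv.discrete (fixedField N)
  obtain ⟨ρ, hρ, hρ0, hρ1, hρd⟩ := hw.discrete (fixedField N)
  obtain ⟨x, hx, hxv, hx1, hx2⟩ := exists_x hN hNo hv hw hpq (hps v hv) hπ hπ0 hπ1
  obtain ⟨x', hx', hxv', hx1', hx2'⟩ := exists_x hN hNo hw hv hpq.symm (hqs w hw) hρ hρ0 hρ1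
  obtain ⟨a, haN, ha1, ha2⟩ := exists_flip hN hNo hv hp2 hx hx' hπ0 hπ1 hπd hxv hx1 hx2'
  obtain ⟨b, hbN, hb1, hb2⟩ := exists_flip hN hNo hw hq2 hx' hx hρ0 hρ1 hρd hxv' hx1' hx2
  have hM := MM_normal (x := x) (x' := x') hN
  have hMo := MM_open (x := x) (x' := x') hNo
  have hMA : MM N x x' ≤ A := fun c hc => hNA hc.1
  -- the transport of a pair of supports
  have key : ∀ c : A, (c : Ω ≃ₐ[ℚ] Ω) ∈ N → ∃ g : Ω ≃ₐ[ℚ] Ω, ∀ σ,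
      (σ ∈ Fl x (e.e c : Ω ≃ₐ[ℚ] Ω) ↔ g * σ ∈ Fl x (c : Ω ≃ₐ[ℚ] Ω)) ∧
      (σ ∈ Fl x' (e.e c : Ω ≃ₐ[ℚ] Ω) ↔ g * σ ∈ Fl x' (c : Ω ≃ₐ[ℚ] Ω)) := by
    intro c hc
    obtain ⟨g, hg⟩ := e.conj hM hMo hMA c (MM_sq hN hx hx' hc)
    refine ⟨g, fun σ => ?_⟩
    have := MM_Fl hg (g * σ)
    rw [Fl_conj, Fl_conj] at this
    exact this
  have heN : ∀ c : A, (c : Ω ≃ₐ[ℚ] Ω) ∈ N → (e.e c : Ω ≃ₐ[ℚ] Ω) ∈ N := by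
    intro c hc
    have := (e.apply_mem (H := N)).2 hc
    rwa [htr] at this
  let a' : A := ⟨a, hNA haN⟩
  let b' : A := ⟨b, hNA hbN⟩
  obtain ⟨ga, hga⟩ := key a' haN
  obtain ⟨gb, hgb⟩ := key b' hbN
  have hea : ∀ σ, σ ∈ Fl x (e.e a' : Ω ≃ₐ[ℚ] Ω) ↔ ga * σ ∈ N := fun σ => (hga σ).1.trans (ha1 _)
  have hea' : ∀ σ, σ ∉ Fl x' (e.e a' : Ω ≃ₐ[ℚ] Ω) := fun σ h => ha2 _ ((hga σ).2.1 h)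
  have heb : ∀ σ, σ ∈ Fl x' (e.e b' : Ω ≃ₐ[ℚ] Ω) ↔ gb * σ ∈ N := fun σ => (hgb σ).2.trans (hb1 _)
  have heb' : ∀ σ, σ ∉ Fl x (e.e b' : Ω ≃ₐ[ℚ] Ω) := fun σ h => hb2 _ ((hgb σ).1.1 h)
  have hFlc : ∀ (z : Ω) (g c σ : Ω ≃ₐ[ℚ] Ω), σ ∈ Fl z (g * c * g⁻¹) ↔ g⁻¹ * σ ∈ Fl z c := by
    intro z g c σ
    rw [← Fl_conj (g := g) (a := c), mul_inv_cancel_left]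
  have main : ∀ τ : A, ga * (e.e τ : Ω ≃ₐ[ℚ] Ω)⁻¹ * gb⁻¹ * τ ∈ N := by
    intro τ
    let c : A := τ * a' * τ⁻¹ * b'
    have hc0 : (c : Ω ≃ₐ[ℚ] Ω) = τ * a * (τ : Ω ≃ₐ[ℚ] Ω)⁻¹ * b := rfl
    have hc1 : (τ : Ω ≃ₐ[ℚ] Ω) * a * (τ : Ω ≃ₐ[ℚ] Ω)⁻¹ ∈ N := hN.conj_mem a haN τ
    have hcN : (c : Ω ≃ₐ[ℚ] Ω) ∈ N := N.mul_mem hc1 hbN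
    obtain ⟨h, hh⟩ := key c hcN
    have hec : (e.e c : Ω ≃ₐ[ℚ] Ω) = (e.e τ : Ω ≃ₐ[ℚ] Ω) * (e.e a' : Ω ≃ₐ[ℚ] Ω) *
        (e.e τ : Ω ≃ₐ[ℚ] Ω)⁻¹ * (e.e b' : Ω ≃ₐ[ℚ] Ω) := by
      simp [c]
    have hx1c : ∀ σ, σ ∈ Fl x (c : Ω ≃ₐ[ℚ] Ω) ↔ (τ : Ω ≃ₐ[ℚ] Ω)⁻¹ * σ ∈ N := by
      intro σ
      rw [hc0, Fl_mul_left (hb2 σ), hFlc, ha1]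
    have hx2c : ∀ σ, σ ∈ Fl x' (c : Ω ≃ₐ[ℚ] Ω) ↔ σ ∈ N := by
      intro σ
      rw [hc0, Fl_mul_right hN hx' hbN, hb1]
      rw [hFlc]; exact ha2 _
    have hx1e : ∀ σ, σ ∈ Fl x (e.e c : Ω ≃ₐ[ℚ] Ω) ↔ ga * ((e.e τ : Ω ≃ₐ[ℚ] Ω)⁻¹ * σ) ∈ N := by
      intro σ
      rw [hec, Fl_mul_left (heb' σ), hFlc, hea]
    have hx2e : ∀ σ, σ ∈ Fl x' (e.e c : Ω ≃ₐ[ℚ] Ω) ↔ gb * σ ∈ N := by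
      intro σ
      rw [hec, Fl_mul_right hN hx' (heN b' hbN), heb]
      rw [hFlc]; exact hea' _
    have h1 : ga * ((e.e τ : Ω ≃ₐ[ℚ] Ω)⁻¹ * (h⁻¹ * τ)) ∈ N := by
      rw [← hx1e, (hh _).1, hx1c]
      simp
    have h2 : gb * h⁻¹ ∈ N := by
      rw [← hx2e, (hh _).2, hx2c]
      simp
    have h3 : (gb * h⁻¹)⁻¹ ∈ N := N.inv_mem h2
    rw [← QuotientGroup.eq_one_iff] at h1 h2 ⊢
    simp only [QuotientGroup.mk_mul, QuotientGroup.mk_inv] at h1 h2 ⊢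
    rw [mul_inv_eq_one] at h2
    rw [h2, ← h1]
    simp only [mul_assoc]
  have hab := main 1
  refine ⟨ga, fun τ => ?_⟩
  have hτ := main τ
  rw [← QuotientGroup.eq_one_iff] at hab hτ ⊢
  simp only [QuotientGroup.mk_mul, QuotientGroup.mk_inv, map_one, OneMemClass.coe_one,
    inv_one, mul_one] at hab hτ ⊢
  rw [mul_inv_eq_one] at hab
  rw [← hab] at hτ
  have h4 := congrArg (fun z => z⁻¹) hτ
  simp only [mul_inv_rev, inv_inv, inv_one] at h4
  have h5 := congrArg (fun z => (ga : (Ω ≃ₐ[ℚ] Ω) ⧸ N)⁻¹ * z * ga) h4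
  simp only [mul_inv_rev] 
  simpa [mul_assoc] using h5

theorem LI.main (e : LI A B) : ∃ g : Ω ≃ₐ[ℚ] Ω, ∀ σ, σ ∈ B ↔ g * σ * g⁻¹ ∈ A := by
  set N := (A ⊓ B).normalCore with hNdef
  have hN : N.Normal := by rw [hNdef]; infer_instance
  have hNo : Op N := open_core (e.oA.inf e.oB)
  have hNA : N ≤ A := (Subgroup.normalCore_le _).trans inf_le_left
  have hNB : N ≤ B := (Subgroup.normalCore_le _).trans inf_le_right
  obtain ⟨g, hg⟩ := e.main_aux hN hNo hNA
  refine ⟨g, fun σ => ⟨fun h => ?_, fun h => ?_⟩⟩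
  · obtain ⟨τ, hτ⟩ := e.e.surjective ⟨σ, h⟩
    have h1 := hg τ
    rw [hτ] at h1
    have h2 := A.mul_mem τ.2 (hNA (hN.conj_mem _ h1 g))
    simpa [mul_assoc] using h2
  · have h1 := hg ⟨_, h⟩
    have h2 := B.mul_mem (e.e ⟨_, h⟩).2 (B.inv_mem (hNB h1))
    simpa [mul_assoc] using h2

theorem LI.field_iso (e : LI A B) : Nonempty (fixedField A ≃+* fixedField B) := by
  obtain ⟨g, hg⟩ := e.main
  have h1 : ∀ x ∈ fixedField A, g.symm x ∈ fixedField B := by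
    intro x hx
    rw [mem_fixedField']
    intro σ hσ
    have h2 := mem_fixedField'.1 hx _ ((hg σ).1 hσ)
    have h3 : g (σ (g.symm x)) = x := h2
    rw [← g.injective.eq_iff, h3, g.apply_symm_apply]
  have h2 : ∀ x ∈ fixedField B, g x ∈ fixedField A := by
    intro x hx
    rw [mem_fixedField']
    intro σ hσ
    have h2 : g⁻¹ * σ * g ∈ B := by rw [hg]; simpa [mul_assoc] using hσ
    have h3 : g.symm (σ (g x)) = x := mem_fixedField'.1 hx _ h2
    rw [← g.symm.injective.eq_iff, h3, g.symm_apply_apply]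
  exact ⟨{ toFun := fun x => ⟨g.symm x, h1 x x.2⟩
           invFun := fun x => ⟨g x, h2 x x.2⟩
           left_inv := fun x => Subtype.ext (g.apply_symm_apply _)
           right_inv := fun x => Subtype.ext (g.symm_apply_apply _)
           map_mul' := fun x y => Subtype.ext (map_mul g.symm _ _)
           map_add' := fun x y => Subtype.ext (map_add g.symm _ _) }⟩

end E4

end NU

namespace NU

open IntermediateField NumberField IsDedekindDomain Topology

section Transport

theorem cont_of_stab {G K L : Type*} [Group G] [TopologicalSpace G] [IsTopologicalGroup G]
    [Field K] [Field L] [Algebra K L] (f : G →* (L ≃ₐ[K] L))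
    (h : ∀ x : L, IsOpen {g : G | f g x = x}) : Continuous f := by
  refine continuous_of_continuousAt_one f ?_
  rw [ContinuousAt, map_one]
  intro S hS
  obtain ⟨E, hE, hES⟩ := (krullTopology_mem_nhds_one_iff K L S).1 hS
  let b := Module.finBasis K E
  have hopen : IsOpen (⋂ i, {g : G | f g (b i : L) = b i}) := isOpen_iInter_of_finite fun i => h _
  have hmem : (1 : G) ∈ (⋂ i, {g : G | f g (b i : L) = b i}) := by
    rw [Set.mem_iInter]; intro i
    show f 1 (b i : L) = b i
    rw [map_one]; rfl
  rw [Filter.mem_map]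
  refine Filter.mem_of_superset (hopen.mem_nhds hmem) ?_
  intro g hg
  show f g ∈ S
  apply hES
  rw [Set.mem_iInter] at hg
  show f g ∈ E.fixingSubgroup
  rw [IntermediateField.mem_fixingSubgroup_iff]
  intro x hx
  have h1 : (f g).toLinearMap.comp E.val.toLinearMap = E.val.toLinearMap :=
    b.ext fun i => hg i
  exact LinearMap.congr_fun h1 (⟨x, hx⟩ : E)

variable {Ω : Type*} [Field Ω] [CharZero Ω] [Algebra.IsAlgebraic ℚ Ω] [IsAlgClosed Ω]

theorem gal_model (K : Type*) [Field K] [NumberField K] (φ : AlgebraicClosure K ≃+* Ω) :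
    ∃ A : Subgroup (Ω ≃ₐ[ℚ] Ω), Op A ∧ ∃ c : (AlgebraicClosure K ≃ₐ[K] AlgebraicClosure K) ≃* A,
      Continuous c ∧ Continuous c.symm ∧ Nonempty (fixedField A ≃+* K) := by
  let ι : K →+* Ω := φ.toRingHom.comp (algebraMap K (AlgebraicClosure K))
  let ι' : K →ₐ[ℚ] Ω := ι.toRatAlgHom
  let E : IntermediateField ℚ Ω := ι'.fieldRange
  have hι : ∀ k, ι' k = φ (algebraMap K _ k) := fun k => rfl
  have hfd : FiniteDimensional ℚ E :=
    Module.Finite.equiv (AlgEquiv.ofInjectiveField ι').toLinearEquiv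
  have hmemE : ∀ x, x ∈ E ↔ ∃ k, φ (algebraMap K _ k) = x := fun x => Iff.rfl
  let toA : (AlgebraicClosure K ≃ₐ[K] AlgebraicClosure K) → (Ω ≃ₐ[ℚ] Ω) := fun σ =>
    AlgEquiv.ofRingEquiv (f := (φ.symm.trans σ.toRingEquiv).trans φ) (fun r => by simp)
  have htoA : ∀ σ x, toA σ x = φ (σ (φ.symm x)) := fun σ x => rfl
  let c : (AlgebraicClosure K ≃ₐ[K] AlgebraicClosure K) ≃* E.fixingSubgroup :=
    { toFun := fun σ => ⟨toA σ, by
        rw [mem_fixing]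
        intro x hx
        obtain ⟨k, rfl⟩ := (hmemE x).1 hx
        rw [htoA, φ.symm_apply_apply, σ.commutes]⟩
      invFun := fun g => AlgEquiv.ofRingEquiv (f := (φ.trans g.1.toRingEquiv).trans φ.symm) (fun k => by
        have h1 := mem_fixing.1 g.2 _ ((hmemE _).2 ⟨k, rfl⟩)
        show φ.symm (g.1 (φ _)) = _
        rw [h1, φ.symm_apply_apply])
      left_inv := fun σ => by
        ext x
        show φ.symm (φ (σ (φ.symm (φ x)))) = σ x
        simp
      right_inv := fun g => by
        refine Subtype.ext (AlgEquiv.ext fun x => ?_)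
        show φ (φ.symm (g.1 (φ (φ.symm x)))) = g.1 x
        simp
      map_mul' := fun σ τ => by
        refine Subtype.ext (AlgEquiv.ext fun x => ?_)
        show φ (σ (τ (φ.symm x))) = φ (σ (φ.symm (φ (τ (φ.symm x)))))
        simp }
  have hc1 : ∀ σ x, (c σ : Ω ≃ₐ[ℚ] Ω) x = φ (σ (φ.symm x)) := fun σ x => rfl
  have hc2 : ∀ g x, (c.symm g) x = φ.symm ((g : Ω ≃ₐ[ℚ] Ω) (φ x)) := fun σ x => rfl
  refine ⟨E.fixingSubgroup, IntermediateField.fixingSubgroup_isOpen E, c, ?_, ?_, ?_⟩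
  · refine Topology.IsInducing.subtypeVal.continuous_iff.2 ?_
    refine cont_of_stab (E.fixingSubgroup.subtype.comp c.toMonoidHom) fun x => ?_
    have h1 : {σ | (E.fixingSubgroup.subtype.comp c.toMonoidHom) σ x = x} =
        (MulAction.stabilizer (AlgebraicClosure K ≃ₐ[K] AlgebraicClosure K) (φ.symm x) : Set _) := by
      ext σ
      show φ (σ (φ.symm x)) = x ↔ σ (φ.symm x) = φ.symm x
      rw [RingEquiv.eq_symm_apply]
    rw [h1]
    exact stabilizer_isOpen_of_isIntegral _
  · refine cont_of_stab c.symm.toMonoidHom fun x => ?_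
    have h1 : {g | c.symm.toMonoidHom g x = x} = Subtype.val ⁻¹' {g : Ω ≃ₐ[ℚ] Ω | g (φ x) ∈ ({φ x} : Set Ω)} := by
      ext g
      show φ.symm ((g : Ω ≃ₐ[ℚ] Ω) (φ x)) = x ↔ (g : Ω ≃ₐ[ℚ] Ω) (φ x) = φ x
      rw [RingEquiv.symm_apply_eq]
    rw [h1]
    exact (isOpen_apply _ _).preimage continuous_subtype_val
  · rw [InfiniteGalois.fixedField_fixingSubgroup]
    exact ⟨(AlgEquiv.ofInjectiveField ι').symm.toRingEquiv⟩

theorem final (K L : Type) [Field K] [NumberField K] [Field L] [NumberField L]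
    (h : ∃ e : Field.absoluteGaloisGroup K ≃* Field.absoluteGaloisGroup L, Continuous e ∧ Continuous e.symm) :
    Nonempty (K ≃+* L) := by
  have hfact : ∀ (F : Type) [Field F] [NumberField F], Algebra.IsAlgebraic ℚ (AlgebraicClosure F) := by
    intro F _ _
    have h1 : Algebra.IsAlgebraic ℚ F := inferInstance
    exact Algebra.IsAlgebraic.trans ℚ F (AlgebraicClosure F)
  have hK := hfact K
  have hL := hfact L
  have c1 : IsAlgClosure ℚ (AlgebraicClosure K) := ⟨inferInstance, hK⟩
  have c2 : IsAlgClosure ℚ (AlgebraicClosure L) := ⟨inferInstance, hL⟩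
  let φ : AlgebraicClosure L ≃+* AlgebraicClosure K :=
    (IsAlgClosure.equiv ℚ (AlgebraicClosure L) (AlgebraicClosure K)).toRingEquiv
  obtain ⟨A, hA, a, ha1, ha2, ⟨rA⟩⟩ := gal_model K (RingEquiv.refl (AlgebraicClosure K))
  obtain ⟨B, hB, b, hb1, hb2, ⟨rB⟩⟩ := gal_model L φ
  obtain ⟨e, he1, he2⟩ := h
  let e' : (AlgebraicClosure K ≃ₐ[K] AlgebraicClosure K) ≃* (AlgebraicClosure L ≃ₐ[L] AlgebraicClosure L) := e
  have he1' : Continuous e' := he1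
  have he2' : Continuous e'.symm := he2
  let E : LI A B :=
    { e := (a.symm.trans e').trans b
      c1 := hb1.comp (he1'.comp ha2)
      c2 := ha1.comp (he2'.comp hb2)
      oA := hA
      oB := hB }
  obtain ⟨r⟩ := E.field_iso
  exact ⟨(rA.symm.trans r).trans rB⟩

end Transport

end NU

open Field

/-- **The Neukirch–Uchida theorem** (Neukirch 1969 for fields Galois over `ℚ`, Uchida 1976 in
general): two number fields whose absolute Galois groups (with the Krull topology) are
isomorphic as topological groups are isomorphic as fields. -/
theorem neukirch_uchida
    (K L : Type) [Field K] [NumberField K] [Field L] [NumberField L]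
    (h : ∃ e : absoluteGaloisGroup K ≃* absoluteGaloisGroup L,
      Continuous e ∧ Continuous e.symm) :
    Nonempty (K ≃+* L) := by
  exact NU.final K L h
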